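/- arXiv:0910.0936 — 2 statements merged into one kernel-verified Lean document; each statement's English description precedes it below -/
import Mathlib

section
/- Let r_n → 0. Assume (A1), (A2), (B1), (B2) and (C1). Then β(𝓕, r_n, α) ≥ Φ(H^{(α)} − u_n) + o(1) for every α ∈ (0,1) and γ(𝓕, r_n) ≥ 2Φ(−u_n/2) + o(1), where u_n is the value of the extremal problem u_n² = inf{ ½ Σ_{l∈𝓛} v_l⁴ : Σ_{l∈𝓛} v_l² ≥ n r_n², Σ_{l∈𝓛} c_l² v_l² ≤ n }. (Theorem 2, part (1): sharp lower bounds.) -/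
open MeasureTheory ProbabilityTheory Filter
open scoped BigOperators Topology

noncomputable section

/-- The uniform probability measure on the cube Δ = [0,1]^d. -/
def uniformCube (d : ℕ) : Measure (Fin d → ℝ) :=
  volume.restrict (Set.Icc (0 : Fin d → ℝ) 1)

/-- Law of a single observation (x, t) with x = f(t) + ξ, t uniform on Δ and,
conditionally on t, ξ ∼ N(0,1). -/
def obsLaw (d : ℕ) (f : (Fin d → ℝ) → ℝ) : Measure (ℝ × (Fin d → ℝ)) :=
  ((gaussianReal 0 1).prod (uniformCube d)).map fun p => (f p.2 + p.1, p.2)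

/-- Joint law P_{n,f} of the n i.i.d. observations z_i = (x_i, t_i). -/
def jointLaw (d n : ℕ) (f : (Fin d → ℝ) → ℝ) :
    Measure (Fin n → ℝ × (Fin d → ℝ)) :=
  Measure.pi fun _ => obsLaw d f

/-- A (randomized) test: a measurable [0,1]-valued function of the
observations. -/
def IsTest {d n : ℕ} (ψ : (Fin n → ℝ × (Fin d → ℝ)) → ℝ) : Prop :=
  Measurable ψ ∧ ∀ z, ψ z ∈ Set.Icc (0 : ℝ) 1

/-- Type I error probability α(ψ) = E_{n,0} ψ. -/
def typeI (d n : ℕ) (ψ : (Fin n → ℝ × (Fin d → ℝ)) → ℝ) : ℝ :=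
  ∫ z, ψ z ∂(jointLaw d n 0)

/-- Type II error probability E_{n,f}(1 − ψ) at a single f. -/
def typeII (d n : ℕ) (f : (Fin d → ℝ) → ℝ)
    (ψ : (Fin n → ℝ × (Fin d → ℝ)) → ℝ) : ℝ :=
  ∫ z, (1 - ψ z) ∂(jointLaw d n f)

/-- Maximal type II error probability β(F, ψ) = sup_{f ∈ F} E_{n,f}(1 − ψ). -/
def typeIImax (d n : ℕ) (F : Set ((Fin d → ℝ) → ℝ))
    (ψ : (Fin n → ℝ × (Fin d → ℝ)) → ℝ) : ℝ :=
  sSup ((fun f => typeII d n f ψ) '' F)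

/-- Minimax type II error probability β(F, α) at level α. -/
def minimaxTypeII (d n : ℕ) (F : Set ((Fin d → ℝ) → ℝ)) (α : ℝ) : ℝ :=
  sInf {x : ℝ | ∃ ψ, IsTest ψ ∧ typeI d n ψ ≤ α ∧ x = typeIImax d n F ψ}

/-- Minimax total error probability γ(F). -/
def minimaxTotal (d n : ℕ) (F : Set ((Fin d → ℝ) → ℝ)) : ℝ :=
  sInf {x : ℝ | ∃ ψ, IsTest ψ ∧ x = typeI d n ψ + typeIImax d n F ψ}

/-- The L₂(Δ)-norm ‖f‖. -/
def L2norm (d : ℕ) (f : (Fin d → ℝ) → ℝ) : ℝ :=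
  (∫ t, (f t) ^ 2 ∂(uniformCube d)) ^ (1 / 2 : ℝ)

/-- The ellipsoid 𝓕 = {f = Σ_l θ_l φ_l : Σ_l c_l² θ_l² ≤ 1}. -/
def ellipsoid {d : ℕ} {ι : Type*} (φ : ι → (Fin d → ℝ) → ℝ) (c : ι → ℝ) :
    Set ((Fin d → ℝ) → ℝ) :=
  {f | ∃ θ : ι → ℝ, (∀ t, f t = ∑' l, θ l * φ l t) ∧
    Summable (fun l => (c l) ^ 2 * (θ l) ^ 2) ∧
    ∑' l, (c l) ^ 2 * (θ l) ^ 2 ≤ 1}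

/-- The alternative 𝓕(r) = {f ∈ 𝓕 : ‖f‖ ≥ r}. -/
def altSet {d : ℕ} {ι : Type*} (φ : ι → (Fin d → ℝ) → ℝ) (c : ι → ℝ) (r : ℝ) :
    Set ((Fin d → ℝ) → ℝ) :=
  {f ∈ ellipsoid φ c | r ≤ L2norm d f}

/-- An orthonormal system in L₂(Δ). -/
def OrthonormalSystem {ι : Type*} [DecidableEq ι] (d : ℕ) (φ : ι → (Fin d → ℝ) → ℝ) : Prop :=
  ∀ j l, ∫ t, φ j t * φ l t ∂(uniformCube d) = if j = l then (1 : ℝ) else 0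

/-- N(C) = #{l : c_l < C}. -/
def Ncard {ι : Type*} (c : ι → ℝ) (C : ℝ) : ℕ := {l | c l < C}.ncard

/-- The standard Gaussian cumulative distribution function Φ. -/
def stdGaussCDF (x : ℝ) : ℝ := (gaussianReal 0 1 (Set.Iic x)).toReal

/-- Assumption (A2): Σ_{l ∈ 𝓝(C)} φ_l²(t) = N(C) for all C > 0 and t ∈ Δ. -/
def AssumptionA2 {ι : Type*} (d : ℕ) (φ : ι → (Fin d → ℝ) → ℝ) (c : ι → ℝ) : Prop :=
  ∀ C : ℝ, 0 < C → ∀ t ∈ Set.Icc (0 : Fin d → ℝ) 1,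
    ∑' l : {l | c l < C}, (φ l.1 t) ^ 2 = (Ncard c C : ℝ)

/-- The U-statistic U_n = (1/n) Σ_{1≤i<k≤n} x_i x_k G(t_i, t_k). -/
def Ustat {d : ℕ} (n : ℕ) (G : (Fin d → ℝ) → (Fin d → ℝ) → ℝ)
    (z : Fin n → ℝ × (Fin d → ℝ)) : ℝ :=
  (1 / (n : ℝ)) * ∑ i : Fin n, ∑ k ∈ Finset.Ioi i,
    (z i).1 * (z k).1 * G (z i).2 (z k).2

/-- The test ψ^H = 1{U > H} based on a U-statistic with kernel G. -/
def Utest {d : ℕ} (n : ℕ) (G : (Fin d → ℝ) → (Fin d → ℝ) → ℝ) (H : ℝ)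
    (z : Fin n → ℝ × (Fin d → ℝ)) : ℝ :=
  if H < Ustat n G z then 1 else 0

end

/-- a_n ≍ b_n. -/
def Asymp (A B : ℕ → ℝ) : Prop :=
  ∃ c₁ c₂ : ℝ, 0 < c₁ ∧ 0 < c₂ ∧ ∀ᶠ n in Filter.atTop, c₁ * B n ≤ A n ∧ A n ≤ c₂ * B n

/-- The value u_n²(b,B) of the extremal problem
`inf{½ Σ_l v_l⁴ : Σ_l v_l² ≥ n(Bρ)², Σ_l c_l² v_l² ≤ nb²}`. -/
noncomputable def extremalVal {ι : Type*} (c : ι → ℝ) (n : ℕ) (ρ b B : ℝ) : ℝ :=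
  sInf {x : ℝ | ∃ v : ι → ℝ,
    Summable (fun l => (v l) ^ 2) ∧
    Summable (fun l => (c l) ^ 2 * (v l) ^ 2) ∧
    Summable (fun l => (v l) ^ 4) ∧
    (n : ℝ) * (B * ρ) ^ 2 ≤ ∑' l, (v l) ^ 2 ∧
    ∑' l, (c l) ^ 2 * (v l) ^ 2 ≤ (n : ℝ) * b ^ 2 ∧
    x = (1 / 2 : ℝ) * ∑' l, (v l) ^ 4}

section Part1
open MeasureTheory ProbabilityTheory Filter
open scoped BigOperators Topology

lemma gm_integrable (k : ℕ) : Integrable (fun x : ℝ => x ^ k) (gaussianReal 0 1) := by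
  have h := memLp_id_gaussianReal (μ := 0) (v := 1) (k : NNReal)
  have := h.integrable_norm_pow'
  refine (integrable_norm_iff (by fun_prop)).1 ?_
  simpa [norm_pow] using this

lemma gm_pdf (k : ℕ) : Integrable (fun x : ℝ => x ^ k * gaussianPDFReal 0 1 x) := by
  have h := gm_integrable k
  rw [gaussianReal_of_var_ne_zero _ one_ne_zero] at h
  have h2 := (integrable_withDensity_iff (measurable_gaussianPDF 0 1) (by simp [gaussianPDF])).1 h
  simpa using h2

lemma gm_rec (k : ℕ) : ∫ x : ℝ, x ^ (k + 2) ∂(gaussianReal 0 1)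
    = (k + 1 : ℝ) * ∫ x : ℝ, x ^ k ∂(gaussianReal 0 1) := by
  simp only [integral_gaussianReal_eq_integral_smul (one_ne_zero), smul_eq_mul]
  have hd : ∀ x : ℝ, HasDerivAt (gaussianPDFReal 0 1) (-(x * gaussianPDFReal 0 1 x)) x := by
    intro x
    have e : gaussianPDFReal 0 1 = fun x => (√(2 * Real.pi * 1))⁻¹ * Real.exp (- x ^ 2 / 2) := by
      ext y; simp [gaussianPDFReal]
    rw [e]
    have := (((hasDerivAt_pow 2 x).neg.div_const 2).exp.const_mul ((√(2 * Real.pi * 1))⁻¹))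
    convert! this using 1
    simp; ring
  have := integral_mul_deriv_eq_deriv_mul_of_integrable (u := fun x : ℝ => x ^ (k+1))
    (v := gaussianPDFReal 0 1) (u' := fun x => (k+1:ℝ) * x ^ k) (v' := fun x => -(x * gaussianPDFReal 0 1 x))
    (fun x _ => by simpa using hasDerivAt_pow (k+1) x) (fun x _ => hd x) ?_ ?_ ?_
  · have e1 : ∀ x : ℝ, gaussianPDFReal 0 1 x * x ^ (k+2) = - (x ^ (k+1) * -(x * gaussianPDFReal 0 1 x)) := by
      intro x; ring
    simp_rw [e1]
    rw [integral_neg, this, neg_neg, ← integral_const_mul]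
    congr 1; ext x; ring
  · refine (gm_pdf (k+2)).neg.congr (ae_of_all _ fun x => ?_)
    simp; ring
  · refine ((gm_pdf k).const_mul (k+1:ℝ)).congr (ae_of_all _ fun x => ?_)
    simp; ring
  · exact gm_pdf (k+1)

lemma gm0 : ∫ x : ℝ, x ^ 0 ∂(gaussianReal 0 1) = 1 := by simp
lemma gm1 : ∫ x : ℝ, x ^ 1 ∂(gaussianReal 0 1) = 0 := by simp
lemma gm2 : ∫ x : ℝ, x ^ 2 ∂(gaussianReal 0 1) = 1 := by rw [gm_rec 0, gm0]; norm_num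
lemma gm3 : ∫ x : ℝ, x ^ 3 ∂(gaussianReal 0 1) = 0 := by rw [gm_rec 1, gm1]; norm_num
lemma gm4 : ∫ x : ℝ, x ^ 4 ∂(gaussianReal 0 1) = 3 := by rw [gm_rec 2, gm2]; norm_num
lemma gm5 : ∫ x : ℝ, x ^ 5 ∂(gaussianReal 0 1) = 0 := by rw [gm_rec 3, gm3]; norm_num
lemma gm6 : ∫ x : ℝ, x ^ 6 ∂(gaussianReal 0 1) = 15 := by rw [gm_rec 4, gm4]; norm_num
lemma gm7 : ∫ x : ℝ, x ^ 7 ∂(gaussianReal 0 1) = 0 := by rw [gm_rec 5, gm5]; norm_num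
lemma gm8 : ∫ x : ℝ, x ^ 8 ∂(gaussianReal 0 1) = 105 := by rw [gm_rec 6, gm6]; norm_num

end Part1

section Part2
open MeasureTheory ProbabilityTheory Filter
open scoped BigOperators Topology

/-- standard Gaussian on `Fin n → ℝ` -/
noncomputable abbrev gn (n : ℕ) : Measure (Fin n → ℝ) := Measure.pi (fun _ : Fin n => gaussianReal 0 1)

noncomputable def lin {n : ℕ} (a : Fin n → ℝ) (x : Fin n → ℝ) : ℝ := ∑ i, a i * x i

@[fun_prop] lemma lin_meas {n : ℕ} (a : Fin n → ℝ) : Measurable (lin a) := by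
  unfold lin; fun_prop

@[fun_prop] lemma lin_cont {n : ℕ} (a : Fin n → ℝ) : Continuous (lin a) := by
  unfold lin; fun_prop

lemma gn_indep (n : ℕ) : iIndepFun (fun (i : Fin n) (x : Fin n → ℝ) => x i) (gn n) :=
  iIndepFun_pi (X := fun _ x => x) (fun _ => aemeasurable_id)

lemma gn_coord (n : ℕ) (i : Fin n) : (gn n).map (fun x => x i) = gaussianReal 0 1 := by
  exact (measurePreserving_eval (fun _ : Fin n => gaussianReal 0 1) i).map_eq

lemma gn_gauss (n : ℕ) : HasGaussianLaw (fun x : Fin n → ℝ => x) (gn n) := by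
  have := (gn_indep n).hasGaussianLaw (fun i => ⟨by rw [gn_coord]; infer_instance⟩)
  exact this

lemma gn_coord_memLp (n : ℕ) (i : Fin n) : MemLp (fun x : Fin n → ℝ => x i) 2 (gn n) := 
  (HasGaussianLaw.eval (X := fun (i : Fin n) (x : Fin n → ℝ) => x i) (gn_gauss n) i).memLp_two

lemma gn_cov (n : ℕ) (i j : Fin n) : cov[fun x : Fin n → ℝ => x i, fun x => x j; gn n] = if i = j then 1 else 0 := by
  split_ifs with h
  · subst h
    rw [covariance_self (measurable_pi_apply i).aemeasurable]
    have := variance_map (μ := gn n) (X := id) (Y := fun x : Fin n → ℝ => x i) (by fun_prop) (measurable_pi_apply i).aemeasurable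
    rw [gn_coord] at this
    simpa [Function.comp_def] using this.symm
  · exact ((gn_indep n).indepFun h).covariance_eq_zero (gn_coord_memLp n i) (gn_coord_memLp n j)

lemma gn_coord_mean (n : ℕ) (i : Fin n) : ∫ x : Fin n → ℝ, x i ∂(gn n) = 0 := by
  have h : ∫ y, y ∂((gn n).map (fun x => x i)) = _ := integral_map (measurable_pi_apply i).aemeasurable (by fun_prop)
  rw [← h, gn_coord]; simp

lemma lin_gauss2 {n : ℕ} (a b : Fin n → ℝ) : HasGaussianLaw (fun x => (lin a x, lin b x)) (gn n) := by
  let L : (Fin n → ℝ) →L[ℝ] ℝ × ℝ := ContinuousLinearMap.prod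
    (∑ i, a i • ContinuousLinearMap.proj i) (∑ i, b i • ContinuousLinearMap.proj i)
  have := (gn_gauss n).map_fun L
  simpa [L, lin] using this

lemma lin_mean {n : ℕ} (a : Fin n → ℝ) : ∫ x, lin a x ∂(gn n) = 0 := by
  unfold lin
  rw [integral_finsetSum _ (fun i _ => ((gn_coord_memLp n i).integrable (by norm_num)).const_mul _)]
  simp [integral_const_mul, gn_coord_mean]

lemma lin_cov {n : ℕ} (a b : Fin n → ℝ) : cov[lin a, lin b; gn n] = ∑ i, a i * b i := by
  unfold lin
  rw [covariance_fun_sum_fun_sum (fun i => (gn_coord_memLp n i).const_mul _) (fun i => (gn_coord_memLp n i).const_mul _)]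
  simp [covariance_const_mul_left, covariance_const_mul_right, gn_cov, mul_comm]

lemma lin_law {n : ℕ} (a : Fin n → ℝ) : (gn n).map (lin a) = gaussianReal 0 (Real.toNNReal (∑ i, a i * a i)) := by
  have := (lin_gauss2 a a).fst.map_eq_gaussianReal
  rw [this, lin_mean, ← covariance_self (by fun_prop), lin_cov]

lemma lin_law' {n : ℕ} (a : Fin n → ℝ) : (gn n).map (lin a) = (gaussianReal 0 1).map (fun y => √(∑ i, a i * a i) * y) := by
  rw [lin_law, gaussianReal_map_const_mul]
  congr 1
  · simp
  · ext; simp [Real.sq_sqrt (Finset.sum_nonneg fun i _ => mul_self_nonneg (a i)), Finset.sum_nonneg fun i _ => mul_self_nonneg (a i)]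

lemma lin_pow_integrable {n : ℕ} (a : Fin n → ℝ) (k : ℕ) : Integrable (fun x => lin a x ^ k) (gn n) := by
  have h : Integrable (fun y : ℝ => y ^ k) ((gn n).map (lin a)) := by
    rw [lin_law', integrable_map_measure (by fun_prop) (by fun_prop)]
    simp only [Function.comp_def, mul_pow]
    exact (gm_integrable k).const_mul _
  exact (integrable_map_measure (measurable_id.pow_const k).aestronglyMeasurable (lin_meas a).aemeasurable).1 h

lemma lin_pow {n : ℕ} (a : Fin n → ℝ) (k : ℕ) :
    ∫ x, lin a x ^ k ∂(gn n) = √(∑ i, a i * a i) ^ k * ∫ y, y ^ k ∂(gaussianReal 0 1) := by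
  have h : ∫ y : ℝ, y ^ k ∂((gn n).map (lin a)) = _ := integral_map (by fun_prop) (by fun_prop)
  rw [← h, lin_law', integral_map (by fun_prop) (by fun_prop)]
  simp only [mul_pow, integral_const_mul]

lemma lin_pow4 {n : ℕ} (a : Fin n → ℝ) : ∫ x, lin a x ^ 4 ∂(gn n) = 3 * (∑ i, a i * a i) ^ 2 := by
  have h := Real.sq_sqrt (Finset.sum_nonneg fun i (_ : i ∈ Finset.univ) => mul_self_nonneg (a i))
  rw [lin_pow, gm4, show √(∑ i, a i * a i) ^ 4 = (√(∑ i, a i * a i) ^ 2)^2 by ring, h]; ring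

lemma lin_pow6 {n : ℕ} (a : Fin n → ℝ) : ∫ x, lin a x ^ 6 ∂(gn n) = 15 * (∑ i, a i * a i) ^ 3 := by
  have h := Real.sq_sqrt (Finset.sum_nonneg fun i (_ : i ∈ Finset.univ) => mul_self_nonneg (a i))
  rw [lin_pow, gm6, show √(∑ i, a i * a i) ^ 6 = (√(∑ i, a i * a i) ^ 2)^3 by ring, h]; ring

lemma lin_sum_sub {n : ℕ} (b c : Fin n → ℝ) (t : ℝ) (x : Fin n → ℝ) :
    lin c x = t * lin b x + lin (fun i => c i - t * b i) x := by
  unfold lin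
  rw [Finset.mul_sum, ← Finset.sum_add_distrib]
  exact Finset.sum_congr rfl fun i _ => by ring

lemma integral_add5 {Ω : Type*} [MeasurableSpace Ω] {μ : Measure Ω} {f0 f1 f2 f3 f4 : Ω → ℝ}
    (i0 : Integrable f0 μ) (i1 : Integrable f1 μ) (i2 : Integrable f2 μ) (i3 : Integrable f3 μ) (i4 : Integrable f4 μ) :
    ∫ x, f0 x + f1 x + f2 x + f3 x + f4 x ∂μ = ∫ x, f0 x ∂μ + ∫ x, f1 x ∂μ + ∫ x, f2 x ∂μ + ∫ x, f3 x ∂μ + ∫ x, f4 x ∂μ := by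
  have a1 : Integrable (fun x => f0 x + f1 x) μ := i0.add i1
  have a2 : Integrable (fun x => f0 x + f1 x + f2 x) μ := a1.add i2
  have a3 : Integrable (fun x => f0 x + f1 x + f2 x + f3 x) μ := a2.add i3
  rw [integral_add a3 i4, integral_add a2 i3, integral_add a1 i2, integral_add i0 i1]

lemma lin_44 {n : ℕ} (b c : Fin n → ℝ) :
    Integrable (fun x => lin b x ^ 4 * lin c x ^ 4) (gn n) ∧
    ∫ x, lin b x ^ 4 * lin c x ^ 4 ∂(gn n) = 9 * (∑ i, b i * b i) ^ 2 * (∑ i, c i * c i) ^ 2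
      + 72 * (∑ i, b i * b i) * (∑ i, c i * c i) * (∑ i, b i * c i) ^ 2 + 24 * (∑ i, b i * c i) ^ 4 := by
  set p := ∑ i, b i * b i with hp
  set q := ∑ i, c i * c i with hq
  set k := ∑ i, b i * c i with hk
  set t := k / p with ht
  have hp0 : 0 ≤ p := Finset.sum_nonneg fun i (_ : i ∈ Finset.univ) => mul_self_nonneg (b i)
  have htp : t * p = k := by
    by_cases h : p = 0
    · have hb : ∀ i, b i = 0 := by
        intro i
        have := (Finset.sum_eq_zero_iff_of_nonneg fun i (_ : i ∈ Finset.univ) => mul_self_nonneg (b i)).1 h i (by simp)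
        simpa using this
      have : k = 0 := by simp [hk, hb]
      rw [this, h]; simp
    · rw [ht]; field_simp
  set V := fun i => c i - t * b i with hV
  have hcov : ∑ i, b i * V i = 0 := by
    have : ∑ i, b i * V i = k - t * p := by
      rw [hk, hp, Finset.mul_sum, ← Finset.sum_sub_distrib]
      exact Finset.sum_congr rfl fun i _ => by simp only [hV]; ring
    rw [this, htp]; ring
  have hs : ∑ i, V i * V i = q - t * k := by
    have : ∑ i, V i * V i = q - 2 * t * k + t * t * p := by
      rw [hk, hp, hq, Finset.mul_sum, Finset.mul_sum, ← Finset.sum_sub_distrib, ← Finset.sum_add_distrib]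
      exact Finset.sum_congr rfl fun i _ => by simp only [hV]; ring
    rw [this, mul_assoc t t p, htp]; ring
  have hind : IndepFun (lin b) (lin V) (gn n) :=
    (lin_gauss2 b V).indepFun_of_covariance_eq_zero (by rw [lin_cov, hcov])
  have hind2 : ∀ i j : ℕ, IndepFun (fun x => lin b x ^ i) (fun x => lin V x ^ j) (gn n) := fun i j =>
    hind.comp (φ := fun y => y ^ i) (ψ := fun y => y ^ j) (by fun_prop) (by fun_prop)
  have hint : ∀ i j : ℕ, Integrable (fun x => lin b x ^ i * lin V x ^ j) (gn n) := fun i j =>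
    (hind2 i j).integrable_mul (lin_pow_integrable b i) (lin_pow_integrable V j)
  have hval : ∀ i j : ℕ, ∫ x, lin b x ^ i * lin V x ^ j ∂(gn n) = (√p ^ i * ∫ y, y ^ i ∂(gaussianReal 0 1)) * (√(q - t * k) ^ j * ∫ y, y ^ j ∂(gaussianReal 0 1)) := by
    intro i j
    have := (hind2 i j).integral_fun_mul_eq_mul_integral (by fun_prop) (by fun_prop)
    rw [this, lin_pow, lin_pow, hs]
  have e : (fun x => lin b x ^ 4 * lin c x ^ 4) = fun x => t^4 * (lin b x ^ 8 * lin V x ^ 0) + 4 * t^3 * (lin b x ^ 7 * lin V x ^ 1)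
      + 6 * t ^ 2 * (lin b x ^ 6 * lin V x ^ 2) + 4 * t * (lin b x ^ 5 * lin V x ^ 3) + 1 * (lin b x ^ 4 * lin V x ^ 4) := by
    ext x; rw [lin_sum_sub b c t x]; ring
  have sp : √p ^ 2 = p := Real.sq_sqrt hp0
  have sv : √(q - t * k) ^ 2 = q - t * k := Real.sq_sqrt (by rw [← hs]; exact Finset.sum_nonneg fun i (_ : i ∈ Finset.univ) => mul_self_nonneg (V i))
  rw [e]
  have i0 := (hint 8 0).const_mul (t^4)
  have i1 := (hint 7 1).const_mul (4 * t^3)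
  have i2 := (hint 6 2).const_mul (6 * t^2)
  have i3 := (hint 5 3).const_mul (4 * t)
  have i4 := (hint 4 4).const_mul 1
  refine ⟨(((i0.add i1).add i2).add i3).add i4, ?_⟩
  rw [integral_add5 i0 i1 i2 i3 i4]
  simp only [integral_const_mul, hval, gm0, gm1, gm2, gm3, gm4, gm5, gm6, gm7, gm8]
  have e8 : √p ^ 8 = p ^ 4 := by rw [show √p ^ 8 = (√p ^ 2) ^ 4 by ring, sp]
  have e6 : √p ^ 6 = p ^ 3 := by rw [show √p ^ 6 = (√p ^ 2) ^ 3 by ring, sp]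
  have e4 : √p ^ 4 = p ^ 2 := by rw [show √p ^ 4 = (√p ^ 2) ^ 2 by ring, sp]
  have f4 : √(q - t * k) ^ 4 = (q - t * k)^2 := by rw [show √(q - t * k) ^ 4 = (√(q - t * k) ^ 2) ^ 2 by ring, sv]
  rw [e8, e6, e4, f4, sv]
  rw [← htp]; ring

end Part2

section Part3
open MeasureTheory ProbabilityTheory Filter Matrix
open scoped BigOperators Topology

lemma gn_map_onb {n : ℕ} (b : OrthonormalBasis (Fin n) ℝ (EuclideanSpace ℝ (Fin n))) :
    MeasurePreserving (fun (x : Fin n → ℝ) (j : Fin n) => ∑ i, b j i * x i) (gn n) (gn n) := by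
  have h1 : (fun (x : Fin n → ℝ) (j : Fin n) => ∑ i, b j i * x i) = (WithLp.ofLp : EuclideanSpace ℝ (Fin n) → (Fin n → ℝ)) ∘ b.repr ∘ (WithLp.toLp 2) := by
    ext x j
    simp [b.repr_apply_apply, PiLp.inner_apply, mul_comm]
  refine ⟨by fun_prop, ?_⟩
  rw [h1, ← Measure.map_map (by fun_prop) (by fun_prop), ← Measure.map_map (by fun_prop) (by fun_prop),
    map_pi_eq_stdGaussian, stdGaussian_map, ← map_pi_eq_stdGaussian, Measure.map_map (by fun_prop) (by fun_prop)]
  have : (WithLp.ofLp : EuclideanSpace ℝ (Fin n) → (Fin n → ℝ)) ∘ (WithLp.toLp 2) = id := by ext; simp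
  rw [this, Measure.map_id]

lemma quad_diag {n : ℕ} (M : Matrix (Fin n) (Fin n) ℝ) (hM : M.IsHermitian) :
    ∃ (μ : Fin n → ℝ) (g : (Fin n → ℝ) → Fin n → ℝ), MeasurePreserving g (gn n) (gn n) ∧
      (∀ x, x ⬝ᵥ M *ᵥ x = ∑ j, μ j * (g x j) ^ 2) ∧ ∑ j, μ j = M.trace ∧
      ∑ j, μ j ^ 2 = (M * M).trace ∧ ∑ j, μ j ^ 4 = (M * M * (M * M)).trace := by
  set U : Matrix (Fin n) (Fin n) ℝ := (hM.eigenvectorUnitary).1 with hU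
  set D : Matrix (Fin n) (Fin n) ℝ := diagonal hM.eigenvalues with hD
  have hUU : Uᵀ * U = 1 := by
    have := (Unitary.mem_iff.1 hM.eigenvectorUnitary.2).1
    simpa [star_eq_conjTranspose] using this
  have hsp : M = U * D * Uᵀ := by
    have := hM.spectral_theorem
    rw [Unitary.conjStarAlgAut_apply] at this
    simpa [star_eq_conjTranspose] using this
  have hUij : ∀ i j, U i j = hM.eigenvectorBasis j i := fun i j => by simp [hU]
  have hM2 : M * M = U * (D * D) * Uᵀ := by
    calc M * M = U * D * (Uᵀ * U) * D * Uᵀ := by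
          conv_lhs => rw [hsp]
          simp only [Matrix.mul_assoc]
      _ = _ := by rw [hUU]; simp only [Matrix.mul_assoc, Matrix.one_mul]
  have hM4 : M * M * (M * M) = U * (D * D * (D * D)) * Uᵀ := by
    calc M * M * (M * M) = U * (D * D) * (Uᵀ * U) * (D * D) * Uᵀ := by rw [hM2]; simp only [Matrix.mul_assoc]
      _ = _ := by rw [hUU]; simp only [Matrix.mul_assoc, Matrix.one_mul]
  have htr : ∀ A : Matrix (Fin n) (Fin n) ℝ, (U * A * Uᵀ).trace = A.trace := by
    intro A
    rw [Matrix.trace_mul_comm, ← Matrix.mul_assoc, hUU, Matrix.one_mul]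
  refine ⟨hM.eigenvalues, _, gn_map_onb hM.eigenvectorBasis, ?_, ?_, ?_, ?_⟩
  · intro x
    conv_lhs => rw [hsp]
    rw [← Matrix.mulVec_mulVec, ← Matrix.mulVec_mulVec, Matrix.dotProduct_mulVec, ← Matrix.mulVec_transpose]
    simp only [dotProduct, hD, Matrix.mulVec_diagonal]
    refine Finset.sum_congr rfl fun j _ => ?_
    have : (Uᵀ *ᵥ x) j = ∑ i, hM.eigenvectorBasis j i * x i := by
      simp [Matrix.mulVec, dotProduct, hUij]
    rw [this]; ring
  · conv_rhs => rw [hsp]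
    rw [htr, hD, Matrix.trace_diagonal]
  · rw [hM2, htr, hD, Matrix.diagonal_mul_diagonal, Matrix.trace_diagonal]
    simp [pow_two]
  · rw [hM4, htr, hD, Matrix.diagonal_mul_diagonal, Matrix.diagonal_mul_diagonal, Matrix.trace_diagonal]
    refine Finset.sum_congr rfl fun j _ => by ring

lemma xx_integrable {n : ℕ} (i j : Fin n) : Integrable (fun x : Fin n → ℝ => x i ^ 2 * x j ^ 2) (gn n) ∧
    ∫ x, x i ^ 2 * x j ^ 2 ∂(gn n) = 1 + if i = j then 2 else 0 := by
  have key : ∀ (i : Fin n) (k : ℕ), Integrable (fun x : Fin n → ℝ => x i ^ k) (gn n) ∧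
     ∫ x, x i ^ k ∂(gn n) = ∫ y, y ^ k ∂(gaussianReal 0 1) := by
    intro i k
    have hmp := measurePreserving_eval (fun _ : Fin n => gaussianReal 0 1) i
    refine ⟨(hmp.integrable_comp (gm_integrable k).1).2 (gm_integrable k), ?_⟩
    have h : ∫ y : ℝ, y ^ k ∂((gn n).map (fun x => x i)) = _ := integral_map (measurable_pi_apply i).aemeasurable (by fun_prop)
    rw [← h, gn_coord]
  by_cases hij : i = j
  · subst hij
    have h4 := key i 4
    have : (fun x : Fin n → ℝ => x i ^ 2 * x i ^ 2) = fun x => x i ^ 4 := by ext; ring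
    rw [this]
    refine ⟨h4.1, ?_⟩
    rw [h4.2, gm4]; norm_num
  · have hi : IndepFun (fun x : Fin n → ℝ => x i ^ 2) (fun x => x j ^ 2) (gn n) :=
      ((gn_indep n).indepFun hij).comp (φ := fun y => y ^ 2) (ψ := fun y => y ^ 2) (by fun_prop) (by fun_prop)
    refine ⟨hi.integrable_mul (key i 2).1 (key j 2).1, ?_⟩
    have := hi.integral_fun_mul_eq_mul_integral (key i 2).1.1 (key j 2).1.1
    rw [this, (key i 2).2, (key j 2).2, gm2]; simp [hij]

lemma diag_sq {n : ℕ} (μ : Fin n → ℝ) : Integrable (fun x : Fin n → ℝ => (∑ j, μ j * x j ^ 2) ^ 2) (gn n) ∧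
    ∫ x, (∑ j, μ j * x j ^ 2) ^ 2 ∂(gn n) = (∑ j, μ j) ^ 2 + 2 * ∑ j, μ j ^ 2 := by
  have e : (fun x : Fin n → ℝ => (∑ j, μ j * x j ^ 2) ^ 2) = fun x => ∑ i, ∑ j, (μ i * μ j) * (x i ^ 2 * x j ^ 2) := by
    ext x
    rw [pow_two, Finset.sum_mul_sum]
    exact Finset.sum_congr rfl fun i _ => Finset.sum_congr rfl fun j _ => by ring
  have hI : ∀ i j : Fin n, Integrable (fun x : Fin n → ℝ => (μ i * μ j) * (x i ^ 2 * x j ^ 2)) (gn n) := fun i j => (xx_integrable i j).1.const_mul _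
  rw [e]
  refine ⟨integrable_finsetSum _ fun i _ => integrable_finsetSum _ fun j _ => hI i j, ?_⟩
  rw [integral_finsetSum _ fun i _ => integrable_finsetSum _ fun j _ => hI i j]
  simp_rw [integral_finsetSum _ fun j _ => hI _ j, integral_const_mul, (xx_integrable _ _).2]
  rw [pow_two (∑ j, μ j), Finset.sum_mul_sum, Finset.mul_sum, ← Finset.sum_add_distrib]
  refine Finset.sum_congr rfl fun i _ => ?_
  simp only [mul_add, mul_one, Finset.sum_add_distrib, mul_ite, mul_zero, Finset.sum_ite_eq, Finset.mem_univ, if_true]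
  ring

lemma quad_sq {n : ℕ} (M : Matrix (Fin n) (Fin n) ℝ) (hM : M.IsHermitian) :
    Integrable (fun x : Fin n → ℝ => (x ⬝ᵥ M *ᵥ x) ^ 2) (gn n) ∧
    ∫ x, (x ⬝ᵥ M *ᵥ x) ^ 2 ∂(gn n) = M.trace ^ 2 + 2 * (M * M).trace := by
  obtain ⟨μ, g, hg, h1, h2, h3, -⟩ := quad_diag M hM
  simp_rw [h1]
  rw [← h2, ← h3, ← (diag_sq μ).2]
  refine ⟨(hg.integrable_comp (diag_sq μ).1.1).2 (diag_sq μ).1, ?_⟩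
  conv_rhs => rw [← hg.map_eq]
  rw [integral_map hg.measurable.aemeasurable (by rw [hg.map_eq]; exact (diag_sq μ).1.1)]

end Part3

section Part4
open MeasureTheory ProbabilityTheory Filter Matrix
open scoped BigOperators Topology

lemma prod_diff_le {ι : Type*} (s : Finset ι) (a b : ι → ℂ) (ha : ∀ i, ‖a i‖ ≤ 1) (hb : ∀ i, ‖b i‖ ≤ 1) :
    ‖∏ i ∈ s, a i - ∏ i ∈ s, b i‖ ≤ ∑ i ∈ s, ‖a i - b i‖ := by
  classical
  induction s using Finset.induction_on with
  | empty => simp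
  | insert i s hi ih =>
    rw [Finset.prod_insert hi, Finset.prod_insert hi, Finset.sum_insert hi]
    have e : a i * ∏ x ∈ s, a x - b i * ∏ x ∈ s, b x
        = (a i - b i) * ∏ x ∈ s, a x + b i * (∏ x ∈ s, a x - ∏ x ∈ s, b x) := by ring
    have hp : ‖∏ x ∈ s, a x‖ ≤ 1 := by
      rw [norm_prod]; exact Finset.prod_le_one (fun _ _ => norm_nonneg _) (fun i _ => ha i)
    rw [e]
    refine (norm_add_le _ _).trans (add_le_add ?_ ?_)
    · rw [norm_mul]; exact mul_le_of_le_one_right (norm_nonneg _) hp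
    · rw [norm_mul]; exact (mul_le_of_le_one_left (norm_nonneg _) (hb i)).trans ih

noncomputable def Zfun (y : ℝ) : ℝ := (y ^ 2 - 1) / √2

lemma Zfun_meas : Measurable Zfun := by unfold Zfun; fun_prop

lemma Zchar : (fun t : ℝ ↦ charFun ((gaussianReal 0 1).map Zfun) t - charFun (gaussianReal 0 1) t) =o[𝓝 0] fun t : ℝ ↦ t ^ 2 := by
  have i2 := gm_integrable 2
  have i4 := gm_integrable 4
  have h1 := taylor_charFun_two (P := gaussianReal 0 1) (X := Zfun) Zfun_meas.aemeasurable
    (by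
      simp only [Zfun, integral_div]
      rw [integral_sub i2 (integrable_const _), gm2]; simp)
    (by
      have e : (Zfun ^ 2 : ℝ → ℝ) = fun y => (y ^ 4 - 2 * y ^ 2 + 1) / 2 := by
        ext y; simp only [Zfun, Pi.pow_apply, div_pow]
        rw [Real.sq_sqrt (by norm_num)]; ring
      rw [e, integral_div]
      have i3 : Integrable (fun y : ℝ => y ^ 4 - 2 * y ^ 2) (gaussianReal 0 1) := i4.sub (i2.const_mul 2)
      rw [integral_add i3 (integrable_const _), integral_sub i4 (i2.const_mul 2), integral_const_mul, gm2, gm4]; simp; norm_num)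
  have h2 := taylor_charFun_two (P := gaussianReal 0 1) (X := id) aemeasurable_id
    (by simp) (by simpa using gm2)
  rw [Measure.map_id] at h2
  simpa using h1.sub h2

lemma clt_char {n : ℕ → ℕ} (μ : ∀ k, Fin (n k) → ℝ) (u : ℝ)
    (h2 : Tendsto (fun k => ∑ j, μ k j ^ 2) atTop (𝓝 (2 * u ^ 2)))
    (h4 : Tendsto (fun k => ∑ j, μ k j ^ 4) atTop (𝓝 0)) (t : ℝ) :
    Tendsto (fun k => charFun ((gn (n k)).map (fun x => ∑ j, (1 / 2) * (μ k j * (x j ^ 2 - 1)))) t) atTop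
      (𝓝 (charFun ((gaussianReal 0 1).map (fun y => u * y)) t)) := by
  have hchar : ∀ k, charFun ((gn (n k)).map (fun x => ∑ j, (1 / 2) * (μ k j * (x j ^ 2 - 1)))) t
      = ∏ j, charFun ((gaussianReal 0 1).map Zfun) (μ k j / √2 * t) := by
    intro k
    have hind : iIndepFun (fun (j : Fin (n k)) (x : Fin (n k) → ℝ) => (1 / 2) * (μ k j * (x j ^ 2 - 1))) (gn (n k)) :=
      (gn_indep (n k)).comp (g := fun j y => (1 / 2) * (μ k j * (y ^ 2 - 1))) (fun j => by fun_prop)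
    rw [hind.charFun_map_fun_sum_eq_prod (fun i => Measurable.aemeasurable (by fun_prop)), Finset.prod_apply]
    refine Finset.prod_congr rfl fun j _ => ?_
    rw [← charFun_map_mul, Measure.map_map (by fun_prop) Zfun_meas, ← gn_coord (n k) j,
      Measure.map_map (g := (fun x => μ k j / √2 * x) ∘ Zfun) (Measurable.comp (by fun_prop) Zfun_meas) (measurable_pi_apply j)]
    congr 2
    ext x
    simp only [Function.comp, Zfun]
    have := Real.mul_self_sqrt (show (0 : ℝ) ≤ 2 by norm_num)
    field_simp
    rw [pow_two (√2), this]; ring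
  have hchar2 : ∀ k, charFun ((gaussianReal 0 1).map (fun y => √((∑ j, μ k j ^ 2) / 2) * y)) t
      = ∏ j, charFun (gaussianReal 0 1) (μ k j / √2 * t) := by
    intro k
    rw [charFun_map_mul]
    simp only [charFun_gaussianReal]
    rw [← Complex.exp_sum]
    congr 1
    have e1 : ((√((∑ j, μ k j ^ 2) / 2) * t : ℝ) : ℂ) ^ 2 = ((((∑ j, μ k j ^ 2) / 2) * t ^ 2 : ℝ) : ℂ) := by
      rw [← Complex.ofReal_pow, mul_pow, Real.sq_sqrt (by positivity)]
    have e2 : ∀ j, ((μ k j / √2 * t : ℝ) : ℂ) ^ 2 = ((μ k j ^ 2 / 2 * t ^ 2 : ℝ) : ℂ) := by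
      intro j
      rw [← Complex.ofReal_pow, mul_pow, div_pow, Real.sq_sqrt (by positivity)]
    simp only [e1, e2]
    push_cast
    simp only [Finset.sum_div, Finset.sum_mul, Finset.sum_sub_distrib]
    simp [Finset.sum_div, Finset.sum_mul, Finset.mul_sum]
  have hlim2 : Tendsto (fun k => charFun ((gaussianReal 0 1).map (fun y => √((∑ j, μ k j ^ 2) / 2) * y)) t) atTop
      (𝓝 (charFun ((gaussianReal 0 1).map (fun y => u * y)) t)) := by
    have e : charFun ((gaussianReal 0 1).map (fun y => u * y)) t = charFun ((gaussianReal 0 1).map (fun y => |u| * y)) t := by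
      rw [charFun_map_mul, charFun_map_mul]
      simp only [charFun_gaussianReal]
      congr 1
      have : ((|u| * t : ℝ) : ℂ) ^ 2 = ((u * t : ℝ) : ℂ) ^ 2 := by
        rw [← Complex.ofReal_pow, ← Complex.ofReal_pow, mul_pow, mul_pow, sq_abs]
      rw [this]; simp
    rw [e]
    simp only [charFun_map_mul]
    have hcont : Continuous (charFun (gaussianReal 0 1)) := continuous_charFun
    refine (hcont.tendsto _).comp ?_
    refine Tendsto.mul_const _ ?_
    have := (Real.continuous_sqrt.tendsto _).comp (h2.div_const 2)
    rwa [show 2 * u ^ 2 / 2 = u ^ 2 by ring, Real.sqrt_sq_eq_abs] at this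
  refine tendsto_of_tendsto_of_dist hlim2 ?_
  simp only [hchar, hchar2]
  rw [Metric.tendsto_atTop]
  intro ε hε
  set A : ℝ := (2 * u ^ 2 + 1) * t ^ 2 / 2 + 1 with hA
  have hApos : 0 < A := by positivity
  have hz := Zchar.def (show 0 < ε / (2 * A) by positivity)
  rw [Metric.eventually_nhds_iff] at hz
  obtain ⟨δ, hδ, hz⟩ := hz
  have hsmall : ∀ᶠ k in atTop, (∑ j, μ k j ^ 4) * t ^ 4 < δ ^ 4 := by
    have := h4.mul_const (t ^ 4)
    rw [zero_mul] at this
    exact this.eventually_lt_const (by positivity)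
  have hbd : ∀ᶠ k in atTop, ∑ j, μ k j ^ 2 < 2 * u ^ 2 + 1 := h2.eventually_lt_const (by linarith)
  obtain ⟨N, hN⟩ := eventually_atTop.1 (hsmall.and hbd)
  refine ⟨N, fun k hk => ?_⟩
  obtain ⟨hs, hb⟩ := hN k hk
  rw [dist_zero_right, Real.norm_of_nonneg dist_nonneg, dist_comm, dist_eq_norm]
  haveI : IsProbabilityMeasure ((gaussianReal 0 1).map Zfun) := Measure.isProbabilityMeasure_map Zfun_meas.aemeasurable
  refine (prod_diff_le _ _ _ (fun i => norm_charFun_le_one _) (fun i => norm_charFun_le_one _)).trans_lt ?_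
  have hj : ∀ j, ‖charFun ((gaussianReal 0 1).map Zfun) (μ k j / √2 * t) - charFun (gaussianReal 0 1) (μ k j / √2 * t)‖
      ≤ ε / (2 * A) * (μ k j ^ 2 * t ^ 2 / 2) := by
    intro j
    have hd : dist (μ k j / √2 * t) 0 < δ := by
      rw [dist_zero_right]
      refine lt_of_pow_lt_pow_left₀ 4 hδ.le (lt_of_le_of_lt ?_ hs)
      rw [Real.norm_eq_abs, Even.pow_abs (by decide), mul_pow, div_pow]
      refine mul_le_mul_of_nonneg_right ?_ (by positivity)
      have h1 : μ k j ^ 4 ≤ ∑ j, μ k j ^ 4 := Finset.single_le_sum (f := fun j => μ k j ^ 4) (fun i _ => by positivity) (Finset.mem_univ j)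
      have h2 : √2 ^ 4 = (4 : ℝ) := by
        rw [show √2 ^ 4 = (√2 ^ 2) ^ 2 by ring, Real.sq_sqrt (by norm_num)]; norm_num
      rw [h2]
      have : 0 ≤ μ k j ^ 4 := by positivity
      linarith
    have := hz hd
    refine this.trans (le_of_eq ?_)
    rw [Real.norm_of_nonneg (by positivity), mul_pow, div_pow, Real.sq_sqrt (by norm_num)]
    ring
  refine (Finset.sum_le_sum fun j _ => hj j).trans_lt ?_
  rw [← Finset.mul_sum, ← Finset.sum_div, ← Finset.sum_mul]
  have h3 : (∑ j, μ k j ^ 2) * t ^ 2 / 2 ≤ A := by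
    rw [hA]
    have : (∑ j, μ k j ^ 2) * t ^ 2 ≤ (2 * u ^ 2 + 1) * t ^ 2 := by gcongr
    linarith
  calc ε / (2 * A) * ((∑ j, μ k j ^ 2) * t ^ 2 / 2) ≤ ε / (2 * A) * A := by gcongr
    _ = ε / 2 := by field_simp
    _ < ε := by linarith

lemma clt {n : ℕ → ℕ} (μ : ∀ k, Fin (n k) → ℝ) (u : ℝ)
    (h2 : Tendsto (fun k => ∑ j, μ k j ^ 2) atTop (𝓝 (2 * u ^ 2)))
    (h4 : Tendsto (fun k => ∑ j, μ k j ^ 4) atTop (𝓝 0)) (F : BoundedContinuousFunction ℝ ℝ) :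
    Tendsto (fun k => ∫ x, F (∑ j, (1 / 2) * (μ k j * (x j ^ 2 - 1))) ∂(gn (n k))) atTop
      (𝓝 (∫ y, F (u * y) ∂(gaussianReal 0 1))) := by
  let P : ℕ → ProbabilityMeasure ℝ := fun k => ⟨(gn (n k)).map (fun x => ∑ j, (1 / 2) * (μ k j * (x j ^ 2 - 1))),
    Measure.isProbabilityMeasure_map (Measurable.aemeasurable (by fun_prop))⟩
  let P0 : ProbabilityMeasure ℝ := ⟨(gaussianReal 0 1).map (fun y => u * y), Measure.isProbabilityMeasure_map (by fun_prop)⟩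
  have h := (ProbabilityMeasure.tendsto_iff_tendsto_charFun (μ := P) (μ₀ := P0)).2 (fun t => clt_char μ u h2 h4 t)
  have := ProbabilityMeasure.tendsto_iff_forall_integral_tendsto.1 h F
  simp only [P, P0, ProbabilityMeasure.coe_mk] at this
  rw [integral_map (by fun_prop) (by fun_prop)] at this
  refine this.congr fun k => ?_
  rw [integral_map (Measurable.aemeasurable (by fun_prop)) (by fun_prop)]

end Part4

section Part5
open MeasureTheory ProbabilityTheory Filter Matrix
open scoped BigOperators Topology

noncomputable def sgb (b : Bool) : ℝ := if b then 1 else -1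

lemma sgb_sq (b : Bool) : sgb b * sgb b = 1 := by cases b <;> simp [sgb]

lemma hlog {w : ℝ} (hw : |w| ≤ 1 / 2) :
    ((1 + w) * Real.log (1 + w) + (1 - w) * Real.log (1 - w)) / 2 ≤ w ^ 2 / 2 + w ^ 4 / 12 + 3 * w ^ 6 := by
  have h1 := Real.abs_log_sub_add_sum_range_le (x := w) (by linarith) 5
  have h2 := Real.abs_log_sub_add_sum_range_le (x := -w) (by rw [abs_neg]; linarith) 5
  have h6 : |w| ^ 6 = w ^ 6 := Even.pow_abs (by decide) w
  have hd : |w| ^ 6 / (1 - |w|) ≤ 2 * w ^ 6 := by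
    rw [h6, div_le_iff₀ (by linarith)]
    have : 0 ≤ w ^ 6 := by positivity
    nlinarith
  rw [abs_neg] at h2
  norm_num [Finset.sum_range_succ] at h1 h2
  have h1' := abs_le.1 (h1.trans hd)
  have h2' := abs_le.1 (h2.trans hd)
  have hw' := abs_le.1 hw
  have a1 := mul_le_mul_of_nonneg_left h2'.2 (show 0 ≤ 1 + w by linarith)
  have a2 := mul_le_mul_of_nonneg_left h1'.2 (show 0 ≤ 1 - w by linarith)
  have : 0 ≤ w ^ 6 := by positivity
  nlinarith

section
variable {S : Type*} [Fintype S] [DecidableEq S]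

lemma sum_prod_bool (f : S → Bool → ℝ) : ∑ e : S → Bool, ∏ l, f l (e l) = ∏ l, (f l true + f l false) := by
  have := Finset.prod_univ_sum (fun _ : S => (Finset.univ : Finset Bool)) f
  simp only [Fintype.univ_bool, Finset.mem_singleton, Bool.true_eq_false, not_false_eq_true, Finset.sum_insert, Finset.sum_singleton] at this
  rw [this]
  refine Finset.sum_congr ?_ fun _ _ => rfl
  rw [← Fintype.univ_bool, Fintype.piFinset_univ]

noncomputable def qw (w : S → ℝ) (e : S → Bool) : ℝ := ∏ l, ((1 + sgb (e l) * w l) / 2)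

lemma qw_sum (w : S → ℝ) : ∑ e, qw w e = 1 := by
  unfold qw
  rw [sum_prod_bool (fun l b => (1 + sgb b * w l) / 2)]
  refine Finset.prod_eq_one fun l _ => ?_
  simp [sgb]; ring

lemma qw_one (w : S → ℝ) (l : S) (g : Bool → ℝ) :
    ∑ e, qw w e * g (e l) = (1 + w l) / 2 * g true + (1 - w l) / 2 * g false := by
  have h : ∀ e : S → Bool, qw w e * g (e l) = ∏ m, ((1 + sgb (e m) * w m) / 2 * (if m = l then g (e m) else 1)) := by
    intro e
    rw [Finset.prod_mul_distrib, Finset.prod_ite_eq']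
    simp [qw]
  simp_rw [h]
  rw [sum_prod_bool (fun m b => (1 + sgb b * w m) / 2 * (if m = l then g b else 1)),
    Finset.prod_eq_single l]
  · simp only [sgb, if_true]; simp [← sub_eq_add_neg]
  · intro m _ hm; simp [sgb, hm]; ring
  · simp

lemma qw_two (w : S → ℝ) (l k : S) (hlk : l ≠ k) :
    ∑ e, qw w e * (sgb (e l) * sgb (e k)) = w l * w k := by
  have h : ∀ e : S → Bool, qw w e * (sgb (e l) * sgb (e k)) = ∏ m, ((1 + sgb (e m) * w m) / 2 * ((if m = l then sgb (e m) else 1) * (if m = k then sgb (e m) else 1))) := by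
    intro e
    rw [Finset.prod_mul_distrib, Finset.prod_mul_distrib, Finset.prod_ite_eq', Finset.prod_ite_eq']
    simp [qw]
  simp_rw [h]
  rw [sum_prod_bool (fun m b => (1 + sgb b * w m) / 2 * ((if m = l then sgb b else 1) * (if m = k then sgb b else 1))),
    Finset.prod_eq_mul l k hlk]
  · simp [sgb, hlk, hlk.symm]; ring
  · intro m _ hm; simp [sgb, hm.1, hm.2]; ring
  · simp
  · simp

lemma jensen (w : S → ℝ) (K : S → S → ℝ) (hw : ∀ l, |w l| ≤ 1 / 2) :
    Real.exp ((1 / 2) * (∑ l, w l ^ 2 - ∑ l, K l l) - (1 / 2) * (∑ l, ∑ m, if l = m then 0 else K l m * (w l * w m))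
      - (1 / 12) * ∑ l, w l ^ 4 - 3 * ∑ l, w l ^ 6)
    ≤ (1 / 2 ^ Fintype.card S) * ∑ e : S → Bool, Real.exp (∑ l, sgb (e l) * w l - (1 / 2) * ∑ l, ∑ m, K l m * (sgb (e l) * sgb (e m))) := by
  set E : (S → Bool) → ℝ := fun e => ∑ l, sgb (e l) * w l - (1 / 2) * ∑ l, ∑ m, K l m * (sgb (e l) * sgb (e m)) with hE
  have hpos : ∀ (l : S) (b : Bool), 0 < 1 + sgb b * w l := by
    intro l b
    have := abs_le.1 (hw l)
    cases b <;> simp [sgb] <;> linarith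
  have hq : ∀ e, 0 < qw w e := fun e => Finset.prod_pos fun l _ => div_pos (hpos l _) (by norm_num)
  set G : (S → Bool) → ℝ := fun e => E e - ∑ l, Real.log (1 + sgb (e l) * w l) with hG
  have hrw : ∀ e, (1 / 2 ^ Fintype.card S) * Real.exp (E e) = qw w e * Real.exp (G e) := by
    intro e
    simp only [hG, Real.exp_sub, Real.exp_sum, qw]
    simp_rw [Real.exp_log (hpos _ _)]
    rw [Finset.prod_div_distrib]
    have : ∏ l, (1 + sgb (e l) * w l) ≠ 0 := (Finset.prod_pos fun l _ => hpos l _).ne'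
    simp only [Finset.prod_const, Finset.card_univ]
    field_simp
  have hrw2 : (1 / 2 ^ Fintype.card S) * ∑ e, Real.exp (E e) = ∑ e, qw w e * Real.exp (G e) := by
    rw [Finset.mul_sum, Finset.sum_congr rfl fun e _ => hrw e]
  rw [hrw2]
  have hj := convexOn_exp.map_sum_le (t := (Finset.univ : Finset (S → Bool))) (w := qw w) (p := G)
    (fun e _ => (hq e).le) (qw_sum w) (fun _ _ => Set.mem_univ _)
  simp only [smul_eq_mul] at hj
  refine le_trans (Real.exp_le_exp.2 ?_) hj
  have t1 : ∑ e, qw w e * ∑ l, sgb (e l) * w l = ∑ l, w l ^ 2 := by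
    simp_rw [Finset.mul_sum]
    rw [Finset.sum_comm]
    refine Finset.sum_congr rfl fun l _ => ?_
    rw [qw_one w l (fun b => sgb b * w l)]; simp [sgb]; ring
  have t2 : ∑ e, qw w e * ∑ l, ∑ m, K l m * (sgb (e l) * sgb (e m)) = ∑ l, K l l + ∑ l, ∑ m, if l = m then 0 else K l m * (w l * w m) := by
    simp_rw [Finset.mul_sum]
    rw [Finset.sum_comm, ← Finset.sum_add_distrib]
    refine Finset.sum_congr rfl fun l _ => ?_
    rw [Finset.sum_comm]
    have : K l l = ∑ m, if l = m then K l m else 0 := by simp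
    rw [this, ← Finset.sum_add_distrib]
    refine Finset.sum_congr rfl fun m _ => ?_
    by_cases hlm : l = m
    · subst hlm
      simp [sgb_sq, ← Finset.sum_mul, qw_sum]
    · simp only [hlm, if_false, zero_add]
      rw [← qw_two w l m hlm, Finset.mul_sum]
      exact Finset.sum_congr rfl fun e _ => by ring
  have t3 : ∑ e, qw w e * ∑ l, Real.log (1 + sgb (e l) * w l) ≤ ∑ l, (w l ^ 2 / 2 + w l ^ 4 / 12 + 3 * w l ^ 6) := by
    simp_rw [Finset.mul_sum]
    rw [Finset.sum_comm]
    refine Finset.sum_le_sum fun l _ => ?_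
    rw [qw_one w l (fun b => Real.log (1 + sgb b * w l))]
    refine le_trans (le_of_eq ?_) (hlog (hw l))
    simp [sgb, ← sub_eq_add_neg]; ring
  have t4 : ∑ l, (w l ^ 2 / 2 + w l ^ 4 / 12 + 3 * w l ^ 6) = (1 / 2) * ∑ l, w l ^ 2 + (1 / 12) * ∑ l, w l ^ 4 + 3 * ∑ l, w l ^ 6 := by
    rw [Finset.mul_sum, Finset.mul_sum, Finset.mul_sum, ← Finset.sum_add_distrib, ← Finset.sum_add_distrib]
    exact Finset.sum_congr rfl fun l _ => by ring
  have t5 : ∑ e, qw w e * G e = ∑ e, qw w e * ∑ l, sgb (e l) * w l - (1 / 2) * ∑ e, qw w e * ∑ l, ∑ m, K l m * (sgb (e l) * sgb (e m))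
      - ∑ e, qw w e * ∑ l, Real.log (1 + sgb (e l) * w l) := by
    rw [Finset.mul_sum, ← Finset.sum_sub_distrib, ← Finset.sum_sub_distrib]
    exact Finset.sum_congr rfl fun e _ => by simp only [hG, hE]; ring
  rw [t5, t1, t2]
  linarith [t3, t4]

/-- average likelihood ratio -/
noncomputable def Lfun {n : ℕ} (B : Matrix S (Fin n) ℝ) (x : Fin n → ℝ) : ℝ :=
  (1 / 2 ^ Fintype.card S) * ∑ e : S → Bool,
    Real.exp (∑ i, ((∑ l, sgb (e l) * B l i) * x i - (∑ l, sgb (e l) * B l i) ^ 2 / 2))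

lemma Lfun_pos {n : ℕ} (B : Matrix S (Fin n) ℝ) (x : Fin n → ℝ) : 0 < Lfun B x := by
  unfold Lfun
  have : 0 < ∑ e : S → Bool, Real.exp (∑ i, ((∑ l, sgb (e l) * B l i) * x i - (∑ l, sgb (e l) * B l i) ^ 2 / 2)) :=
    Finset.sum_pos (fun _ _ => Real.exp_pos _) Finset.univ_nonempty
  positivity

lemma Lfun_ge {n : ℕ} (B : Matrix S (Fin n) ℝ) (x : Fin n → ℝ) (hw : ∀ l, |lin (B l) x| ≤ 1 / 2) :
    Real.exp ((1 / 2) * (∑ l, lin (B l) x ^ 2 - ∑ l, (B * Bᵀ) l l)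
      - (1 / 2) * (∑ l, ∑ m, if l = m then 0 else (B * Bᵀ) l m * (lin (B l) x * lin (B m) x))
      - (1 / 12) * ∑ l, lin (B l) x ^ 4 - 3 * ∑ l, lin (B l) x ^ 6) ≤ Lfun B x := by
  refine (jensen (fun l => lin (B l) x) (fun l m => (B * Bᵀ) l m) hw).trans (le_of_eq ?_)
  unfold Lfun
  congr 1
  refine Finset.sum_congr rfl fun e _ => ?_
  congr 1
  rw [Finset.sum_sub_distrib]
  congr 1
  · simp only [lin, Finset.mul_sum, Finset.sum_mul]
    rw [Finset.sum_comm]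
    exact Finset.sum_congr rfl fun i _ => Finset.sum_congr rfl fun l _ => by ring
  · simp only [Matrix.mul_apply, Matrix.transpose_apply, Finset.mul_sum, Finset.sum_mul, pow_two, Finset.sum_div]
    conv_rhs => rw [Finset.sum_comm]
    refine Finset.sum_congr rfl fun l _ => ?_
    rw [Finset.sum_comm]
    refine Finset.sum_congr rfl fun i _ => ?_
    exact Finset.sum_congr rfl fun m _ => by ring
end

end Part5

section Part6
open MeasureTheory ProbabilityTheory Filter Matrix
open scoped BigOperators Topology
set_option linter.unusedSectionVars false

section
variable {S : Type*} [Fintype S] [DecidableEq S]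

def fro {T : Type*} [Fintype T] (A : Matrix S T ℝ) : ℝ := ∑ l, ∑ m, A l m ^ 2

lemma fro_nonneg {T : Type*} [Fintype T] (A : Matrix S T ℝ) : 0 ≤ fro A :=
  Finset.sum_nonneg fun _ _ => Finset.sum_nonneg fun _ _ => sq_nonneg _

lemma fro_mul (A B : Matrix S S ℝ) : fro (A * B) ≤ fro A * fro B := by
  unfold fro
  rw [Finset.sum_comm (f := fun l m => B l m ^ 2), Finset.sum_mul_sum]
  refine Finset.sum_le_sum fun l _ => Finset.sum_le_sum fun m _ => ?_
  rw [Matrix.mul_apply]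
  exact Finset.sum_mul_sq_le_sq_mul_sq _ _ _

lemma trace_mul_self_le (A : Matrix S S ℝ) : (A * A).trace ≤ fro A := by
  have h : ∑ l, ∑ m, A l m * A m l ≤ ∑ l, ∑ m, (A l m ^ 2 / 2 + A m l ^ 2 / 2) :=
    Finset.sum_le_sum fun l _ => Finset.sum_le_sum fun m _ => by nlinarith [sq_nonneg (A l m - A m l)]
  have h2 : ∑ l, ∑ m, (A l m ^ 2 / 2 + A m l ^ 2 / 2) = fro A := by
    simp only [Finset.sum_add_distrib]
    rw [Finset.sum_comm (f := fun l m => A m l ^ 2 / 2), ← Finset.sum_add_distrib]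
    refine Finset.sum_congr rfl fun l _ => ?_
    rw [← Finset.sum_add_distrib]
    exact Finset.sum_congr rfl fun m _ => by ring
  rw [← h2]
  simpa [Matrix.trace, Matrix.mul_apply] using h

lemma trace_mul_self_symm (A : Matrix S S ℝ) (hA : Aᵀ = A) : (A * A).trace = fro A := by
  simp only [Matrix.trace, Matrix.diag, Matrix.mul_apply, fro]
  refine Finset.sum_congr rfl fun l _ => Finset.sum_congr rfl fun m _ => ?_
  have : A m l = A l m := congrFun (congrFun hA l) m
  rw [this, pow_two]

/-- off-diagonal part -/
def offd (K : Matrix S S ℝ) : Matrix S S ℝ := Matrix.of fun l m => if l = m then 0 else K l m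

lemma fd_facts (K : Matrix S S ℝ) (d : S → ℝ) {u δ : ℝ} (hδ0 : 0 < δ) (hδ1 : δ ≤ 1)
    (hd0 : ∀ l, 0 ≤ d l) (hd : ∀ l, d l ≤ δ) (hdu : |∑ l, d l ^ 2 - 2 * u ^ 2| ≤ δ)
    (hK : fro (K - Matrix.diagonal d) ≤ δ ^ 2) :
    |fro K - 2 * u ^ 2| ≤ δ * (2 * u ^ 2 + 4) ∧ (∀ l, K l l ≤ 2 * δ) ∧ fro (offd K) ≤ δ ^ 2 ∧
    fro (K * K) ≤ 4 * δ ^ 2 * fro K ∧ ∑ l, K l l ^ 2 ≤ 2 * u ^ 2 + δ * (2 * u ^ 2 + 4) := by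
  set E := K - Matrix.diagonal d with hE
  have hKE : ∀ l m, K l m = E l m + if l = m then d l else 0 := by
    intro l m; simp [hE, Matrix.sub_apply, Matrix.diagonal_apply]
  have hEll : ∑ l, E l l ^ 2 ≤ δ ^ 2 := le_trans (Finset.sum_le_sum fun l _ =>
    Finset.single_le_sum (f := fun m => E l m ^ 2) (fun _ _ => sq_nonneg _) (Finset.mem_univ l)) hK
  have hEl : ∀ l, |E l l| ≤ δ := fun l => by
    refine abs_le_of_sq_le_sq ?_ hδ0.le
    exact le_trans (Finset.single_le_sum (f := fun m => E m m ^ 2) (fun _ _ => sq_nonneg _) (Finset.mem_univ l)) hEll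
  have hdu' := abs_le.1 hdu
  have hcross : |∑ l, 2 * (d l * E l l)| ≤ δ * (∑ l, d l ^ 2) + δ := by
    have h1 : ∀ l, |2 * (d l * E l l)| ≤ δ * d l ^ 2 + E l l ^ 2 / δ := by
      intro l
      have hx : E l l ^ 2 / δ * δ = E l l ^ 2 := by field_simp
      have : 0 ≤ (δ * d l - |E l l|) ^ 2 / δ := by positivity
      have e : (δ * d l - |E l l|) ^ 2 / δ = δ * d l ^ 2 + E l l ^ 2 / δ - 2 * (d l * |E l l|) := by
        rw [← sq_abs (E l l)]; field_simp; ring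
      rw [abs_mul, abs_mul, abs_of_nonneg (hd0 l)]
      norm_num; linarith
    refine (Finset.abs_sum_le_sum_abs _ _).trans ((Finset.sum_le_sum fun l _ => h1 l).trans ?_)
    rw [Finset.sum_add_distrib, ← Finset.mul_sum, ← Finset.sum_div]
    have : (∑ l, E l l ^ 2) / δ ≤ δ := by rw [div_le_iff₀ hδ0]; nlinarith
    linarith
  have hcross' := abs_le.1 hcross
  have hfro : fro K = fro E + ∑ l, 2 * (d l * E l l) + ∑ l, d l ^ 2 := by
    unfold fro
    rw [← Finset.sum_add_distrib, ← Finset.sum_add_distrib]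
    refine Finset.sum_congr rfl fun l _ => ?_
    have : ∀ m, K l m ^ 2 = E l m ^ 2 + ((if l = m then 2 * (d l * E l m) else 0) + if l = m then d l ^ 2 else 0) := by
      intro m; rw [hKE]; split_ifs <;> ring
    simp only [this, Finset.sum_add_distrib, Finset.sum_ite_eq, Finset.mem_univ, if_true]
    ring
  have hEn := fro_nonneg E
  have hd2 : 0 ≤ ∑ l, d l ^ 2 := Finset.sum_nonneg fun _ _ => sq_nonneg _
  have hδδ : δ ^ 2 ≤ δ := by nlinarith
  have hδd : δ * ∑ l, d l ^ 2 ≤ δ * (2 * u ^ 2 + 1) := by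
    refine mul_le_mul_of_nonneg_left ?_ hδ0.le; linarith
  refine ⟨?_, ?_, ?_, ?_, ?_⟩
  · rw [abs_le]; constructor <;> nlinarith
  · intro l
    rw [hKE, if_pos rfl]
    have := (abs_le.1 (hEl l)).2
    linarith [hd l]
  · refine le_trans ?_ hK
    refine Finset.sum_le_sum fun l _ => Finset.sum_le_sum fun m _ => ?_
    simp only [offd, Matrix.of_apply]
    split_ifs with h
    · simpa using sq_nonneg _
    · rw [hKE, if_neg h, add_zero]
  · have h1 : fro (K * K) ≤ ∑ l, ∑ m, (2 * (E * K) l m ^ 2 + 2 * (δ ^ 2 * K l m ^ 2)) := by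
      refine Finset.sum_le_sum fun l _ => Finset.sum_le_sum fun m _ => ?_
      have : (K * K) l m = (E * K) l m + d l * K l m := by
        have : K * K = E * K + Matrix.diagonal d * K := by rw [← Matrix.add_mul]; simp [hE]
        rw [this, Matrix.add_apply, Matrix.diagonal_mul]
      rw [this]
      have h3 : (d l * K l m) ^ 2 ≤ δ ^ 2 * K l m ^ 2 := by
        rw [mul_pow]; exact mul_le_mul_of_nonneg_right (pow_le_pow_left₀ (hd0 l) (hd l) 2) (sq_nonneg _)
      nlinarith [sq_nonneg ((E * K) l m - d l * K l m)]
    refine h1.trans ?_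
    simp only [Finset.sum_add_distrib, ← Finset.mul_sum]
    have h2 : fro (E * K) ≤ δ ^ 2 * fro K := (fro_mul E K).trans (mul_le_mul_of_nonneg_right hK (fro_nonneg K))
    unfold fro at h2 ⊢
    linarith
  · have : ∀ l, K l l ^ 2 = E l l ^ 2 + 2 * (d l * E l l) + d l ^ 2 := by
      intro l; rw [hKE, if_pos rfl]; ring
    simp only [this, Finset.sum_add_distrib]
    nlinarith
end

end Part6

section Part7
open MeasureTheory ProbabilityTheory Filter Matrix
open scoped BigOperators Topology
set_option linter.unusedSectionVars false

section
variable {S : Type*} [Fintype S] [DecidableEq S] {n : ℕ}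

lemma sum_B (B : Matrix S (Fin n) ℝ) (l m : S) : ∑ i, B l i * B m i = (B * Bᵀ) l m := by
  simp [Matrix.mul_apply]

lemma lin_eq (B : Matrix S (Fin n) ℝ) (x : Fin n → ℝ) (l : S) : lin (B l) x = (B *ᵥ x) l := rfl

lemma K_symm (B : Matrix S (Fin n) ℝ) : (B * Bᵀ)ᵀ = B * Bᵀ := by
  rw [Matrix.transpose_mul, Matrix.transpose_transpose]

lemma quadW (B : Matrix S (Fin n) ℝ) (R : Matrix S S ℝ) (x : Fin n → ℝ) :
    ∑ l, ∑ m, R l m * (lin (B l) x * lin (B m) x) = x ⬝ᵥ (Bᵀ * R * B) *ᵥ x := by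
  rw [← Matrix.mulVec_mulVec, ← Matrix.mulVec_mulVec, Matrix.dotProduct_mulVec, Matrix.vecMul_transpose]
  simp only [dotProduct, Matrix.mulVec, Finset.mul_sum, lin]
  refine Finset.sum_congr rfl fun l _ => Finset.sum_congr rfl fun m _ => ?_
  simp only [Finset.sum_mul, Finset.mul_sum]
  refine Finset.sum_congr rfl fun i _ => Finset.sum_congr rfl fun j _ => by ring

lemma offd_symm (K : Matrix S S ℝ) (hK : Kᵀ = K) : (offd K)ᵀ = offd K := by
  ext l m
  have : K m l = K l m := congrFun (congrFun hK l) m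
  simp only [offd, Matrix.transpose_apply, Matrix.of_apply, this, eq_comm]

lemma bad1 (B : Matrix S (Fin n) ℝ) {δ : ℝ} (hR : fro (offd (B * Bᵀ)) ≤ δ) {η : ℝ} (hη : 0 < η) :
    (gn n).real {x | η ≤ |∑ l, ∑ m, if l = m then 0 else (B * Bᵀ) l m * (lin (B l) x * lin (B m) x)|}
      ≤ (δ ^ 2 + 2 * (δ * fro (B * Bᵀ))) / η ^ 2 := by
  set K := B * Bᵀ with hKd
  set R := offd K with hRd
  have hKs : Kᵀ = K := K_symm B
  have hRs : Rᵀ = R := offd_symm K hKs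
  have e : ∀ x, (∑ l, ∑ m, if l = m then 0 else K l m * (lin (B l) x * lin (B m) x)) = x ⬝ᵥ (Bᵀ * R * B) *ᵥ x := by
    intro x; rw [← quadW]
    refine Finset.sum_congr rfl fun l _ => Finset.sum_congr rfl fun m _ => ?_
    simp only [hRd, offd, Matrix.of_apply]; split_ifs <;> simp
  have hH : (Bᵀ * R * B).IsHermitian := by
    rw [Matrix.IsHermitian, Matrix.conjTranspose_eq_transpose_of_trivial, Matrix.transpose_mul, Matrix.transpose_mul, hRs, Matrix.transpose_transpose, Matrix.mul_assoc]
  obtain ⟨hi, hv⟩ := quad_sq _ hH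
  have h1 : (Bᵀ * R * B).trace = fro R := by
    rw [Matrix.trace_mul_comm, ← Matrix.mul_assoc, ← hKd, ]
    simp only [Matrix.trace, Matrix.diag, Matrix.mul_apply, fro]
    refine Finset.sum_congr rfl fun l _ => Finset.sum_congr rfl fun m _ => ?_
    have : R m l = R l m := congrFun (congrFun hRs l) m
    rw [this]; simp only [hRd, offd, Matrix.of_apply]; split_ifs <;> ring
  have h2 : ((Bᵀ * R * B) * (Bᵀ * R * B)).trace = ((R * K) * (R * K)).trace := by
    have : (Bᵀ * R * B) * (Bᵀ * R * B) = Bᵀ * (R * K * R * B) := by simp only [hKd, Matrix.mul_assoc]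
    rw [this, Matrix.trace_mul_comm]
    simp only [hKd, Matrix.mul_assoc]
  have hv' : ∫ x, (x ⬝ᵥ (Bᵀ * R * B) *ᵥ x) ^ 2 ∂(gn n) ≤ δ ^ 2 + 2 * (δ * fro K) := by
    rw [hv, h1, h2]
    have a1 := fro_nonneg R
    have a2 := (trace_mul_self_le (R * K)).trans (fro_mul R K)
    have a3 := mul_le_mul_of_nonneg_right hR (fro_nonneg K)
    have a4 := pow_le_pow_left₀ a1 hR 2
    linarith
  have hm := mul_meas_ge_le_integral_of_nonneg (Eventually.of_forall fun x => sq_nonneg _) hi (η ^ 2)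
  rw [le_div_iff₀ (by positivity), mul_comm]
  refine le_trans (le_trans (le_of_eq ?_) hm) hv'
  congr 2
  ext x
  simp only [Set.mem_ofPred_eq, e]
  rw [← sq_abs (x ⬝ᵥ _), pow_le_pow_iff_left₀ hη.le (abs_nonneg _) (by norm_num)]

lemma bad3 (B : Matrix S (Fin n) ℝ) {δ a : ℝ} (hd : ∀ l, (B * Bᵀ) l l ≤ δ) (ha : ∑ l, (B * Bᵀ) l l ^ 2 ≤ a) (h0 : 0 ≤ δ)
    {κ : ℝ} (hκ : 0 < κ) :
    (gn n).real {x | κ ≤ ∑ l, lin (B l) x ^ 6} ≤ 15 * δ * a / κ := by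
  have hi : Integrable (fun x => ∑ l, lin (B l) x ^ 6) (gn n) := integrable_finsetSum _ fun l _ => lin_pow_integrable _ _
  have hm := mul_meas_ge_le_integral_of_nonneg (Eventually.of_forall fun x => Finset.sum_nonneg fun l _ => by positivity) hi κ
  rw [le_div_iff₀ hκ, mul_comm]
  refine hm.trans ?_
  rw [integral_finsetSum _ fun l _ => lin_pow_integrable (B l) _]
  simp only [lin_pow6, sum_B]
  calc ∑ l, 15 * (B * Bᵀ) l l ^ 3 ≤ ∑ l, 15 * δ * (B * Bᵀ) l l ^ 2 := Finset.sum_le_sum fun l _ => by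
        nlinarith [hd l, mul_le_mul_of_nonneg_right (hd l) (sq_nonneg ((B * Bᵀ) l l))]
    _ = 15 * δ * ∑ l, (B * Bᵀ) l l ^ 2 := by rw [Finset.mul_sum]
    _ ≤ _ := by gcongr

lemma bad2 (B : Matrix S (Fin n) ℝ) {δ a : ℝ} (hd : ∀ l, (B * Bᵀ) l l ≤ δ) (ha : ∑ l, (B * Bᵀ) l l ^ 2 ≤ a) (h0 : 0 ≤ δ)
    {η : ℝ} (hη : 0 < η) :
    (gn n).real {x | 3 * a + η ≤ ∑ l, lin (B l) x ^ 4} ≤ 96 * δ ^ 2 * fro (B * Bᵀ) / η ^ 2 := by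
  set K := B * Bᵀ with hKd
  set m := 3 * ∑ l, K l l ^ 2 with hmd
  have hi : Integrable (fun x => ∑ l, lin (B l) x ^ 4) (gn n) := integrable_finsetSum _ fun l _ => lin_pow_integrable _ _
  have hmean : ∫ x, ∑ l, lin (B l) x ^ 4 ∂(gn n) = m := by
    rw [integral_finsetSum _ fun l _ => lin_pow_integrable (B l) _]
    simp only [lin_pow4, sum_B, hmd, Finset.mul_sum]
    rfl
  have e2 : (fun x => (∑ l, lin (B l) x ^ 4) ^ 2) = fun x => ∑ l, ∑ k, lin (B l) x ^ 4 * lin (B k) x ^ 4 := by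
    ext x; rw [pow_two, Finset.sum_mul_sum]
  have hi2 : Integrable (fun x => (∑ l, lin (B l) x ^ 4) ^ 2) (gn n) := by
    rw [e2]; exact integrable_finsetSum _ fun l _ => integrable_finsetSum _ fun k _ => (lin_44 _ _).1
  have hsq : ∫ x, (∑ l, lin (B l) x ^ 4) ^ 2 ∂(gn n) ≤ m ^ 2 + 96 * δ ^ 2 * fro K := by
    rw [e2, integral_finsetSum _ fun l _ => integrable_finsetSum _ fun k _ => (lin_44 (B l) (B k)).1]
    simp_rw [integral_finsetSum _ fun k _ => (lin_44 (B _) (B k)).1, (lin_44 _ _).2, sum_B]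
    have e3 : m ^ 2 + 96 * δ ^ 2 * fro K = ∑ l, ∑ k, (9 * K l l ^ 2 * K k k ^ 2 + 96 * δ ^ 2 * K l k ^ 2) := by
      simp only [Finset.sum_add_distrib, ← Finset.mul_sum, fro]
      congr 1
      simp only [hmd, mul_pow, pow_two (∑ l, K l l ^ 2), Finset.sum_mul_sum]
      norm_num [Finset.mul_sum, Finset.sum_mul, mul_assoc]
    rw [e3]
    refine Finset.sum_le_sum fun l _ => Finset.sum_le_sum fun k _ => ?_
    have hnn : ∀ l, 0 ≤ K l l := fun l => by
      rw [hKd, ← sum_B]; exact Finset.sum_nonneg fun i _ => mul_self_nonneg _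
    have hcs : K l k ^ 2 ≤ K l l * K k k := by
      simp only [hKd, ← sum_B]
      have := Finset.sum_mul_sq_le_sq_mul_sq Finset.univ (B l) (B k)
      simpa [pow_two] using this
    have hdd : K l l * K k k ≤ δ ^ 2 := by
      rw [pow_two]; exact mul_le_mul (hd l) (hd k) (hnn k) h0
    have s1 : K l l * K k k * K l k ^ 2 ≤ δ ^ 2 * K l k ^ 2 := mul_le_mul_of_nonneg_right hdd (sq_nonneg _)
    have s2 : K l k ^ 2 * K l k ^ 2 ≤ δ ^ 2 * K l k ^ 2 := mul_le_mul_of_nonneg_right (hcs.trans hdd) (sq_nonneg _)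
    change 9 * K l l ^ 2 * K k k ^ 2 + 72 * K l l * K k k * K l k ^ 2 + 24 * K l k ^ 4 ≤ _
    nlinarith
  have hi3 : Integrable (fun x => (∑ l, lin (B l) x ^ 4 - m) ^ 2) (gn n) := by
    have : (fun x => (∑ l, lin (B l) x ^ 4 - m) ^ 2) = fun x => (∑ l, lin (B l) x ^ 4) ^ 2 - (2 * m) * (∑ l, lin (B l) x ^ 4) + m ^ 2 := by
      ext x; ring
    rw [this]
    exact (hi2.sub (hi.const_mul _)).add (integrable_const _)
  have hvar : ∫ x, (∑ l, lin (B l) x ^ 4 - m) ^ 2 ∂(gn n) ≤ 96 * δ ^ 2 * fro K := by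
    have : (fun x => (∑ l, lin (B l) x ^ 4 - m) ^ 2) = fun x => (∑ l, lin (B l) x ^ 4) ^ 2 - (2 * m) * (∑ l, lin (B l) x ^ 4) + m ^ 2 := by
      ext x; ring
    have hi4 : Integrable (fun x => (∑ l, lin (B l) x ^ 4) ^ 2 - (2 * m) * (∑ l, lin (B l) x ^ 4)) (gn n) := hi2.sub (hi.const_mul _)
    rw [this, integral_add hi4 (integrable_const _), integral_sub hi2 (hi.const_mul _), integral_const_mul, hmean]
    simp; nlinarith
  have hm := mul_meas_ge_le_integral_of_nonneg (Eventually.of_forall fun x => sq_nonneg _) hi3 (η ^ 2)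
  rw [le_div_iff₀ (by positivity), mul_comm]
  refine le_trans ?_ (hm.trans hvar)
  refine mul_le_mul_of_nonneg_left (measureReal_mono ?_) (by positivity)
  intro x hx
  simp only [Set.mem_ofPred_eq] at hx ⊢
  refine pow_le_pow_left₀ hη.le ?_ 2
  have : m ≤ 3 * a := by rw [hmd]; linarith
  linarith
end

end Part7

section Part8
open MeasureTheory ProbabilityTheory Filter Matrix
open scoped BigOperators Topology

lemma clt_unif (u : ℝ) (F : BoundedContinuousFunction ℝ ℝ) {ε : ℝ} (hε : 0 < ε) :
    ∃ δ > 0, ∀ (n : ℕ) (μ : Fin n → ℝ), |∑ j, μ j ^ 2 - 2 * u ^ 2| ≤ δ → ∑ j, μ j ^ 4 ≤ δ →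
      |∫ x, F (∑ j, (1 / 2) * (μ j * (x j ^ 2 - 1))) ∂(gn n) - ∫ y, F (u * y) ∂(gaussianReal 0 1)| ≤ ε := by
  by_contra hcon
  push Not at hcon
  have hk : ∀ k : ℕ, 0 < 1 / ((k : ℝ) + 1) := fun k => by positivity
  choose n μ h2 h4 hbad using fun k : ℕ => hcon (1 / ((k : ℝ) + 1)) (hk k)
  have hlim := tendsto_one_div_add_atTop_nhds_zero_nat (𝕜 := ℝ)
  have hc := clt μ u
    (by
      rw [tendsto_iff_dist_tendsto_zero]
      exact squeeze_zero (fun _ => dist_nonneg) (fun k => by rw [Real.dist_eq]; exact h2 k) hlim)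
    (squeeze_zero (fun _ => Finset.sum_nonneg fun _ _ => by positivity) h4 hlim) F
  rw [Metric.tendsto_atTop] at hc
  obtain ⟨N, hN⟩ := hc ε hε
  have := hN N le_rfl
  rw [Real.dist_eq] at this
  exact absurd this (not_lt.2 (hbad N).le)

noncomputable def Gfun (s u : ℝ) : ℝ := ∫ y, min s (Real.exp (u * y - u ^ 2 / 2)) ∂(gaussianReal 0 1)

noncomputable def minExp (s c : ℝ) (hs : 0 < s) : BoundedContinuousFunction ℝ ℝ :=
  BoundedContinuousFunction.ofNormedAddCommGroup (fun y => min s (Real.exp (y - c))) (by fun_prop) s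
    (fun y => by
      rw [Real.norm_of_nonneg (le_min hs.le (Real.exp_pos _).le)]; exact min_le_left _ _)

lemma minExp_apply (s c : ℝ) (hs : 0 < s) (y : ℝ) : minExp s c hs y = min s (Real.exp (y - c)) := rfl

lemma minExp_int (s c : ℝ) (hs : 0 < s) (u : ℝ) :
    Integrable (fun y => min s (Real.exp (u * y - c))) (gaussianReal 0 1) := by
  refine Integrable.of_bound (C := s) (by fun_prop) (Eventually.of_forall fun y => ?_)
  rw [Real.norm_of_nonneg (le_min hs.le (Real.exp_pos _).le)]; exact min_le_left _ _

lemma G_shift (s u η : ℝ) (hs : 0 < s) (hη : 0 ≤ η) :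
    Gfun s u - η * s ≤ ∫ y, minExp s (u ^ 2 / 2 + η) hs (u * y) ∂(gaussianReal 0 1) := by
  have h1 : Gfun s u - η * s = ∫ y, (min s (Real.exp (u * y - u ^ 2 / 2)) - η * s) ∂(gaussianReal 0 1) := by
    rw [integral_sub (minExp_int s _ hs u) (integrable_const _)]; simp [Gfun]
  rw [h1]
  refine integral_mono ((minExp_int s _ hs u).sub (integrable_const _)) (minExp_int s _ hs u) fun y => ?_
  simp only [minExp_apply]
  set z := Real.exp (u * y - u ^ 2 / 2) with hz
  have e : Real.exp (u * y - (u ^ 2 / 2 + η)) = Real.exp (-η) * z := by rw [hz, ← Real.exp_add]; congr 1; ring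
  have hzp : 0 < z := Real.exp_pos _
  have h2 : 1 - η ≤ Real.exp (-η) := by have := Real.add_one_le_exp (-η); linarith
  have h3 : Real.exp (-η) ≤ 1 := Real.exp_le_one_iff.2 (by linarith)
  rw [e]
  refine le_min ?_ ?_
  · have := min_le_left s z
    nlinarith
  · rcases le_total (1 - η) 0 with h | h
    · have := min_le_left s z
      have : 0 ≤ Real.exp (-η) * z := by positivity
      nlinarith
    · have a1 := min_le_left s z
      have a2 := min_le_right s z
      have a3 : 0 ≤ min s z := le_min hs.le hzp.le
      nlinarith [mul_le_mul_of_nonneg_right h2 hzp.le, mul_le_mul_of_nonneg_left a2 h, mul_le_mul_of_nonneg_left a1 hη]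

section
variable {S : Type*} [Fintype S] [DecidableEq S] {n : ℕ}

lemma Lfun_cont (B : Matrix S (Fin n) ℝ) : Continuous (Lfun B) := by unfold Lfun; fun_prop

lemma minL_int (B : Matrix S (Fin n) ℝ) {s : ℝ} (hs : 0 < s) : Integrable (fun x => min s (Lfun B x)) (gn n) := by
  have := Lfun_cont B
  refine Integrable.of_bound (C := s) (by fun_prop) (Eventually.of_forall fun y => ?_)
  rw [Real.norm_of_nonneg (le_min hs.le (Lfun_pos B y).le)]; exact min_le_left _ _

lemma T_diag (B : Matrix S (Fin n) ℝ) : ∃ (μ : Fin n → ℝ) (g : (Fin n → ℝ) → Fin n → ℝ), MeasurePreserving g (gn n) (gn n) ∧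
    (∀ x, (1 / 2) * (∑ l, lin (B l) x ^ 2 - ∑ l, (B * Bᵀ) l l) = ∑ j, (1 / 2) * (μ j * (g x j ^ 2 - 1))) ∧
    ∑ j, μ j ^ 2 = fro (B * Bᵀ) ∧ ∑ j, μ j ^ 4 = fro (B * Bᵀ * (B * Bᵀ)) := by
  have hH : (Bᵀ * B).IsHermitian := by
    rw [Matrix.IsHermitian, Matrix.conjTranspose_eq_transpose_of_trivial, Matrix.transpose_mul, Matrix.transpose_transpose]
  obtain ⟨μ, g, hg, h1, h2, h3, h4⟩ := quad_diag _ hH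
  refine ⟨μ, g, hg, ?_, ?_, ?_⟩
  · intro x
    rw [← Finset.mul_sum]
    simp only [mul_sub, Finset.sum_sub_distrib, mul_one]
    rw [← h1, h2, Matrix.trace_mul_comm]
    congr 2
    rw [← Matrix.mulVec_mulVec, Matrix.dotProduct_mulVec, Matrix.vecMul_transpose]
    simp only [dotProduct, ← lin_eq, pow_two]
  · rw [h3, ← trace_mul_self_symm _ (K_symm B)]
    have : Bᵀ * B * (Bᵀ * B) = Bᵀ * (B * Bᵀ * B) := by simp only [Matrix.mul_assoc]
    rw [this, Matrix.trace_mul_comm]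
    simp only [Matrix.mul_assoc]
  · have hs : (B * Bᵀ * (B * Bᵀ))ᵀ = B * Bᵀ * (B * Bᵀ) := by rw [Matrix.transpose_mul, K_symm]
    rw [h4, ← trace_mul_self_symm _ hs]
    have : Bᵀ * B * (Bᵀ * B) * (Bᵀ * B * (Bᵀ * B)) = Bᵀ * (B * Bᵀ * (B * Bᵀ * (B * Bᵀ)) * B) := by simp only [Matrix.mul_assoc]
    rw [this, Matrix.trace_mul_comm]
    simp only [Matrix.mul_assoc]
end

lemma fd_bound {S : Type*} [Fintype S] [DecidableEq S] {n : ℕ} (B : Matrix S (Fin n) ℝ) (d : S → ℝ) {u δ s η : ℝ}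
    (hs : 0 < s) (hη : 0 < η) (hδ0 : 0 < δ) (hδ1 : δ ≤ 1)
    (hd0 : ∀ l, 0 ≤ d l) (hd : ∀ l, d l ≤ δ) (hdu : |∑ l, d l ^ 2 - 2 * u ^ 2| ≤ δ)
    (hK : fro (B * Bᵀ - Matrix.diagonal d) ≤ δ ^ 2) (hδη : 3 * (δ * (2 * u ^ 2 + 4)) ≤ 6 * η) :
    ∫ x, minExp s (u ^ 2 / 2 + 3 * η) hs ((1 / 2) * (∑ l, lin (B l) x ^ 2 - ∑ l, (B * Bᵀ) l l)) ∂(gn n)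
      - s * (δ * ((1 + 2 * (4 * u ^ 2 + 4)) / (2 * η) ^ 2 + 384 * (4 * u ^ 2 + 4) / (6 * η) ^ 2
        + 30 * (4 * u ^ 2 + 4) / (min (η / 3) (1 / 64)))) ≤ ∫ x, min s (Lfun B x) ∂(gn n) := by
  obtain ⟨f1, f2, f3, f4, f5⟩ := fd_facts (B * Bᵀ) d hδ0 hδ1 hd0 hd hdu hK
  set K := B * Bᵀ with hKd
  set κ := min (η / 3) (1 / 64) with hκd
  have hκ : 0 < κ := lt_min (by positivity) (by norm_num)
  set A := 4 * u ^ 2 + 4 with hA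
  have hAp : 0 < A := by positivity
  have hδQ : δ * (2 * u ^ 2 + 4) ≤ 2 * u ^ 2 + 4 := mul_le_of_le_one_left (by positivity) hδ1
  have hfA : fro K ≤ A := by have := (abs_le.1 f1).2; rw [hA]; linarith
  have hδδ : δ ^ 2 ≤ δ := by nlinarith
  set b1 : Set (Fin n → ℝ) := {x | 2 * η ≤ |∑ l, ∑ m, if l = m then 0 else K l m * (lin (B l) x * lin (B m) x)|} with hb1
  set b2 : Set (Fin n → ℝ) := {x | 3 * (2 * u ^ 2 + δ * (2 * u ^ 2 + 4)) + 6 * η ≤ ∑ l, lin (B l) x ^ 4} with hb2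
  set b3 : Set (Fin n → ℝ) := {x | κ ≤ ∑ l, lin (B l) x ^ 6} with hb3
  have p1 : (gn n).real b1 ≤ δ * ((1 + 2 * A) / (2 * η) ^ 2) := by
    refine (bad1 B f3 (by positivity)).trans ?_
    rw [← mul_div_assoc]
    refine div_le_div_of_nonneg_right ?_ (by positivity)
    have : δ ^ 2 * fro K ≤ δ * A := mul_le_mul hδδ hfA (fro_nonneg _) hδ0.le
    have h4 : (δ ^ 2) ^ 2 ≤ δ := by nlinarith [sq_nonneg δ]
    linarith
  have p2 : (gn n).real b2 ≤ δ * (384 * A / (6 * η) ^ 2) := by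
    refine (bad2 B f2 f5 (by positivity) (by positivity)).trans ?_
    rw [← mul_div_assoc]
    refine div_le_div_of_nonneg_right ?_ (by positivity)
    have : δ ^ 2 * fro K ≤ δ * A := mul_le_mul hδδ hfA (fro_nonneg _) hδ0.le
    nlinarith
  have p3 : (gn n).real b3 ≤ δ * (30 * A / κ) := by
    refine (bad3 B f2 (f5.trans (show _ ≤ A by rw [hA]; linarith)) (by positivity) hκ).trans (le_of_eq ?_)
    ring
  set bad := b1 ∪ b2 ∪ b3 with hbad
  have hW : Measurable fun x => |∑ l, ∑ m, if l = m then 0 else K l m * (lin (B l) x * lin (B m) x)| := by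
    have : Continuous fun x => |∑ l, ∑ m, if l = m then 0 else K l m * (lin (B l) x * lin (B m) x)| := by
      refine continuous_abs.comp (continuous_finsetSum _ fun l _ => continuous_finsetSum _ fun m _ => ?_)
      split_ifs <;> fun_prop
    exact this.measurable
  have hmb : MeasurableSet bad := by
    refine (MeasurableSet.union (measurableSet_le measurable_const hW) (measurableSet_le measurable_const ?_)).union (measurableSet_le measurable_const ?_)
    · fun_prop
    · fun_prop
  have pbad : (gn n).real bad ≤ δ * ((1 + 2 * A) / (2 * η) ^ 2 + 384 * A / (6 * η) ^ 2 + 30 * A / κ) := by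
    have h1 := measureReal_union_le (μ := gn n) (b1 ∪ b2) b3
    have h2 := measureReal_union_le (μ := gn n) b1 b2
    rw [mul_add, mul_add]; linarith
  have hint1 : Integrable (fun x => minExp s (u ^ 2 / 2 + 3 * η) hs ((1 / 2) * (∑ l, lin (B l) x ^ 2 - ∑ l, K l l))) (gn n) := by
    refine Integrable.of_bound (C := s) (Continuous.aestronglyMeasurable (by fun_prop)) (Eventually.of_forall fun y => ?_)
    rw [minExp_apply, Real.norm_of_nonneg (le_min hs.le (Real.exp_pos _).le)]; exact min_le_left _ _
  have hint2 : Integrable (fun x => bad.indicator (fun _ => s) x) (gn n) := (integrable_const s).indicator hmb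
  have hmain : ∫ x, minExp s (u ^ 2 / 2 + 3 * η) hs ((1 / 2) * (∑ l, lin (B l) x ^ 2 - ∑ l, K l l)) ∂(gn n)
      ≤ ∫ x, (min s (Lfun B x) + bad.indicator (fun _ => s) x) ∂(gn n) := by
    refine integral_mono hint1 ((minL_int B hs).add hint2) fun x => ?_
    simp only [minExp_apply]
    have hL0 : 0 ≤ min s (Lfun B x) := le_min hs.le (Lfun_pos B x).le
    by_cases hx : x ∈ bad
    · rw [Set.indicator_of_mem hx]
      exact (min_le_left _ _).trans (by linarith)
    · rw [Set.indicator_of_notMem hx, add_zero]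
      simp only [hbad, hb1, hb2, hb3, Set.mem_union, Set.mem_ofPred_eq, not_or, not_le] at hx
      obtain ⟨⟨x1, x2⟩, x3⟩ := hx
      have hw : ∀ l, |lin (B l) x| ≤ 1 / 2 := by
        intro l
        have h6 : lin (B l) x ^ 6 ≤ ∑ l, lin (B l) x ^ 6 := Finset.single_le_sum (f := fun l => lin (B l) x ^ 6) (fun _ _ => by positivity) (Finset.mem_univ l)
        have h7 : κ ≤ 1 / 64 := min_le_right _ _
        refine le_of_pow_le_pow_left₀ (n := 6) (by norm_num) (by norm_num) ?_
        rw [Even.pow_abs (by decide)]; norm_num; linarith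
      refine min_le_min le_rfl (le_trans (Real.exp_le_exp.2 ?_) (Lfun_ge B x hw))
      have h8 : κ ≤ η / 3 := min_le_left _ _
      have h9 := (abs_lt.1 x1).2
      rw [← hKd]
      linarith
  rw [integral_add (minL_int B hs) hint2, integral_indicator hmb, setIntegral_const, smul_eq_mul] at hmain
  have := mul_le_mul_of_nonneg_left pbad hs.le
  linarith

lemma fd_lemma.{v} (u s ε : ℝ) (hs : 0 < s) (hε : 0 < ε) : ∃ δ > 0, ∀ (S : Type v) [Fintype S] [DecidableEq S] (n : ℕ)
    (B : Matrix S (Fin n) ℝ) (d : S → ℝ), (∀ l, 0 ≤ d l) → (∀ l, d l ≤ δ) → |∑ l, d l ^ 2 - 2 * u ^ 2| ≤ δ →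
    fro (B * Bᵀ - Matrix.diagonal d) ≤ δ ^ 2 → Gfun s u - ε ≤ ∫ x, min s (Lfun B x) ∂(gn n) := by
  set η := ε / (9 * s) with hη
  have hηp : 0 < η := by positivity
  obtain ⟨δ1, hδ1, hclt⟩ := clt_unif u (minExp s (u ^ 2 / 2 + 3 * η) hs) (show 0 < ε / 3 by positivity)
  set Cη := (1 + 2 * (4 * u ^ 2 + 4)) / (2 * η) ^ 2 + 384 * (4 * u ^ 2 + 4) / (6 * η) ^ 2
        + 30 * (4 * u ^ 2 + 4) / (min (η / 3) (1 / 64)) with hC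
  have hκ : 0 < min (η / 3) (1 / 64) := lt_min (by positivity) (by norm_num)
  have hCp : 0 < Cη := by positivity
  have hQ : 0 < 2 * u ^ 2 + 4 := by positivity
  set δ := min (min 1 (ε / (3 * s * Cη))) (min (δ1 / (16 * (u ^ 2 + 1))) (2 * η / (2 * u ^ 2 + 4))) with hδd
  have hδp : 0 < δ := by
    refine lt_min (lt_min one_pos (by positivity)) (lt_min (by positivity) (by positivity))
  have e1 : δ ≤ 1 := (min_le_left _ _).trans (min_le_left _ _)
  have e2 : δ ≤ ε / (3 * s * Cη) := (min_le_left _ _).trans (min_le_right _ _)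
  have e3 : δ ≤ δ1 / (16 * (u ^ 2 + 1)) := (min_le_right _ _).trans (min_le_left _ _)
  have e4 : δ ≤ 2 * η / (2 * u ^ 2 + 4) := (min_le_right _ _).trans (min_le_right _ _)
  rw [le_div_iff₀ (by positivity)] at e2 e3 e4
  refine ⟨δ, hδp, ?_⟩
  intro S _ _ n B d hd0 hd hdu hK
  have hb := fd_bound B d hs hηp hδp e1 hd0 hd hdu hK (by linarith)
  rw [← hC] at hb
  obtain ⟨f1, -, -, f4, -⟩ := fd_facts (B * Bᵀ) d hδp e1 hd0 hd hdu hK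
  obtain ⟨μ, g, hg, t1, t2, t3⟩ := T_diag B
  have hδQ : δ * (2 * u ^ 2 + 4) ≤ 2 * u ^ 2 + 4 := mul_le_of_le_one_left (by positivity) e1
  have hu2 := sq_nonneg u
  have hfr : fro (B * Bᵀ) ≤ 4 * u ^ 2 + 4 := by have := (abs_le.1 f1).2; linarith
  have hc := hclt n μ (by rw [t2]; nlinarith) (by
    rw [t3]
    have hδδ : δ ^ 2 ≤ δ := by nlinarith
    have : δ ^ 2 * fro (B * Bᵀ) ≤ δ * (4 * u ^ 2 + 4) := mul_le_mul hδδ hfr (fro_nonneg _) hδp.le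
    nlinarith)
  have heq : ∫ x, minExp s (u ^ 2 / 2 + 3 * η) hs ((1 / 2) * (∑ l, lin (B l) x ^ 2 - ∑ l, (B * Bᵀ) l l)) ∂(gn n)
      = ∫ x, minExp s (u ^ 2 / 2 + 3 * η) hs (∑ j, (1 / 2) * (μ j * (x j ^ 2 - 1))) ∂(gn n) := by
    simp_rw [t1]
    conv_rhs => rw [← hg.map_eq]
    rw [integral_map hg.measurable.aemeasurable (Continuous.aestronglyMeasurable (by fun_prop))]
  rw [heq] at hb
  have hG := G_shift s u (3 * η) hs (by positivity)
  have h3 : 3 * η * s = ε / 3 := by rw [hη]; field_simp; norm_num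
  have h4 := (abs_le.1 hc).1
  have h5 : s * (δ * Cη) ≤ ε / 3 := by linarith
  linarith

end Part8

section Part9
open MeasureTheory ProbabilityTheory Filter
open scoped BigOperators Topology

lemma gauss_shift (u H : ℝ) :
    ∫ y, (Set.Iic H).indicator (fun y => Real.exp (u * y - u ^ 2 / 2)) y ∂(gaussianReal 0 1)
      = stdGaussCDF (H - u) := by
  have h1 : stdGaussCDF (H - u)
      = ∫ y, (Set.Iic (H - u)).indicator (fun _ => (1 : ℝ)) y ∂(gaussianReal 0 1) := by
    rw [integral_indicator measurableSet_Iic]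
    simp [stdGaussCDF, Measure.real]
  rw [h1, integral_gaussianReal_eq_integral_smul one_ne_zero,
    integral_gaussianReal_eq_integral_smul one_ne_zero]
  rw [← integral_sub_right_eq_self (fun x => gaussianPDFReal 0 1 x •
    (Set.Iic (H - u)).indicator (fun _ => (1 : ℝ)) x) u]
  congr 1
  ext y
  by_cases hy : y ≤ H
  · rw [Set.indicator_of_mem (by simpa using hy), Set.indicator_of_mem (by simpa using hy)]
    simp only [gaussianPDFReal, smul_eq_mul, mul_one, NNReal.coe_one, sub_zero]
    rw [mul_assoc, ← Real.exp_add]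
    congr 2
    ring
  · rw [Set.indicator_of_notMem (by simpa using hy), Set.indicator_of_notMem (by simpa using hy)]
    simp

lemma Phi_nonneg (x : ℝ) : 0 ≤ stdGaussCDF x := ENNReal.toReal_nonneg

lemma Phi_Ioi (x : ℝ) : (gaussianReal 0 1).real (Set.Ioi x) = 1 - stdGaussCDF x := by
  rw [← Set.compl_Iic, probReal_compl_eq_one_sub measurableSet_Iic]
  rfl

lemma Phi_neg (x : ℝ) : stdGaussCDF (-x) = 1 - stdGaussCDF x := by
  rw [← Phi_Ioi]
  have : NullSingletonClass (gaussianReal 0 1) := by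
    exact nullSingletonClass_gaussianReal one_ne_zero
  have h : (gaussianReal 0 1).map (fun x => -x) = gaussianReal 0 1 := by
    rw [gaussianReal_map_neg]; simp
  unfold stdGaussCDF Measure.real
  conv_lhs => rw [← h]
  rw [Measure.map_apply measurable_neg measurableSet_Iic]
  have : (fun x : ℝ => -x) ⁻¹' Set.Iic (-x) = Set.Ici x := by ext; simp
  rw [this, measure_congr Ioi_ae_eq_Ici]

lemma Phi_cont : Continuous stdGaussCDF := by
  have h : ∀ x, stdGaussCDF x = stdGaussCDF 0 + ∫ y in (0:ℝ)..x, gaussianPDFReal 0 1 y := by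
    intro x
    have hI : ∀ x, stdGaussCDF x = ∫ y in Set.Iic x, gaussianPDFReal 0 1 y := fun x => by
      unfold stdGaussCDF
      rw [gaussianReal_apply_eq_integral _ one_ne_zero, ENNReal.toReal_ofReal]
      exact integral_nonneg fun y => gaussianPDFReal_nonneg _ _ _
    rw [hI, hI, ← intervalIntegral.integral_Iic_sub_Iic
      (integrable_gaussianPDFReal 0 1).integrableOn (integrable_gaussianPDFReal 0 1).integrableOn]
    ring
  rw [show stdGaussCDF = _ from funext h]
  exact continuous_const.add ((integrable_gaussianPDFReal 0 1).continuous_primitive 0)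

lemma Phi_bot : Tendsto stdGaussCDF atBot (𝓝 0) := by
  have := tendsto_cdf_atBot (gaussianReal 0 1)
  refine this.congr fun x => ?_
  rw [cdf_eq_real]; rfl

lemma G_eq {u : ℝ} (hu : 0 ≤ u) (H : ℝ) :
    Gfun (Real.exp (u * H - u ^ 2 / 2)) u =
      Real.exp (u * H - u ^ 2 / 2) * (1 - stdGaussCDF H) + stdGaussCDF (H - u) := by
  rw [← gauss_shift, ← Phi_Ioi]
  have hs : 0 < Real.exp (u * H - u ^ 2 / 2) := Real.exp_pos _
  set s := Real.exp (u * H - u ^ 2 / 2) with hsdef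
  have h2 : s * (gaussianReal 0 1).real (Set.Ioi H)
      = ∫ y, (Set.Ioi H).indicator (fun _ => s) y ∂(gaussianReal 0 1) := by
    rw [integral_indicator measurableSet_Ioi]
    simp [Measure.real, mul_comm]
  have hpt : ∀ y, min s (Real.exp (u * y - u ^ 2 / 2)) = (Set.Ioi H).indicator (fun _ => s) y +
      (Set.Iic H).indicator (fun y => Real.exp (u * y - u ^ 2 / 2)) y := by
    intro y
    by_cases hy : y ≤ H
    · rw [Set.indicator_of_notMem (by simpa using hy), Set.indicator_of_mem (by simpa using hy),
        zero_add, min_eq_right]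
      exact Real.exp_le_exp.2 (by nlinarith)
    · rw [Set.indicator_of_mem (by simpa using hy), Set.indicator_of_notMem (by simpa using hy),
        add_zero, min_eq_left]
      push Not at hy
      exact Real.exp_le_exp.2 (by nlinarith)
  unfold Gfun
  rw [h2, ← integral_add]
  · simp_rw [hpt]
  · exact (integrable_const s).indicator measurableSet_Ioi
  · refine Integrable.mono' (integrable_const s) ?_ (ae_of_all _ fun y => ?_)
    · exact ((Measurable.indicator (by fun_prop) measurableSet_Iic)).aestronglyMeasurable
    · by_cases hy : y ≤ H
      · rw [Set.indicator_of_mem (by simpa using hy), Real.norm_of_nonneg (Real.exp_pos _).le]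
        exact Real.exp_le_exp.2 (by nlinarith)
      · rw [Set.indicator_of_notMem (by simpa using hy)]
        simpa using hs.le

lemma G_one {u : ℝ} (hu : 0 ≤ u) : Gfun 1 u = 2 * stdGaussCDF (-u / 2) := by
  have := G_eq hu (u / 2)
  have e : u * (u / 2) - u ^ 2 / 2 = 0 := by ring
  rw [e, Real.exp_zero, one_mul, ← Phi_neg] at this
  rw [this, show u / 2 - u = -u / 2 by ring, show -(u / 2) = -u / 2 by ring]
  ring

end Part9

section Part10
open MeasureTheory ProbabilityTheory Filter
open scoped BigOperators Topology ENNReal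

lemma gauss_density (a : ℝ) : gaussianReal a 1 =
    (gaussianReal 0 1).withDensity (fun x => ENNReal.ofReal (Real.exp (x * a - a ^ 2 / 2))) := by
  rw [gaussianReal_of_var_ne_zero _ one_ne_zero, gaussianReal_of_var_ne_zero _ one_ne_zero,
    ← withDensity_mul _ (measurable_gaussianPDF 0 1) (by fun_prop)]
  congr 1
  ext x
  simp only [gaussianPDF, Pi.mul_apply]
  rw [← ENNReal.ofReal_mul (gaussianPDFReal_nonneg _ _ _)]
  congr 1
  simp only [gaussianPDFReal, NNReal.coe_one, sub_zero]
  rw [mul_assoc _ (Real.exp _), ← Real.exp_add]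
  congr 2
  ring

instance uniformCube_prob (d : ℕ) : IsProbabilityMeasure (uniformCube d) := by
  constructor
  rw [uniformCube, Measure.restrict_apply_univ, Real.volume_Icc_pi]
  simp

lemma pi_withDensity {n : ℕ} {X : Type*} [MeasurableSpace X] (μ : Measure X)
    [IsProbabilityMeasure μ] (e : X → ℝ≥0∞) (he : Measurable e)
    [SigmaFinite (μ.withDensity e)] :
    (Measure.pi fun _ : Fin n => μ.withDensity e) =
      (Measure.pi fun _ : Fin n => μ).withDensity (fun z => ∏ i, e (z i)) := by
  refine Measure.pi_eq fun s hs => ?_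
  rw [withDensity_apply _ (MeasurableSet.univ_pi hs), ← lintegral_indicator (MeasurableSet.univ_pi hs)]
  have h1 : ∀ z : Fin n → X, (Set.univ.pi s).indicator (fun z => ∏ i, e (z i)) z
      = ∏ i, (s i).indicator e (z i) := by
    intro z
    by_cases hz : z ∈ Set.univ.pi s
    · rw [Set.indicator_of_mem hz]
      exact Finset.prod_congr rfl fun i _ => (Set.indicator_of_mem (hz i (Set.mem_univ i)) _).symm
    · rw [Set.indicator_of_notMem hz]
      simp only [Set.mem_pi, Set.mem_univ, forall_const, not_forall] at hz
      obtain ⟨i, hi⟩ := hz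
      exact (Finset.prod_eq_zero (Finset.mem_univ i) (Set.indicator_of_notMem hi _)).symm
  simp_rw [h1]
  have hind : iIndepFun (fun (i : Fin n) (z : Fin n → X) => (s i).indicator e (z i))
      (Measure.pi fun _ : Fin n => μ) :=
    iIndepFun_pi (X := fun i => (s i).indicator e)
      (fun i => (he.indicator (hs i)).aemeasurable)
  have := lintegral_prod_eq_prod_lintegral_of_indepFun Finset.univ _ hind
    (fun i => (he.indicator (hs i)).comp (measurable_pi_apply i))
  refine this.trans (Finset.prod_congr rfl fun i _ => ?_)
  rw [withDensity_apply _ (hs i), ← lintegral_indicator (hs i)]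
  have hmp := measurePreserving_eval (fun _ : Fin n => μ) i
  exact hmp.lintegral_comp (he.indicator (hs i))

/-- one-observation likelihood -/
noncomputable def lik {d : ℕ} (f : (Fin d → ℝ) → ℝ) (p : ℝ × (Fin d → ℝ)) : ℝ :=
  Real.exp (f p.2 * p.1 - f p.2 ^ 2 / 2)

lemma lik_meas {d : ℕ} {f : (Fin d → ℝ) → ℝ} (hf : Measurable f) : Measurable (lik f) := by
  unfold lik; fun_prop

lemma lik_prod_nonneg {d n : ℕ} (f : (Fin d → ℝ) → ℝ) (z : Fin n → ℝ × (Fin d → ℝ)) :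
    0 ≤ ∏ i, lik f (z i) := Finset.prod_nonneg fun _ _ => (Real.exp_pos _).le

lemma obsLaw_zero (d : ℕ) : obsLaw d 0 = (gaussianReal 0 1).prod (uniformCube d) := by
  unfold obsLaw
  simp [Measure.map_id']

lemma obsLaw_density {d : ℕ} {f : (Fin d → ℝ) → ℝ} (hf : Measurable f) :
    obsLaw d f = (obsLaw d 0).withDensity (fun p => ENNReal.ofReal (lik f p)) := by
  rw [obsLaw_zero]
  ext s hs
  have hm : Measurable fun p : ℝ × (Fin d → ℝ) => (f p.2 + p.1, p.2) := by fun_prop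
  have hl : Measurable (fun p => ENNReal.ofReal (lik f p)) := (lik_meas hf).ennreal_ofReal
  rw [obsLaw, Measure.map_apply hm hs, Measure.prod_apply_symm (hm hs), withDensity_apply _ hs,
    ← lintegral_indicator hs, lintegral_prod_symm _ (hl.indicator hs).aemeasurable]
  refine lintegral_congr fun t => ?_
  have hA : MeasurableSet ((fun x : ℝ => (x, t)) ⁻¹' s) := measurable_prodMk_right hs
  have h1 : (fun x : ℝ => (x, t)) ⁻¹' ((fun p : ℝ × (Fin d → ℝ) => (f p.2 + p.1, p.2)) ⁻¹' s)
      = (fun x => f t + x) ⁻¹' ((fun x : ℝ => (x, t)) ⁻¹' s) := rfl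
  rw [h1, ← Measure.map_apply (by fun_prop) hA, gaussianReal_map_const_add, zero_add, gauss_density,
    withDensity_apply _ hA, ← lintegral_indicator hA]
  refine lintegral_congr fun x => ?_
  by_cases hx : (x, t) ∈ s
  · rw [Set.indicator_of_mem (show x ∈ _ from hx), Set.indicator_of_mem hx, lik]
    simp only [mul_comm]
  · rw [Set.indicator_of_notMem (show x ∉ _ from hx), Set.indicator_of_notMem hx]

lemma obsLaw_prob {d : ℕ} {f : (Fin d → ℝ) → ℝ} (hf : Measurable f) :
    IsProbabilityMeasure (obsLaw d f) :=
  Measure.isProbabilityMeasure_map (by fun_prop)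

lemma jointLaw_density {d : ℕ} (n : ℕ) {f : (Fin d → ℝ) → ℝ} (hf : Measurable f) :
    jointLaw d n f = (jointLaw d n 0).withDensity (fun z => ENNReal.ofReal (∏ i, lik f (z i))) := by
  have := obsLaw_prob (d := d) (f := 0) measurable_const
  have h2 := obsLaw_prob hf
  unfold jointLaw
  rw [obsLaw_density hf] at h2 ⊢
  rw [pi_withDensity _ _ (lik_meas hf).ennreal_ofReal]
  congr 1
  ext z
  rw [ENNReal.ofReal_prod_of_nonneg fun i _ => show 0 ≤ lik f (z i) from (Real.exp_pos _).le]

instance joint0_prob (d n : ℕ) : IsProbabilityMeasure (jointLaw d n 0) := by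
  have := obsLaw_prob (d := d) (f := 0) measurable_const
  unfold jointLaw; infer_instance

lemma joint_prob {d : ℕ} (n : ℕ) {f : (Fin d → ℝ) → ℝ} (hf : Measurable f) :
    IsProbabilityMeasure (jointLaw d n f) := by
  have := obsLaw_prob hf
  unfold jointLaw; infer_instance

lemma lik_int {d : ℕ} (n : ℕ) {f : (Fin d → ℝ) → ℝ} (hf : Measurable f) :
    Integrable (fun z : Fin n → ℝ × (Fin d → ℝ) => ∏ i, lik f (z i)) (jointLaw d n 0) := by
  have hm : Measurable (fun z : Fin n → ℝ × (Fin d → ℝ) => ∏ i, lik f (z i)) :=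
    Finset.measurable_prod _ fun i _ => (lik_meas hf).comp (measurable_pi_apply i)
  have hp := joint_prob n hf
  have h1 : jointLaw d n f Set.univ = 1 := measure_univ
  rw [jointLaw_density n hf, withDensity_apply _ MeasurableSet.univ, Measure.restrict_univ] at h1
  refine ⟨hm.aestronglyMeasurable, ?_⟩
  rw [hasFiniteIntegral_iff_ofReal (ae_of_all _ fun z => lik_prod_nonneg f z), h1]
  simp

lemma typeII_eq {d : ℕ} (n : ℕ) {f : (Fin d → ℝ) → ℝ} (hf : Measurable f)
    (ψ : (Fin n → ℝ × (Fin d → ℝ)) → ℝ) :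
    typeII d n f ψ = ∫ z, (∏ i, lik f (z i)) * (1 - ψ z) ∂(jointLaw d n 0) := by
  have hm : Measurable (fun z : Fin n → ℝ × (Fin d → ℝ) => ∏ i, lik f (z i)) :=
    Finset.measurable_prod _ fun i _ => (lik_meas hf).comp (measurable_pi_apply i)
  unfold typeII
  rw [jointLaw_density n hf, integral_withDensity_eq_integral_toReal_smul hm.ennreal_ofReal
    (ae_of_all _ fun z => ENNReal.ofReal_lt_top)]
  refine integral_congr_ae (ae_of_all _ fun z => ?_)
  simp only [smul_eq_mul]
  rw [ENNReal.toReal_ofReal (lik_prod_nonneg f z)]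

lemma typeII_le_one {d : ℕ} (n : ℕ) (f : (Fin d → ℝ) → ℝ)
    {ψ : (Fin n → ℝ × (Fin d → ℝ)) → ℝ} (hψ : IsTest ψ) : typeII d n f ψ ≤ 1 := by
  by_cases hm : AEMeasurable (fun p : ℝ × (Fin d → ℝ) => (f p.2 + p.1, p.2))
      ((gaussianReal 0 1).prod (uniformCube d))
  · have : IsProbabilityMeasure (obsLaw d f) := Measure.isProbabilityMeasure_map hm
    have : IsProbabilityMeasure (jointLaw d n f) := by unfold jointLaw; infer_instance
    unfold typeII
    calc _ ≤ ∫ z, (1 : ℝ) ∂(jointLaw d n f) := by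
          refine integral_mono_of_nonneg (ae_of_all _ fun z => ?_) (integrable_const _)
            (ae_of_all _ fun z => ?_)
          · simpa using (hψ.2 z).2
          · simpa using (hψ.2 z).1
      _ = 1 := by simp
  · have h0 : obsLaw d f = 0 := Measure.map_of_not_aemeasurable hm
    have hfin : IsFiniteMeasure (jointLaw d n f) := by
      unfold jointLaw; rw [h0]; infer_instance
    have hle : (jointLaw d n f).real Set.univ ≤ 1 := by
      unfold jointLaw
      rw [h0, Measure.real, Measure.pi_univ]
      simp only [Measure.coe_zero, Pi.zero_apply, Finset.prod_const]
      by_cases hn : (Finset.univ : Finset (Fin n)).card = 0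
      · simp [hn]
      · rw [zero_pow hn]; simp
    unfold typeII
    calc _ ≤ ∫ z, (1 : ℝ) ∂(jointLaw d n f) := by
          refine integral_mono_of_nonneg (ae_of_all _ fun z => ?_) (integrable_const _)
            (ae_of_all _ fun z => ?_)
          · simpa using (hψ.2 z).2
          · simpa using (hψ.2 z).1
      _ ≤ 1 := by simpa using hle

lemma bayes {d : ℕ} (n : ℕ) {E : Type*} [Fintype E] [Nonempty E] (F : Set ((Fin d → ℝ) → ℝ))
    (f : E → (Fin d → ℝ) → ℝ) (hf : ∀ e, Measurable (f e)) (hF : ∀ e, f e ∈ F)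
    {ψ : (Fin n → ℝ × (Fin d → ℝ)) → ℝ} (hψ : IsTest ψ) {s : ℝ} (hs : 0 < s) :
    ∫ z, min s ((1 / (Fintype.card E : ℝ)) * ∑ e, ∏ i, lik (f e) (z i)) ∂(jointLaw d n 0)
      ≤ s * typeI d n ψ + typeIImax d n F ψ := by
  have hcard : (0 : ℝ) < Fintype.card E := by exact_mod_cast Fintype.card_pos
  have hle : ∀ e, typeII d n (f e) ψ ≤ typeIImax d n F ψ := fun e =>
    le_csSup ⟨1, by rintro _ ⟨g, _, rfl⟩; exact typeII_le_one n g hψ⟩ ⟨f e, hF e, rfl⟩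
  have havg : (1 / (Fintype.card E : ℝ)) * ∑ e, typeII d n (f e) ψ ≤ typeIImax d n F ψ := by
    have := Finset.sum_le_sum fun e (_ : e ∈ Finset.univ) => hle e
    simp only [Finset.sum_const, Finset.card_univ, nsmul_eq_mul] at this
    rw [one_div, inv_mul_le_iff₀ hcard]; exact this
  have hψi : Integrable ψ (jointLaw d n 0) :=
    Integrable.of_bound hψ.1.aestronglyMeasurable 1 (ae_of_all _ fun z => by
      rw [Real.norm_of_nonneg (hψ.2 z).1]; exact (hψ.2 z).2)
  have hli : ∀ e, Integrable (fun z : Fin n → ℝ × (Fin d → ℝ) => (∏ i, lik (f e) (z i)) * (1 - ψ z))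
      (jointLaw d n 0) := fun e => by
    refine (lik_int n (hf e)).mono' ?_ (ae_of_all _ fun z => ?_)
    · exact (lik_int n (hf e)).aestronglyMeasurable.mul
        (measurable_const.sub hψ.1).aestronglyMeasurable
    · have h0 : 0 ≤ ∏ i, lik (f e) (z i) := Finset.prod_nonneg fun i _ => (Real.exp_pos _).le
      have h1 := (hψ.2 z).1
      have h2 := (hψ.2 z).2
      rw [Real.norm_of_nonneg (mul_nonneg h0 (by linarith))]
      nlinarith
  refine le_trans ?_ (add_le_add le_rfl havg)
  simp_rw [typeII_eq n (hf _)]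
  rw [← integral_finsetSum _ fun e _ => hli e, typeI, ← integral_const_mul, ← integral_const_mul,
    ← integral_add (hψi.const_mul s) ((integrable_finsetSum _ fun e _ => hli e).const_mul _)]
  refine integral_mono_of_nonneg (ae_of_all _ fun z => ?_)
    ((hψi.const_mul s).add ((integrable_finsetSum _ fun e _ => hli e).const_mul _))
    (ae_of_all _ fun z => ?_)
  · exact le_min hs.le (mul_nonneg (by positivity) (Finset.sum_nonneg fun e _ =>
      Finset.prod_nonneg fun i _ => (Real.exp_pos _).le))
  · simp only
    rw [← Finset.sum_mul, ← mul_assoc]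
    set L := (1 / (Fintype.card E : ℝ)) * ∑ e, ∏ i, lik (f e) (z i)
    have h1 := (hψ.2 z).1
    have h2 := (hψ.2 z).2
    have h3 := min_le_left s L
    have h4 := min_le_right s L
    nlinarith [mul_le_mul_of_nonneg_right h3 h1, mul_le_mul_of_nonneg_right h4 (sub_nonneg.2 h2)]

variable {S : Type*} [Fintype S] [DecidableEq S]

/-- prior functions -/
noncomputable def prior {d : ℕ} (b : S → ℝ) (ph : S → (Fin d → ℝ) → ℝ) (e : S → Bool)
    (t : Fin d → ℝ) : ℝ := ∑ l, sgb (e l) * (b l * ph l t)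

/-- design matrix -/
noncomputable def Bmat {d n : ℕ} (b : S → ℝ) (ph : S → (Fin d → ℝ) → ℝ) (t : Fin n → Fin d → ℝ) :
    Matrix S (Fin n) ℝ := Matrix.of fun l i => b l * ph l (t i)

lemma min_int_prod {d n : ℕ} (b : S → ℝ) (ph : S → (Fin d → ℝ) → ℝ) (hph : ∀ l, Measurable (ph l))
    {s : ℝ} (hs : 0 < s) : Integrable (fun p : (Fin n → ℝ) × (Fin n → Fin d → ℝ) =>
      min s (Lfun (Bmat b ph p.2) p.1))
      ((gn n).prod (Measure.pi fun _ : Fin n => uniformCube d)) := by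
  have hmeas : Measurable fun p : (Fin n → ℝ) × (Fin n → Fin d → ℝ) =>
      min s (Lfun (Bmat b ph p.2) p.1) := by
    unfold Lfun Bmat
    refine measurable_const.min (measurable_const.mul (Finset.measurable_sum _ fun e _ => ?_))
    refine Real.measurable_exp.comp (Finset.measurable_sum _ fun i _ => ?_)
    have h1 : Measurable fun p : (Fin n → ℝ) × (Fin n → Fin d → ℝ) =>
        ∑ l, sgb (e l) * (b l * ph l (p.2 i)) :=
      Finset.measurable_sum _ fun l _ =>
        (((hph l).comp ((measurable_pi_apply i).comp measurable_snd)).const_mul _).const_mul _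
    exact (h1.mul ((measurable_pi_apply i).comp measurable_fst)).sub ((h1.pow_const 2).div_const 2)
  refine Integrable.of_bound hmeas.aestronglyMeasurable s (ae_of_all _ fun p => ?_)
  rw [Real.norm_of_nonneg (le_min hs.le (Lfun_pos _ _).le)]
  exact min_le_left _ _

lemma bayes_design {d : ℕ} (n : ℕ) (F : Set ((Fin d → ℝ) → ℝ))
    (b : S → ℝ) (ph : S → (Fin d → ℝ) → ℝ) (hph : ∀ l, Measurable (ph l))
    (hF : ∀ e, prior b ph e ∈ F)
    {ψ : (Fin n → ℝ × (Fin d → ℝ)) → ℝ} (hψ : IsTest ψ) {s : ℝ} (hs : 0 < s) :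
    ∫ t, ∫ x, min s (Lfun (Bmat b ph t) x) ∂(gn n)
        ∂(Measure.pi fun _ : Fin n => uniformCube d)
      ≤ s * typeI d n ψ + typeIImax d n F ψ := by
  have hpm : ∀ e, Measurable (prior b ph e) := fun e =>
    Finset.measurable_sum _ fun l _ => ((hph l).const_mul _).const_mul _
  refine le_trans (le_of_eq ?_) (bayes n F (prior b ph) hpm hF hψ hs)
  have hz : ∀ z : Fin n → ℝ × (Fin d → ℝ),
      min s ((1 / (Fintype.card (S → Bool) : ℝ)) * ∑ e, ∏ i, lik (prior b ph e) (z i))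
      = min s (Lfun (Bmat b ph fun i => (z i).2) (fun i => (z i).1)) := by
    intro z
    congr 1
    unfold Lfun
    simp only [Fintype.card_pi, Fintype.card_bool, Finset.prod_const, Finset.card_univ, Nat.cast_pow,
      Nat.cast_ofNat]
    congr 1
    refine Finset.sum_congr rfl fun e _ => ?_
    rw [Real.exp_sum]
    rfl
  simp_rw [hz]
  have hmp := measurePreserving_arrowProdEquivProdArrow ℝ (Fin d → ℝ) (Fin n)
    (fun _ => gaussianReal 0 1) (fun _ => uniformCube d)
  have hj : jointLaw d n 0 = Measure.pi fun _ : Fin n => (gaussianReal 0 1).prod (uniformCube d) := by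
    unfold jointLaw; rw [obsLaw_zero]
  rw [hj]
  have hint := min_int_prod (n := n) b ph hph hs
  have h := hmp.integral_comp' (g := fun p : (Fin n → ℝ) × (Fin n → Fin d → ℝ) =>
      min s (Lfun (Bmat b ph p.2) p.1))
  refine Eq.trans ?_ h.symm
  rw [integral_prod_symm _ hint]

end Part10

section Part11
open MeasureTheory ProbabilityTheory Filter
open scoped BigOperators Topology ENNReal

lemma iid_var {T : Type*} [MeasurableSpace T] (μ : Measure T) [IsProbabilityMeasure μ] (n : ℕ)
    (h : T → ℝ) (hm : Measurable h) (K : ℝ) (hK : ∀ᵐ t ∂μ, |h t| ≤ K) :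
    Integrable (fun t : Fin n → T => (∑ i, h (t i) - n * ∫ t, h t ∂μ) ^ 2) (Measure.pi fun _ => μ) ∧
    ∫ t : Fin n → T, (∑ i, h (t i) - n * ∫ t, h t ∂μ) ^ 2 ∂(Measure.pi fun _ => μ)
      ≤ n * ∫ t, h t ^ 2 ∂μ := by
  have hL : MemLp h 2 μ := MemLp.of_bound hm.aestronglyMeasurable K (by simpa using hK)
  have hmp : ∀ i : Fin n, MeasurePreserving (fun t : Fin n → T => t i) (Measure.pi fun _ => μ) μ :=
    fun i => measurePreserving_eval (fun _ : Fin n => μ) i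
  have hLi : ∀ i : Fin n, MemLp (fun t : Fin n → T => h (t i)) 2 (Measure.pi fun _ => μ) :=
    fun i => hL.comp_measurePreserving (hmp i)
  have hLs : MemLp (fun t : Fin n → T => ∑ i, h (t i)) 2 (Measure.pi fun _ => μ) :=
    memLp_finsetSum _ fun i _ => hLi i
  have hE : ∫ t : Fin n → T, ∑ i, h (t i) ∂(Measure.pi fun _ => μ) = n * ∫ t, h t ∂μ := by
    rw [integral_finsetSum _ fun i _ => (hLi i).integrable (by norm_num)]
    have : ∀ i : Fin n, ∫ t : Fin n → T, h (t i) ∂(Measure.pi fun _ => μ) = ∫ t, h t ∂μ := fun i =>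
      integral_comp_eval (μ := fun _ : Fin n => μ) hm.aestronglyMeasurable
    simp [this]
  have hv : Var[fun t : Fin n → T => ∑ i, h (t i); Measure.pi fun _ => μ] = n * Var[h; μ] := by
    have := variance_sum_pi (μ := fun _ : Fin n => μ) (X := fun _ => h) (fun _ => hL)
    have e : (fun t : Fin n → T => ∑ i, h (t i)) = ∑ i, fun ω : Fin n → T => h (ω i) := by
      ext; simp
    rw [e, this]; simp
  refine ⟨?_, ?_⟩
  · exact (hLs.sub (memLp_const _)).integrable_sq
  · rw [variance_eq_integral hLs.aemeasurable, hE] at hv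
    rw [hv]
    refine mul_le_mul_of_nonneg_left ?_ (Nat.cast_nonneg n)
    exact variance_le_expectation_sq hm.aestronglyMeasurable

variable {S : Type*} [Fintype S] [DecidableEq S]

lemma design_bound {d : ℕ} (n : ℕ) (b : S → ℝ) (ph : S → (Fin d → ℝ) → ℝ)
    (hph : ∀ l, Measurable (ph l))
    (hON : ∀ j l, ∫ t, ph j t * ph l t ∂(uniformCube d) = if j = l then (1 : ℝ) else 0)
    (N q : ℝ) (hb : ∀ l, b l ^ 2 ≤ q) (hN : ∀ᵐ t ∂(uniformCube d), ∑ l, ph l t ^ 2 ≤ N) :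
    Integrable (fun t : Fin n → Fin d → ℝ => fro (Bmat b ph t * (Bmat b ph t).transpose
      - Matrix.diagonal (fun l => n * b l ^ 2))) (Measure.pi fun _ => uniformCube d) ∧
    ∫ t : Fin n → Fin d → ℝ, fro (Bmat b ph t * (Bmat b ph t).transpose
      - Matrix.diagonal (fun l => n * b l ^ 2)) ∂(Measure.pi fun _ => uniformCube d)
      ≤ n * (q * N) ^ 2 := by
  have hbd : ∀ l m, ∀ᵐ t ∂(uniformCube d), |ph l t * ph m t| ≤ N := fun l m => by
    filter_upwards [hN] with t ht
    have h1 : ph l t ^ 2 ≤ N := le_trans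
      (Finset.single_le_sum (f := fun l => ph l t ^ 2) (fun _ _ => sq_nonneg _) (Finset.mem_univ l)) ht
    have h2 : ph m t ^ 2 ≤ N := le_trans
      (Finset.single_le_sum (f := fun l => ph l t ^ 2) (fun _ _ => sq_nonneg _) (Finset.mem_univ m)) ht
    rw [abs_le]
    constructor <;> nlinarith [sq_nonneg (ph l t - ph m t), sq_nonneg (ph l t + ph m t)]
  have key := fun l m => iid_var (uniformCube d) n (fun t => ph l t * ph m t) ((hph l).mul (hph m))
    N (hbd l m)
  have hpt : ∀ t : Fin n → Fin d → ℝ, fro (Bmat b ph t * (Bmat b ph t).transpose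
      - Matrix.diagonal (fun l => n * b l ^ 2)) =
      ∑ l, ∑ m, (b l ^ 2 * b m ^ 2) * (∑ i, ph l (t i) * ph m (t i)
        - n * ∫ t, ph l t * ph m t ∂(uniformCube d)) ^ 2 := by
    intro t
    unfold fro
    refine Finset.sum_congr rfl fun l _ => Finset.sum_congr rfl fun m _ => ?_
    rw [← mul_pow, ← mul_pow]
    congr 1
    rw [hON, Matrix.sub_apply, Matrix.mul_apply, mul_sub, Finset.mul_sum]
    congr 1
    · refine Finset.sum_congr rfl fun i _ => ?_
      simp only [Bmat, Matrix.of_apply, Matrix.transpose_apply]; ring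
    · rw [Matrix.diagonal_apply]
      split_ifs with h
      · subst h; ring
      · simp
  simp_rw [hpt]
  have hi : ∀ l m, Integrable (fun t : Fin n → Fin d → ℝ => (b l ^ 2 * b m ^ 2) *
      (∑ i, ph l (t i) * ph m (t i) - n * ∫ t, ph l t * ph m t ∂(uniformCube d)) ^ 2)
      (Measure.pi fun _ => uniformCube d) := fun l m => (key l m).1.const_mul _
  refine ⟨integrable_finsetSum _ fun l _ => integrable_finsetSum _ fun m _ => hi l m, ?_⟩
  rw [integral_finsetSum _ fun l _ => integrable_finsetSum _ fun m _ => hi l m]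
  simp_rw [fun l => integral_finsetSum Finset.univ fun m _ => hi l m, integral_const_mul]
  have hi2 : ∀ l m, Integrable (fun t => (b l ^ 2 * b m ^ 2) * (ph l t * ph m t) ^ 2) (uniformCube d) := by
    intro l m
    refine Integrable.const_mul (MemLp.integrable_sq
      (MemLp.of_bound ((hph l).mul (hph m)).aestronglyMeasurable N (by simpa using hbd l m))) _
  calc _ ≤ ∑ l, ∑ m, (b l ^ 2 * b m ^ 2) * (n * ∫ t, (ph l t * ph m t) ^ 2 ∂(uniformCube d)) :=
        Finset.sum_le_sum fun l _ => Finset.sum_le_sum fun m _ =>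
          mul_le_mul_of_nonneg_left (key l m).2 (by positivity)
    _ = n * ∫ t, ∑ l, ∑ m, (b l ^ 2 * b m ^ 2) * (ph l t * ph m t) ^ 2 ∂(uniformCube d) := by
        rw [integral_finsetSum _ fun l _ => integrable_finsetSum _ fun m _ => hi2 l m]
        simp_rw [fun l => integral_finsetSum Finset.univ fun m _ => hi2 l m, integral_const_mul,
          Finset.mul_sum]
        refine Finset.sum_congr rfl fun l _ => Finset.sum_congr rfl fun m _ => by ring
    _ ≤ n * ∫ t, (q * N) ^ 2 ∂(uniformCube d) := by
        refine mul_le_mul_of_nonneg_left ?_ (Nat.cast_nonneg n)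
        refine integral_mono_ae (integrable_finsetSum _ fun l _ => integrable_finsetSum _ fun m _ => hi2 l m)
          (integrable_const _) ?_
        filter_upwards [hN] with t ht
        have e : ∑ l, ∑ m, (b l ^ 2 * b m ^ 2) * (ph l t * ph m t) ^ 2
            = (∑ l, b l ^ 2 * ph l t ^ 2) ^ 2 := by
          rw [sq (∑ l, b l ^ 2 * ph l t ^ 2), Finset.sum_mul_sum]
          refine Finset.sum_congr rfl fun l _ => Finset.sum_congr rfl fun m _ => by ring
        rw [e]
        by_cases hS : Nonempty S
        · obtain ⟨l₀⟩ := hS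
          have hq : 0 ≤ q := (sq_nonneg _).trans (hb l₀)
          refine pow_le_pow_left₀ (Finset.sum_nonneg fun l _ => by positivity) ?_ 2
          calc _ ≤ ∑ l, q * ph l t ^ 2 := Finset.sum_le_sum fun l _ =>
                mul_le_mul_of_nonneg_right (hb l) (sq_nonneg _)
            _ = q * ∑ l, ph l t ^ 2 := by rw [Finset.mul_sum]
            _ ≤ q * N := mul_le_mul_of_nonneg_left ht hq
        · rw [not_nonempty_iff] at hS
          simp only [Finset.univ_eq_empty, Finset.sum_empty]
          rw [zero_pow two_ne_zero]; positivity
    _ = n * (q * N) ^ 2 := by simp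

lemma Gfun_le {s : ℝ} (hs : 0 < s) (u : ℝ) : Gfun s u ≤ s := by
  unfold Gfun
  calc _ ≤ ∫ y, s ∂(gaussianReal 0 1) :=
        integral_mono (minExp_int s _ hs u) (integrable_const _) fun y => min_le_left _ _
    _ = s := by simp

lemma design_final {d : ℕ} (n : ℕ) (b : S → ℝ) (ph : S → (Fin d → ℝ) → ℝ)
    (hph : ∀ l, Measurable (ph l))
    (hON : ∀ j l, ∫ t, ph j t * ph l t ∂(uniformCube d) = if j = l then (1 : ℝ) else 0)
    (N q : ℝ) (hb : ∀ l, b l ^ 2 ≤ q) (hN : ∀ᵐ t ∂(uniformCube d), ∑ l, ph l t ^ 2 ≤ N)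
    {s u ε δ : ℝ} (hs : 0 < s) (hε : 0 < ε) (hδ : 0 < δ)
    (hfd : ∀ B : Matrix S (Fin n) ℝ,
      fro (B * B.transpose - Matrix.diagonal (fun l => n * b l ^ 2)) ≤ δ ^ 2 →
      Gfun s u - ε ≤ ∫ x, min s (Lfun B x) ∂(gn n)) :
    Gfun s u - ε - s / δ ^ 2 * (n * (q * N) ^ 2) ≤
    ∫ t, ∫ x, min s (Lfun (Bmat b ph t) x) ∂(gn n)
        ∂(Measure.pi fun _ : Fin n => uniformCube d) := by
  obtain ⟨hi, hle⟩ := design_bound n b ph hph hON N q hb hN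
  have hint := (min_int_prod (n := n) b ph hph hs).integral_prod_right
  calc _ ≤ ∫ t : Fin n → Fin d → ℝ, (Gfun s u - ε) - s / δ ^ 2 *
          fro (Bmat b ph t * (Bmat b ph t).transpose - Matrix.diagonal (fun l => n * b l ^ 2))
          ∂(Measure.pi fun _ : Fin n => uniformCube d) := by
        rw [integral_sub (integrable_const _) (hi.const_mul _), integral_const_mul]
        have := mul_le_mul_of_nonneg_left hle (show 0 ≤ s / δ ^ 2 by positivity)
        simp only [integral_const, probReal_univ, smul_eq_mul, one_mul]
        linarith
    _ ≤ _ := by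
        refine integral_mono ((integrable_const _).sub (hi.const_mul _)) hint fun t => ?_
        simp only
        by_cases h : fro (Bmat b ph t * (Bmat b ph t).transpose
            - Matrix.diagonal (fun l => n * b l ^ 2)) ≤ δ ^ 2
        · refine le_trans ?_ (hfd _ h)
          have := fro_nonneg (Bmat b ph t * (Bmat b ph t).transpose
            - Matrix.diagonal (fun l => n * b l ^ 2))
          have : 0 ≤ s / δ ^ 2 * fro (Bmat b ph t * (Bmat b ph t).transpose
            - Matrix.diagonal (fun l => n * b l ^ 2)) := by positivity
          linarith
        · push Not at h
          have h1 := mul_le_mul_of_nonneg_left h.le (show 0 ≤ s / δ ^ 2 by positivity)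
          rw [div_mul_cancel₀ _ (by positivity)] at h1
          have h2 := Gfun_le hs u
          have h3 : 0 ≤ ∫ x, min s (Lfun (Bmat b ph t) x) ∂(gn n) :=
            integral_nonneg fun x => le_min hs.le (Lfun_pos _ _).le
          linarith

end Part11

section Part12
open MeasureTheory ProbabilityTheory Filter
open scoped BigOperators Topology ENNReal

lemma v_in {ι : Type*} {c : ι → ℝ} (hc : ∀ l, 0 ≤ c l) {T : Finset ι} {C z : ℝ}
    (hT : ∀ l, l ∈ T ↔ c l < C) (hC : 0 < C) {v : ι → ℝ}
    (hv : ∀ l, v l ^ 2 = z ^ 2 * max (1 - (c l / C) ^ 2) 0) {l : ι} (hl : l ∈ T) :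
    v l ^ 2 = z ^ 2 * (1 - (c l / C) ^ 2) := by
  rw [hT] at hl
  have h1 : c l / C ≤ 1 := (div_le_one hC).2 hl.le
  have h0 : 0 ≤ c l / C := div_nonneg (hc l) hC.le
  rw [hv l, max_eq_left (by nlinarith)]

lemma v_out {ι : Type*} {c : ι → ℝ} {T : Finset ι} {C z : ℝ}
    (hT : ∀ l, l ∈ T ↔ c l < C) (hC : 0 < C) {v : ι → ℝ}
    (hv : ∀ l, v l ^ 2 = z ^ 2 * max (1 - (c l / C) ^ 2) 0) {l : ι} (hl : l ∉ T) : v l = 0 := by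
  rw [hT, not_lt] at hl
  have h1 : 1 ≤ c l / C := (one_le_div hC).2 hl
  have h2 := hv l
  rw [max_eq_right (by nlinarith), mul_zero] at h2
  exact pow_eq_zero_iff two_ne_zero |>.1 h2

lemma extremal_eq {ι : Type*} {c : ι → ℝ} (hc : ∀ l, 0 ≤ c l) {T : Finset ι} {C z r : ℝ} {n : ℕ}
    (hT : ∀ l, l ∈ T ↔ c l < C) (hC : 0 < C) {v : ι → ℝ}
    (hv : ∀ l, v l ^ 2 = z ^ 2 * max (1 - (c l / C) ^ 2) 0)
    (h1 : ∑ l ∈ T, v l ^ 2 = n * r ^ 2) (h2 : ∑ l ∈ T, c l ^ 2 * v l ^ 2 = n) :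
    extremalVal c n r 1 1 = 1 / 2 * ∑ l ∈ T, v l ^ 4 := by
  have hA : ∑ l ∈ T, v l ^ 4 = z ^ 2 * (n * r ^ 2 - n / C ^ 2) := by
    have : ∀ l ∈ T, v l ^ 4 = z ^ 2 * v l ^ 2 - z ^ 2 / C ^ 2 * (c l ^ 2 * v l ^ 2) := fun l hl => by
      have e : v l ^ 4 = v l ^ 2 * v l ^ 2 := by ring
      rw [e]
      nth_rewrite 1 [v_in hc hT hC hv hl]
      field_simp
    rw [Finset.sum_congr rfl this, Finset.sum_sub_distrib, ← Finset.mul_sum, ← Finset.mul_sum, h1, h2]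
    ring
  have hvo : ∀ l, l ∉ T → v l = 0 := fun l hl => v_out hT hC hv hl
  unfold extremalVal
  refine le_antisymm (csInf_le ⟨0, ?_⟩ ?_) (le_csInf ?_ ?_)
  · rintro x ⟨w, -, -, -, -, -, rfl⟩
    exact mul_nonneg (by norm_num) (tsum_nonneg fun l => by positivity)
  · refine ⟨v, ?_, ?_, ?_, ?_, ?_, ?_⟩
    · exact summable_of_ne_finset_zero (s := T) fun l hl => by simp [hvo l hl]
    · exact summable_of_ne_finset_zero (s := T) fun l hl => by simp [hvo l hl]
    · exact summable_of_ne_finset_zero (s := T) fun l hl => by simp [hvo l hl]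
    · rw [tsum_eq_sum (s := T) fun l hl => by simp [hvo l hl], h1]; simp
    · rw [tsum_eq_sum (s := T) fun l hl => by simp [hvo l hl], h2]; simp
    · rw [tsum_eq_sum (s := T) fun l hl => by simp [hvo l hl]]
  · refine ⟨_, v, ?_, ?_, ?_, ?_, ?_, rfl⟩
    · exact summable_of_ne_finset_zero (s := T) fun l hl => by simp [hvo l hl]
    · exact summable_of_ne_finset_zero (s := T) fun l hl => by simp [hvo l hl]
    · exact summable_of_ne_finset_zero (s := T) fun l hl => by simp [hvo l hl]
    · rw [tsum_eq_sum (s := T) fun l hl => by simp [hvo l hl], h1]; simp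
    · rw [tsum_eq_sum (s := T) fun l hl => by simp [hvo l hl], h2]; simp
  · rintro x ⟨w, s1, s2, s3, g1, g2, rfl⟩
    refine mul_le_mul_of_nonneg_left ?_ (by norm_num)
    have k1 : ∑ l ∈ T, w l ^ 4 ≤ ∑' l, w l ^ 4 := s3.sum_le_tsum T fun l _ => by positivity
    have hsum : Summable fun l => w l ^ 2 - 1 / C ^ 2 * (c l ^ 2 * w l ^ 2) := s1.sub (s2.mul_left _)
    have k2 : ∑' l, (w l ^ 2 - 1 / C ^ 2 * (c l ^ 2 * w l ^ 2))
        ≤ ∑ l ∈ T, (w l ^ 2 - 1 / C ^ 2 * (c l ^ 2 * w l ^ 2)) := by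
      rw [← hsum.sum_add_tsum_compl (s := T)]
      have : ∑' x : ↑(↑T : Set ι)ᶜ, (w x ^ 2 - 1 / C ^ 2 * (c x ^ 2 * w x ^ 2)) ≤ 0 := by
        refine tsum_nonpos fun l => ?_
        have hl := l.2
        simp only [Set.mem_compl_iff, Finset.mem_coe, hT, not_lt] at hl
        have : 1 ≤ 1 / C ^ 2 * c l ^ 2 := by
          rw [one_div, ← div_eq_inv_mul, one_le_div (by positivity)]
          exact pow_le_pow_left₀ hC.le hl 2
        nlinarith [mul_le_mul_of_nonneg_right this (sq_nonneg (w l))]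
      linarith
    rw [s1.tsum_sub (s2.mul_left _), tsum_mul_left] at k2
    have k3 : z ^ 2 * (n * r ^ 2 - n / C ^ 2) ≤ ∑ l ∈ T, v l ^ 2 * w l ^ 2 := by
      have e : ∑ l ∈ T, v l ^ 2 * w l ^ 2
          = z ^ 2 * ∑ l ∈ T, (w l ^ 2 - 1 / C ^ 2 * (c l ^ 2 * w l ^ 2)) := by
        rw [Finset.mul_sum]
        refine Finset.sum_congr rfl fun l hl => ?_
        rw [v_in hc hT hC hv hl]; field_simp
      rw [e]
      refine mul_le_mul_of_nonneg_left (le_trans ?_ k2) (sq_nonneg z)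
      have : 1 / C ^ 2 * ∑' l, c l ^ 2 * w l ^ 2 ≤ 1 / C ^ 2 * n :=
        mul_le_mul_of_nonneg_left (by simpa using g2) (by positivity)
      have e2 : (n : ℝ) / C ^ 2 = 1 / C ^ 2 * n := by ring
      rw [one_mul] at g1
      linarith
    have k4 : 0 ≤ ∑ l ∈ T, (v l ^ 2 - w l ^ 2) ^ 2 := Finset.sum_nonneg fun l _ => sq_nonneg _
    have e4 : ∑ l ∈ T, (v l ^ 2 - w l ^ 2) ^ 2 =
        ∑ l ∈ T, v l ^ 4 - 2 * ∑ l ∈ T, v l ^ 2 * w l ^ 2 + ∑ l ∈ T, w l ^ 4 := by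
      rw [Finset.mul_sum, ← Finset.sum_sub_distrib, ← Finset.sum_add_distrib]
      refine Finset.sum_congr rfl fun l _ => by ring
    linarith

lemma prior_mem {d : ℕ} {ι : Type*} [DecidableEq ι]
    {φ : ι → (Fin d → ℝ) → ℝ} (hφmeas : ∀ l, Measurable (φ l))
    (hON : OrthonormalSystem d φ) {c : ι → ℝ} {T : Finset ι} {r : ℝ} (hr : 0 < r) {n : ℕ} (hn : 0 < n)
    {v : ι → ℝ} (K : ℝ) (hbd : ∀ l ∈ T, ∀ᵐ t ∂(uniformCube d), |φ l t| ≤ K)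
    (h1 : ∑ l ∈ T, v l ^ 2 = n * r ^ 2) (h2 : ∑ l ∈ T, c l ^ 2 * v l ^ 2 = n) (e : T → Bool) :
    prior (fun l : T => v l / Real.sqrt n) (fun l : T => φ l) e ∈ altSet φ c r := by
  have hn' : (0 : ℝ) < n := by exact_mod_cast hn
  have hs : Real.sqrt n ^ 2 = n := Real.sq_sqrt hn'.le
  refine ⟨⟨fun l => if h : l ∈ T then sgb (e ⟨l, h⟩) * (v l / Real.sqrt n) else 0, ?_, ?_, ?_⟩, ?_⟩
  · intro t
    rw [tsum_eq_sum (s := T) fun l hl => by simp [hl], prior, ← Finset.sum_coe_sort T]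
    refine Finset.sum_congr rfl fun l _ => ?_
    simp [mul_assoc]
  · exact summable_of_ne_finset_zero (s := T) fun l hl => by simp [hl]
  · rw [tsum_eq_sum (s := T) fun l hl => by simp [hl]]
    have : ∀ l ∈ T, c l ^ 2 * (if h : l ∈ T then sgb (e ⟨l, h⟩) * (v l / Real.sqrt n) else 0) ^ 2
        = (c l ^ 2 * v l ^ 2) / n := fun l hl => by
      rw [dif_pos hl, mul_pow, div_pow, hs, sq (sgb _), sgb_sq]; ring
    rw [Finset.sum_congr rfl this, ← Finset.sum_div, h2, div_self hn'.ne']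
  · have hint : ∀ j l : T, Integrable (fun t => φ j t * φ l t) (uniformCube d) := fun j l => by
      refine Integrable.of_bound ((hφmeas j).mul (hφmeas l)).aestronglyMeasurable (K * K) ?_
      filter_upwards [hbd j j.2, hbd l l.2] with t a1 a2
      rw [Real.norm_eq_abs, abs_mul]
      exact mul_le_mul a1 a2 (abs_nonneg _) ((abs_nonneg _).trans a1)
    set a : T → ℝ := fun l => sgb (e l) * (v l / Real.sqrt n) with ha
    have hI : ∫ t, (prior (fun l : T => v l / Real.sqrt n) (fun l : T => φ l) e t) ^ 2 ∂(uniformCube d)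
        = r ^ 2 := by
      have hpt : ∀ t, (prior (fun l : T => v l / Real.sqrt n) (fun l : T => φ l) e t) ^ 2
          = ∑ j : T, ∑ l : T, (a j * a l) * (φ j t * φ l t) := by
        intro t
        rw [prior, sq, Finset.sum_mul_sum]
        refine Finset.sum_congr rfl fun l _ => Finset.sum_congr rfl fun m _ => by rw [ha]; ring
      simp_rw [hpt]
      rw [integral_finsetSum _ fun j _ => integrable_finsetSum _ fun l _ => (hint j l).const_mul _]
      simp_rw [fun j : T => integral_finsetSum Finset.univ fun (l : T) _ => (hint j l).const_mul (a j * a l),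
        integral_const_mul, show ∀ j l, ∫ t, φ j t * φ l t ∂(uniformCube d) = if j = l then (1 : ℝ) else 0 from hON]
      have : ∀ j : T, ∑ l : T, a j * a l * (if (j : ι) = l then (1 : ℝ) else 0) = v j ^ 2 / n := by
        intro j
        rw [Finset.sum_eq_single j]
        · rw [if_pos rfl, ha]
          calc _ = (sgb (e j) * sgb (e j)) * (v j / Real.sqrt n) ^ 2 := by ring
            _ = _ := by rw [sgb_sq, div_pow, hs, one_mul]
        · intro l _ hl
          rw [if_neg (fun h => hl (Subtype.ext h.symm)), mul_zero]
        · simp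
      simp_rw [this]
      rw [← Finset.sum_div, Finset.sum_coe_sort T (fun l => v l ^ 2), h1]
      field_simp
    rw [L2norm, hI, ← Real.sqrt_eq_rpow, Real.sqrt_sq hr.le]

end Part12

section Part13
open MeasureTheory ProbabilityTheory Filter
open scoped BigOperators Topology ENNReal

lemma finish_lemma (u β : ℕ → ℝ) (g : ℝ → ℝ) (hg : Continuous g) (hg0 : Tendsto g atTop (𝓝 0))
    (hβ : ∀ n, 0 ≤ β n) (hu : ∀ n, 0 ≤ u n)
    (hloc : ∀ u₀ : ℝ, 0 ≤ u₀ → ∀ ε > 0, ∃ η > 0, ∀ᶠ n in atTop, |u n - u₀| ≤ η → g u₀ - ε ≤ β n) :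
    ∃ ε : ℕ → ℝ, Tendsto ε atTop (𝓝 0) ∧ ∀ n, g (u n) + ε n ≤ β n := by
  refine ⟨fun n => min 0 (β n - g (u n)), ?_, fun n => by
    have := min_le_right 0 (β n - g (u n)); linarith⟩
  have key : ∀ ε > 0, ∀ᶠ n in atTop, g (u n) - ε ≤ β n := by
    intro ε hε
    obtain ⟨M, hM⟩ := eventually_atTop.1 (hg0.eventually (gt_mem_nhds hε))
    have hcomp : ∀ᶠ n in atTop, u n ∈ Set.Icc 0 M → g (u n) - ε ≤ β n := by
      refine isCompact_Icc.induction_on (p := fun s => ∀ᶠ n in atTop, u n ∈ s → g (u n) - ε ≤ β n)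
        (by simp) (fun s t hst ht => ht.mono fun n h hs => h (hst hs))
        (fun s t hs ht => by
          filter_upwards [hs, ht] with n h1 h2 h
          exact h.elim h1 h2) ?_
      intro u₀ hu₀
      obtain ⟨η, hη, hev⟩ := hloc u₀ hu₀.1 (ε / 2) (by linarith)
      have hgc := Metric.continuousAt_iff.1 (hg.continuousAt (x := u₀)) (ε / 2) (by linarith)
      obtain ⟨δ, hδ, hgc⟩ := hgc
      refine ⟨Metric.ball u₀ (min η δ), mem_nhdsWithin_of_mem_nhds
        (Metric.ball_mem_nhds _ (lt_min hη hδ)), ?_⟩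
      filter_upwards [hev] with n h hn
      have hd : dist (u n) u₀ < min η δ := hn
      have h1 := h (by rw [← Real.dist_eq]; exact (hd.trans_le (min_le_left _ _)).le)
      have h2 := hgc (hd.trans_le (min_le_right _ _))
      rw [Real.dist_eq, abs_lt] at h2
      linarith [h2.2]
    filter_upwards [hcomp] with n h
    by_cases hn : u n ≤ M
    · exact h ⟨hu n, hn⟩
    · have := hM (u n) (not_le.1 hn).le
      linarith [hβ n]
  rw [Metric.tendsto_nhds]
  intro ε hε
  filter_upwards [key (ε / 2) (by linarith)] with n hn
  rw [Real.dist_eq, sub_zero, abs_of_nonpos (min_le_left _ _)]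
  have : -(ε / 2) ≤ min 0 (β n - g (u n)) := le_min (by linarith) (by linarith)
  linarith

lemma typeIImax_nonneg {d n : ℕ} (F : Set ((Fin d → ℝ) → ℝ))
    {ψ : (Fin n → ℝ × (Fin d → ℝ)) → ℝ} (hψ : IsTest ψ) : 0 ≤ typeIImax d n F ψ := by
  refine Real.sSup_nonneg ?_
  rintro _ ⟨f, _, rfl⟩
  exact integral_nonneg fun z => by simpa using (hψ.2 z).2

lemma typeI_nonneg {d n : ℕ} {ψ : (Fin n → ℝ × (Fin d → ℝ)) → ℝ} (hψ : IsTest ψ) :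
    0 ≤ typeI d n ψ := integral_nonneg fun z => (hψ.2 z).1

lemma zero_isTest {d n : ℕ} : IsTest (fun _ : Fin n → ℝ × (Fin d → ℝ) => (0 : ℝ)) :=
  ⟨measurable_const, fun _ => ⟨le_rfl, zero_le_one⟩⟩

lemma le_minimaxTypeII {d n : ℕ} {F : Set ((Fin d → ℝ) → ℝ)} {α x : ℝ} (hα : 0 < α)
    (h : ∀ ψ : (Fin n → ℝ × (Fin d → ℝ)) → ℝ, IsTest ψ → typeI d n ψ ≤ α → x ≤ typeIImax d n F ψ) :
    x ≤ minimaxTypeII d n F α := by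
  refine le_csInf ⟨_, fun _ => 0, zero_isTest, by simp [typeI, hα.le], rfl⟩ ?_
  rintro _ ⟨ψ, h1, h2, rfl⟩
  exact h ψ h1 h2

lemma le_minimaxTotal {d n : ℕ} {F : Set ((Fin d → ℝ) → ℝ)} {x : ℝ}
    (h : ∀ ψ : (Fin n → ℝ × (Fin d → ℝ)) → ℝ, IsTest ψ → x ≤ typeI d n ψ + typeIImax d n F ψ) :
    x ≤ minimaxTotal d n F := by
  refine le_csInf ⟨_, fun _ => 0, zero_isTest, rfl⟩ ?_
  rintro _ ⟨ψ, h1, rfl⟩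
  exact h ψ h1

/-- number of active coefficients tends to infinity -/
lemma N_tendsto {ι : Type*} {c : ι → ℝ} (hc : ∀ l, 0 ≤ c l)
    (hA1 : ∀ C : ℝ, 0 < C → {l | c l < C}.Finite)
    {r : ℕ → ℝ} (hr : Tendsto r atTop (𝓝 0)) {C : ℕ → ℝ} (hCpos : ∀ n, 0 < C n)
    {v : ℕ → ι → ℝ} (T : ℕ → Finset ι) (hT : ∀ n l, l ∈ T n ↔ c l < C n)
    (h1 : ∀ n : ℕ, ∑ l ∈ T n, (v n l) ^ 2 = (n : ℝ) * (r n) ^ 2)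
    (h2 : ∀ n : ℕ, ∑ l ∈ T n, (c l) ^ 2 * (v n l) ^ 2 = (n : ℝ)) (M : ℕ) :
    ∀ᶠ n in atTop, M ≤ Ncard c (C n) := by
  have hr2 : Tendsto (fun n => r n ^ 2) atTop (𝓝 0) := by simpa using hr.pow 2
  have hbd : ∀ K : ℝ, ∀ᶠ n in atTop, (∀ l ∈ T n, c l ≤ K) → False := by
    intro K
    have hev : ∀ᶠ n in atTop, K ^ 2 * r n ^ 2 < 1 := by
      have := (hr2.const_mul (K ^ 2)); rw [mul_zero] at this
      exact this.eventually (gt_mem_nhds one_pos)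
    filter_upwards [hev, eventually_gt_atTop 0] with n hn hn0 hall
    have hn' : (0 : ℝ) < n := by exact_mod_cast hn0
    have : (n : ℝ) ≤ K ^ 2 * (n * r n ^ 2) := by
      rw [← h1, Finset.mul_sum]
      calc (n : ℝ) = _ := (h2 n).symm
        _ ≤ _ := Finset.sum_le_sum fun l hl =>
          mul_le_mul_of_nonneg_right (pow_le_pow_left₀ (hc l) (hall l hl) 2) (sq_nonneg _)
    nlinarith
  have hinf : Infinite ι := by
    by_contra hfin
    rw [not_infinite_iff_finite] at hfin
    obtain ⟨K, hK⟩ := (Set.finite_range c).bddAbove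
    obtain ⟨n, hn⟩ := (hbd K).exists
    exact hn fun l _ => hK ⟨l, rfl⟩
  obtain ⟨A, hA⟩ := Infinite.exists_subset_card_eq ι M
  obtain ⟨K, hK⟩ := (A.image c).bddAbove
  filter_upwards [hbd K] with n hn
  have : ∃ l ∈ T n, K < c l := by
    by_contra hcon; push Not at hcon; exact hn hcon
  obtain ⟨l, hl, hKl⟩ := this
  rw [hT] at hl
  rw [← hA, ← Set.ncard_coe_finset]
  refine Set.ncard_le_ncard (fun a ha => ?_) (hA1 _ (hCpos n))
  have : c a ≤ K := hK (by simpa using ⟨a, ha, rfl⟩)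
  exact lt_of_le_of_lt this (hKl.trans hl)

end Part13

section Part14
open MeasureTheory ProbabilityTheory Filter
open scoped BigOperators Topology

lemma core {d : ℕ} {ι : Type*} [DecidableEq ι]
    (φ : ι → (Fin d → ℝ) → ℝ) (hφmeas : ∀ l, Measurable (φ l))
    (hON : OrthonormalSystem d φ)
    (c : ι → ℝ) (hc : ∀ l, 0 ≤ c l)
    (hA1 : ∀ C : ℝ, 0 < C → {l | c l < C}.Finite)
    (hA2 : AssumptionA2 d φ c)
    (r : ℕ → ℝ) (hrpos : ∀ n, 0 < r n) (hr : Tendsto r atTop (𝓝 0))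
    (z₀ C : ℕ → ℝ) (hCpos : ∀ n, 0 < C n)
    (v : ℕ → ι → ℝ)
    (hvval : ∀ n l, (v n l) ^ 2 = (z₀ n) ^ 2 * max (1 - (c l / C n) ^ 2) 0)
    (hvcon1 : ∀ n, ∑' l, (v n l) ^ 2 = (n : ℝ) * (r n) ^ 2)
    (hvcon2 : ∀ n, ∑' l, (c l) ^ 2 * (v n l) ^ 2 = (n : ℝ))
    (u : ℕ → ℝ) (hupos : ∀ n, 0 ≤ u n)
    (hu : ∀ n, (u n) ^ 2 = extremalVal c n (r n) 1 1)
    (hB1 : Tendsto (fun n => (Ncard c (C n) : ℝ) / n) atTop (𝓝 0))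
    (hB2 : ∀ B : ℝ, 0 < B →
      Asymp (fun n => (Ncard c (B * C n) : ℝ)) (fun n => (Ncard c (C n) : ℝ)))
    (u₀ : ℝ) (hu₀ : 0 ≤ u₀) (s : ℝ) (hs : 0 < s) (ε : ℝ) (hε : 0 < ε) :
    ∃ η > 0, ∀ᶠ n in atTop, |u n - u₀| ≤ η →
      ∀ ψ : (Fin n → ℝ × (Fin d → ℝ)) → ℝ, IsTest ψ →
        Gfun s u₀ - ε ≤ s * typeI d n ψ + typeIImax d n (altSet φ c (r n)) ψ := by
  obtain ⟨δ, hδ, hfd⟩ := fd_lemma u₀ s (ε / 2) hs (by linarith)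
  set T : ℕ → Finset ι := fun n => (hA1 (C n) (hCpos n)).toFinset with hTdef
  have hT : ∀ n l, l ∈ T n ↔ c l < C n := fun n l => by simp [hTdef]
  have hcard : ∀ n, Ncard c (C n) = (T n).card := fun n => by
    rw [Ncard, Set.ncard_eq_toFinset_card _ (hA1 (C n) (hCpos n))]
  have hvo : ∀ n l, l ∉ T n → v n l = 0 := fun n l hl => v_out (hT n) (hCpos n) (hvval n) hl
  have h1 : ∀ n : ℕ, ∑ l ∈ T n, (v n l) ^ 2 = (n : ℝ) * (r n) ^ 2 := fun n => by
    rw [← hvcon1, tsum_eq_sum (s := T n) fun l hl => by simp [hvo n l hl]]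
  have h2 : ∀ n : ℕ, ∑ l ∈ T n, (c l) ^ 2 * (v n l) ^ 2 = (n : ℝ) := fun n => by
    conv_rhs => rw [← hvcon2]
    rw [tsum_eq_sum (s := T n) fun l hl => by simp [hvo n l hl]]
  have h4 : ∀ n : ℕ, ∑ l ∈ T n, (v n l) ^ 4 = 2 * u n ^ 2 := fun n => by
    rw [hu, extremal_eq hc (hT n) (hCpos n) (hvval n) (h1 n) (h2 n)]; ring
  have hz : ∀ n l, v n l ^ 2 ≤ z₀ n ^ 2 := fun n l => by
    rw [hvval]
    have : max (1 - (c l / C n) ^ 2) 0 ≤ 1 := max_le (by nlinarith [sq_nonneg (c l / C n)]) zero_le_one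
    nlinarith [mul_le_mul_of_nonneg_left this (sq_nonneg (z₀ n))]
  obtain ⟨c₁, c₂, hc₁, hc₂, hB⟩ := hB2 (1 / 2) (by norm_num)
  -- lower bound for the fourth moment sum
  have hlow : ∀ n, 9 / 16 * (z₀ n ^ 4 * (Ncard c (1 / 2 * C n) : ℝ)) ≤ 2 * u n ^ 2 := by
    intro n
    rw [← h4]
    have hC2 : 0 < 1 / 2 * C n := by have := hCpos n; positivity
    set T2 := (hA1 _ hC2).toFinset with hT2
    have hsub : T2 ⊆ T n := fun l hl => by
      rw [hT2, Set.Finite.mem_toFinset, Set.mem_ofPred_eq] at hl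
      rw [hT]; have := hCpos n; linarith
    have hcd : Ncard c (1 / 2 * C n) = T2.card := by
      rw [Ncard, Set.ncard_eq_toFinset_card _ (hA1 _ hC2)]
    rw [hcd]
    calc _ = ∑ l ∈ T2, 9 / 16 * z₀ n ^ 4 := by simp; ring
      _ ≤ ∑ l ∈ T2, v n l ^ 4 := Finset.sum_le_sum fun l hl => by
          have e : v n l ^ 4 = (v n l ^ 2) ^ 2 := by ring
          rw [e, v_in hc (hT n) (hCpos n) (hvval n) (hsub hl)]
          rw [hT2, Set.Finite.mem_toFinset, Set.mem_ofPred_eq] at hl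
          have a1 : c l / C n ≤ 1 / 2 := by rw [div_le_iff₀ (hCpos n)]; exact hl.le
          have a0 : 0 ≤ c l / C n := div_nonneg (hc l) (hCpos n).le
          have a2 : 3 / 4 ≤ 1 - (c l / C n) ^ 2 := by nlinarith
          calc 9 / 16 * z₀ n ^ 4 = (z₀ n ^ 2 * (3 / 4)) ^ 2 := by ring
            _ ≤ _ := pow_le_pow_left₀ (by positivity) (mul_le_mul_of_nonneg_left a2 (sq_nonneg _)) 2
      _ ≤ ∑ l ∈ T n, v n l ^ 4 := Finset.sum_le_sum_of_subset_of_nonneg hsub fun l _ _ => by positivity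
  set M := u₀ + 1 with hM
  set K : ℝ := 2 * M ^ 2 * (16 / 9) / c₁ with hK
  have hMpos : 0 < M := by linarith
  have hKpos : 0 < K := by positivity
  have hNinf := N_tendsto hc hA1 hr hCpos T hT h1 h2 (⌈K / δ ^ 2⌉₊ + 1)
  have hsmall : ∀ᶠ n : ℕ in atTop, s / δ ^ 2 * (K * ((Ncard c (C n) : ℝ) / n)) < ε / 2 := by
    have := (hB1.const_mul K).const_mul (s / δ ^ 2)
    rw [mul_zero, mul_zero] at this
    exact this.eventually (gt_mem_nhds (by linarith))
  refine ⟨min 1 (δ / (2 * (2 * u₀ + 1))), lt_min one_pos (by positivity), ?_⟩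
  filter_upwards [hB, hNinf, hsmall, eventually_gt_atTop 0] with n hBn hNn hsn hn0 hun ψ hψ
  have hn' : (0 : ℝ) < n := by exact_mod_cast hn0
  have hsq : Real.sqrt n ^ 2 = n := Real.sq_sqrt hn'.le
  set N : ℝ := (Ncard c (C n) : ℝ) with hNdef
  have hun1 := (abs_le.1 (hun.trans (min_le_left _ _))).2
  have hunM : u n ≤ M := by linarith
  have hNpos : 0 < N := by
    rw [hNdef]; exact_mod_cast lt_of_lt_of_le (Nat.succ_pos _) hNn
  have hNK : K / δ ^ 2 ≤ N := by
    refine (Nat.le_ceil _).trans ?_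
    rw [hNdef]; exact_mod_cast (Nat.le_succ _).trans hNn
  have hzN : z₀ n ^ 4 * N ≤ K := by
    rw [hK, le_div_iff₀ hc₁]
    have b1 := hlow n
    have b2 := mul_le_mul_of_nonneg_left hBn.1 (show 0 ≤ z₀ n ^ 4 by positivity)
    have b3 : u n ^ 2 ≤ M ^ 2 := pow_le_pow_left₀ (hupos n) hunM 2
    nlinarith
  have hz4 : z₀ n ^ 4 ≤ δ ^ 2 := by
    rw [div_le_iff₀ (by positivity)] at hNK
    by_contra hcon
    push Not at hcon
    nlinarith [mul_lt_mul_of_pos_right hcon hNpos]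
  have hz2 : z₀ n ^ 2 ≤ δ := by
    refine le_of_sq_le_sq ?_ hδ.le
    calc (z₀ n ^ 2) ^ 2 = z₀ n ^ 4 := by ring
      _ ≤ _ := hz4
  -- design functions
  have hN : ∀ᵐ t ∂(uniformCube d), ∑ l : T n, φ l t ^ 2 ≤ N := by
    unfold uniformCube
    filter_upwards [ae_restrict_mem measurableSet_Icc] with t ht
    have := hA2 (C n) (hCpos n) t ht
    rw [hNdef, ← this]
    rw [Finset.sum_coe_sort (T n) (fun l => φ l t ^ 2), ← Finset.tsum_subtype]
    refine le_of_eq ?_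
    have hset : {x | x ∈ T n} = {l | c l < C n} := by ext l; exact hT n l
    exact tsum_congr_set_coe (fun l => φ l t ^ 2) hset
  have hb1 : ∀ l ∈ T n, ∀ᵐ t ∂(uniformCube d), |φ l t| ≤ Real.sqrt N := fun l hl => by
    filter_upwards [hN] with t ht
    refine Real.abs_le_sqrt (le_trans ?_ ht)
    exact Finset.single_le_sum (f := fun l : T n => φ l t ^ 2) (fun _ _ => sq_nonneg _)
      (Finset.mem_univ (⟨l, hl⟩ : T n))
  have hmem := prior_mem hφmeas hON (hrpos n) hn0 (Real.sqrt N) hb1 (h1 n) (h2 n)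
  have hbayes := bayes_design n (altSet φ c (r n)) (fun l : T n => v n l / Real.sqrt n)
    (fun l : T n => φ l) (fun l => hφmeas l) hmem hψ hs
  have hd : ∀ l : T n, n * (v n l / Real.sqrt n) ^ 2 = v n l ^ 2 := fun l => by
    rw [div_pow, hsq]; field_simp
  have hfinal := design_final n (fun l : T n => v n l / Real.sqrt n)
    (fun l : T n => φ l) (fun l => hφmeas l)
    (fun j l => by
      have := hON j l
      rw [this]; exact if_congr Subtype.ext_iff.symm rfl rfl) N (z₀ n ^ 2 / n)
    (fun l => by rw [div_pow, hsq]; exact div_le_div_of_nonneg_right (hz n l) hn'.le) hN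
    (u := u₀) hs (half_pos hε) hδ (fun B hBf => by
      refine hfd (T n) n B _ (fun l => ?_) (fun l => ?_) ?_ hBf
      · rw [hd]; positivity
      · rw [hd]; exact (hz n l).trans hz2
      · simp_rw [hd]
        have : ∑ l : T n, (v n l ^ 2) ^ 2 = 2 * u n ^ 2 := by
          rw [← h4, ← Finset.sum_coe_sort (T n)]
          exact Finset.sum_congr rfl fun l _ => by ring
        rw [this]
        have e : 2 * u n ^ 2 - 2 * u₀ ^ 2 = 2 * ((u n - u₀) * (u n + u₀)) := by ring
        rw [e, abs_mul, abs_mul, abs_of_nonneg (show 0 ≤ u n + u₀ by linarith [hupos n]), abs_two]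
        have g1 := hun.trans (min_le_right _ _)
        have g2 : u n + u₀ ≤ 2 * u₀ + 1 := by linarith
        calc 2 * (|u n - u₀| * (u n + u₀)) ≤ 2 * (δ / (2 * (2 * u₀ + 1)) * (2 * u₀ + 1)) := by
              refine mul_le_mul_of_nonneg_left (mul_le_mul g1 g2 (by linarith [hupos n]) (by positivity))
                (by norm_num)
          _ = δ := by field_simp)
  have hrem : (n : ℝ) * (z₀ n ^ 2 / n * N) ^ 2 ≤ K * (N / n) := by
    have e : (n : ℝ) * (z₀ n ^ 2 / n * N) ^ 2 = (z₀ n ^ 4 * N) * (N / n) := by field_simp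
    rw [e]
    exact mul_le_mul_of_nonneg_right hzN (by positivity)
  have hrem2 := mul_le_mul_of_nonneg_left hrem (show 0 ≤ s / δ ^ 2 by positivity)
  linarith

end Part14

/- STATEMENT 4 (Theorem 2, part (1), sharp lower bounds): let r_n → 0, assume
(A1), (A2), (B1), (B2) and (C1).  Then β(𝓕,r_n,α) ≥ Φ(H^{(α)} − u_n) + o(1)
for every α ∈ (0,1) and γ(𝓕,r_n) ≥ 2Φ(−u_n/2) + o(1), where u_n is the value
of the extremal problem u_n² = inf{½Σv⁴ : Σv² ≥ n r_n², Σc²v² ≤ n}. -/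
theorem stmt4 {d : ℕ} {ι : Type*} [Countable ι] [DecidableEq ι]
    (φ : ι → (Fin d → ℝ) → ℝ) (hφmeas : ∀ l, Measurable (φ l))
    (hON : OrthonormalSystem d φ)
    (c : ι → ℝ) (hc : ∀ l, 0 ≤ c l)
    (hA1 : ∀ C : ℝ, 0 < C → {l | c l < C}.Finite)
    (hA2 : AssumptionA2 d φ c)
    (r : ℕ → ℝ) (hrpos : ∀ n, 0 < r n) (hr : Tendsto r atTop (𝓝 0))
    -- the solution of the extremal problem (b = B = 1), which determines
    -- C = C_n and N = N(C_n) via the Lagrange multiplier equations: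
    (z₀ C : ℕ → ℝ) (hz₀ : ∀ n, 0 < z₀ n) (hCpos : ∀ n, 0 < C n)
    (v : ℕ → ι → ℝ)
    (hvval : ∀ n l, (v n l) ^ 2 = (z₀ n) ^ 2 * max (1 - (c l / C n) ^ 2) 0)
    (hvcon1 : ∀ n, ∑' l, (v n l) ^ 2 = (n : ℝ) * (r n) ^ 2)
    (hvcon2 : ∀ n, ∑' l, (c l) ^ 2 * (v n l) ^ 2 = (n : ℝ))
    -- u_n is the value of the extremal problem:
    (u : ℕ → ℝ) (hupos : ∀ n, 0 ≤ u n)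
    (hu : ∀ n, (u n) ^ 2 = extremalVal c n (r n) 1 1)
    -- (B1), (B2) for N = N(C_n):
    (hB1 : Tendsto (fun n => (Ncard c (C n) : ℝ) / n) atTop (𝓝 0))
    (hB2 : ∀ B : ℝ, 0 < B →
      Asymp (fun n => (Ncard c (B * C n) : ℝ)) (fun n => (Ncard c (C n) : ℝ)))
    -- (C1): u_n(B) ≍ u_n for every B = B_n ≍ 1:
    (hC1 : ∀ B : ℕ → ℝ, Asymp B (fun _ => 1) →
      Asymp (fun n => Real.sqrt (extremalVal c n (r n) 1 (B n))) u) :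
    (∀ α ∈ Set.Ioo (0 : ℝ) 1, ∀ Hα : ℝ, stdGaussCDF Hα = 1 - α →
      ∃ ε : ℕ → ℝ, Tendsto ε atTop (𝓝 0) ∧
        ∀ n, stdGaussCDF (Hα - u n) + ε n ≤
          minimaxTypeII d n (altSet φ c (r n)) α) ∧
    (∃ ε : ℕ → ℝ, Tendsto ε atTop (𝓝 0) ∧
      ∀ n, 2 * stdGaussCDF (-(u n) / 2) + ε n ≤
        minimaxTotal d n (altSet φ c (r n))) := by
  have hcore := core φ hφmeas hON c hc hA1 hA2 r hrpos hr z₀ C hCpos v hvval hvcon1 hvcon2 u hupos hu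
    hB1 hB2
  refine ⟨?_, ?_⟩
  · intro α hα Hα hH
    refine finish_lemma u _ (fun x => stdGaussCDF (Hα - x))
      (Phi_cont.comp (continuous_const.sub continuous_id)) ?_ ?_ hupos ?_
    · refine Phi_bot.comp ?_
      exact tendsto_const_nhds.add_atBot tendsto_neg_atTop_atBot
    · exact fun n => le_minimaxTypeII hα.1 fun ψ hψ _ => typeIImax_nonneg _ hψ
    · intro u₀ hu₀ ε hε
      obtain ⟨η, hη, hev⟩ := hcore u₀ hu₀ (Real.exp (u₀ * Hα - u₀ ^ 2 / 2)) (Real.exp_pos _) ε hε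
      refine ⟨η, hη, hev.mono fun n hn hun => le_minimaxTypeII hα.1 fun ψ hψ hψα => ?_⟩
      have h1 := hn hun ψ hψ
      rw [G_eq hu₀, hH] at h1
      have h2 := mul_le_mul_of_nonneg_left hψα (Real.exp_pos (u₀ * Hα - u₀ ^ 2 / 2)).le
      have h3 : 1 - (1 - α) = α := by ring
      rw [h3] at h1
      linarith
  · refine finish_lemma u _ (fun x => 2 * stdGaussCDF (-x / 2))
      (continuous_const.mul (Phi_cont.comp (by fun_prop))) ?_ ?_ hupos ?_
    · have h : Tendsto (fun x : ℝ => -x / 2) atTop atBot :=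
        tendsto_neg_atTop_atBot.atBot_div_const (by norm_num)
      simpa using (Phi_bot.comp h).const_mul 2
    · exact fun n => le_minimaxTotal fun ψ hψ =>
        add_nonneg (typeI_nonneg hψ) (typeIImax_nonneg _ hψ)
    · intro u₀ hu₀ ε hε
      obtain ⟨η, hη, hev⟩ := hcore u₀ hu₀ 1 one_pos ε hε
      refine ⟨η, hη, hev.mono fun n hn hun => le_minimaxTotal fun ψ hψ => ?_⟩
      have h1 := hn hun ψ hψ
      rw [G_one hu₀, one_mul] at h1
      exact h1
end

section
/- Let t_1,…,t_n be i.i.d. uniform on Δ and R = (r_{jl})_{j,l∈𝓝} with r_{jl} = (1/n)Σ_{i=1}^n φ_j(t_i)φ_l(t_i). If Σ_{l∈𝓝} φ_l²(t) = N for all t ∈ Δ and N = N_n = o(n), then E Tr((R − I_N)²) ≤ N²/n = o(N), E Tr(R²) ∼ N, and E Tr(R⁴) ∼ N (indeed E Tr(R⁴) = N(1 + O(N/n + (N/n)² + (N/n)³))). (Lemma 7.2, part (2).) -/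
open MeasureTheory Filter
open scoped BigOperators Topology

noncomputable section

/-- The empirical correlation matrix R = (r_{jl}),
r_{jl} = (1/n) Σ_{i=1}^n φ_j(t_i) φ_l(t_i). -/
def empR {d : ℕ} {ι : Type*} [Fintype ι] (φ : ι → (Fin d → ℝ) → ℝ)
    (n : ℕ) (t : Fin n → (Fin d → ℝ)) : Matrix ι ι ℝ :=
  Matrix.of fun j l => (1 / (n : ℝ)) * ∑ i, φ j (t i) * φ l (t i)

namespace Aux9

variable {X : Type*} [MeasurableSpace X]

/-- resampling one coordinate preserves the product measure -/
lemma map_update (μ : Measure X) [IsProbabilityMeasure μ] {n : ℕ} (j : Fin n) :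
    ((Measure.pi fun _ : Fin n => μ).prod μ).map
      (fun p : (Fin n → X) × X => Function.update p.1 j p.2) = Measure.pi fun _ : Fin n => μ := by
  symm
  apply Measure.pi_eq
  intro s hs
  rw [Measure.map_apply measurable_update' (MeasurableSet.univ_pi hs)]
  have : (fun p : (Fin n → X) × X => Function.update p.1 j p.2) ⁻¹' (Set.univ.pi s)
      = (Set.univ.pi (Function.update s j Set.univ)) ×ˢ (s j) := by
    ext ⟨t, x⟩
    simp only [Set.mem_preimage, Set.mem_pi, Set.mem_univ, true_imp_iff, Set.mem_prod]
    constructor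
    · intro h
      refine ⟨fun i => ?_, by simpa using h j⟩
      by_cases hi : i = j
      · subst hi; simp
      · simpa [hi] using h i
    · rintro ⟨h1, h2⟩ i
      by_cases hi : i = j
      · subst hi; simpa using h2
      · simpa [hi] using h1 i
  rw [this, Measure.prod_prod, Measure.pi_pi, ← Finset.mul_prod_erase _ _ (Finset.mem_univ j),
    ← Finset.mul_prod_erase Finset.univ (fun i => μ (s i)) (Finset.mem_univ j)]
  simp only [Function.update_self, measure_univ, one_mul]
  rw [mul_comm]
  congr 1
  apply Finset.prod_congr rfl
  intro i hi
  rw [Function.update_of_ne (Finset.ne_of_mem_erase hi)]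

lemma integral_update (μ : Measure X) [IsProbabilityMeasure μ] {n : ℕ} (j : Fin n)
    (F : (Fin n → X) → ℝ) (hF : Measurable F) (C : ℝ) (hC : ∀ t, |F t| ≤ C) :
    ∫ t, F t ∂(Measure.pi fun _ : Fin n => μ)
      = ∫ t, ∫ x, F (Function.update t j x) ∂μ ∂(Measure.pi fun _ : Fin n => μ) := by
  conv_lhs => rw [← map_update μ j]
  rw [integral_map measurable_update'.aemeasurable hF.aestronglyMeasurable, integral_prod]
  exact Integrable.of_bound (hF.comp measurable_update').aestronglyMeasurable C
    (ae_of_all _ fun p => hC _)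

/-- the standing hypotheses, for a single `n` -/
structure Core {ι : Type*} [Fintype ι] [DecidableEq ι] (μ : Measure X) (ψ : ι → X → ℝ) (N : ℝ) :
    Prop where
  prob : IsProbabilityMeasure μ
  meas : ∀ l, Measurable (ψ l)
  on : ∀ j l, ∫ t, ψ j t * ψ l t ∂μ = if j = l then (1 : ℝ) else 0
  card : N = Fintype.card ι
  sumsq : ∀ t, ∑ l, (ψ l t) ^ 2 = N

def ker {ι : Type*} [Fintype ι] (ψ : ι → X → ℝ) (s t : X) : ℝ := ∑ l, ψ l s * ψ l t

variable {ι : Type*} [Fintype ι] [DecidableEq ι] {μ : Measure X} {ψ : ι → X → ℝ} {N : ℝ}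

omit [MeasurableSpace X] [DecidableEq ι] in
lemma ker_comm (s t : X) : ker ψ s t = ker ψ t s := by
  simp only [ker, mul_comm]

namespace Core

variable (h : Core μ ψ N)
include h

lemma N0 : 0 ≤ N := by rw [h.card]; positivity

lemma ker_self (t : X) : ker ψ t t = N := by
  rw [← h.sumsq t]; simp only [ker, pow_two]

lemma ker_abs (s t : X) : |ker ψ s t| ≤ N := by
  have := Finset.sum_mul_sq_le_sq_mul_sq Finset.univ (fun l => ψ l s) (fun l => ψ l t)
  rw [h.sumsq, h.sumsq] at this
  exact abs_le_of_sq_le_sq (by simpa [ker, ← pow_two] using this) h.N0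

lemma psi_abs (l : ι) (t : X) : |ψ l t| ≤ N := by
  have h1 : (ψ l t) ^ 2 ≤ N := by
    rw [← h.sumsq t]
    exact Finset.single_le_sum (f := fun l => (ψ l t) ^ 2) (fun _ _ => sq_nonneg _)
      (Finset.mem_univ l)
  have h2 : (1 : ℝ) ≤ N := by
    rw [h.card]
    exact_mod_cast Fintype.card_pos_iff.mpr ⟨l⟩
  apply abs_le_of_sq_le_sq _ h.N0
  nlinarith

lemma ker_meas : Measurable (fun p : X × X => ker ψ p.1 p.2) := by
  unfold ker
  have := h.meas
  fun_prop

lemma int_psi (j l : ι) : Integrable (fun t => ψ j t * ψ l t) μ := by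
  have := h.prob
  refine Integrable.of_bound ((h.meas j).mul (h.meas l)).aestronglyMeasurable (N * N)
    (ae_of_all _ fun t => ?_)
  rw [Real.norm_eq_abs, abs_mul]
  exact mul_le_mul (h.psi_abs _ _) (h.psi_abs _ _) (abs_nonneg _) h.N0

lemma repro (s t : X) : ∫ x, ker ψ s x * ker ψ x t ∂μ = ker ψ s t := by
  have : ∀ x, ker ψ s x * ker ψ x t = ∑ j, ∑ l, (ψ j s * ψ l t) * (ψ j x * ψ l x) := by
    intro x
    simp only [ker, Finset.sum_mul_sum]
    exact Finset.sum_congr rfl fun _ _ => Finset.sum_congr rfl fun _ _ => by ring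
  simp_rw [this]
  rw [integral_finsetSum _ (fun j _ => integrable_finsetSum _ fun l _ =>
    (h.int_psi j l).const_mul _)]
  simp_rw [integral_finsetSum _ (fun l _ => (h.int_psi _ l).const_mul _), integral_const_mul, h.on]
  simp [ker]

lemma G_meas {n : ℕ} (i j : Fin n) : Measurable (fun t : Fin n → X => ker ψ (t i) (t j)) :=
  h.ker_meas.comp (by fun_prop : Measurable fun t : Fin n → X => (t i, t j))

/-- integrating out the coordinate `j` -/
lemma out {n : ℕ} (a b j : Fin n) (ha : a ≠ j) (hb : b ≠ j) (H : (Fin n → X) → ℝ)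
    (hH : Measurable H) (C : ℝ) (hC : ∀ t, |H t| ≤ C)
    (hu : ∀ t x, H (Function.update t j x) = H t) :
    ∫ t, ker ψ (t a) (t j) * ker ψ (t j) (t b) * H t ∂(Measure.pi fun _ : Fin n => μ)
      = ∫ t, ker ψ (t a) (t b) * H t ∂(Measure.pi fun _ : Fin n => μ) := by
  have := h.prob
  rw [integral_update μ j (fun t => ker ψ (t a) (t j) * ker ψ (t j) (t b) * H t) (((h.G_meas a j).mul (h.G_meas j b)).mul hH) (N * N * C)]
  · congr 1
    ext t
    simp only [hu, Function.update_self, Function.update_of_ne ha, Function.update_of_ne hb]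
    rw [integral_mul_const, h.repro]
  · intro t
    rw [abs_mul, abs_mul]
    have := h.N0
    have := h.ker_abs (t a) (t j)
    have := h.ker_abs (t j) (t b)
    have := hC t
    gcongr

lemma G_int {n : ℕ} (H : (Fin n → X) → ℝ) (hH : Measurable H) (C : ℝ) (hC : ∀ t, |H t| ≤ C) :
    Integrable H (Measure.pi fun _ : Fin n => μ) := by
  have := h.prob
  exact Integrable.of_bound hH.aestronglyMeasurable C (ae_of_all _ hC)

lemma T2 {n : ℕ} (i j : Fin n) :
    ∫ t, ker ψ (t i) (t j) * ker ψ (t j) (t i) ∂(Measure.pi fun _ : Fin n => μ)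
      ≤ N * (1 + if j = i then N else 0) := by
  have := h.prob
  have h0 := h.N0
  by_cases hij : j = i
  · subst hij
    simp only [h.ker_self]
    simp
    nlinarith
  · have := h.out i i j (Ne.symm hij) (Ne.symm hij) (fun _ => 1) measurable_const 1 (by simp)
      (by simp)
    simp only [mul_one] at this
    rw [this]
    simp [h.ker_self, hij]

lemma T3 {n : ℕ} (i j k : Fin n) :
    ∫ t, ker ψ (t i) (t j) * ker ψ (t j) (t k) * ker ψ (t k) (t i)
      ∂(Measure.pi fun _ : Fin n => μ)
      ≤ N * (1 + if j = i then N else 0) *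
        (1 + (if k = i then N else 0) + (if k = j then N else 0)) := by
  have := h.prob
  have h0 := h.N0
  have h2 := h.T2 i j
  have hp : 0 ≤ N * (1 + if j = i then N else 0) := by split_ifs <;> positivity
  by_cases hki : k = i
  · subst hki
    simp only [h.ker_self, integral_mul_const]
    refine (mul_le_mul_of_nonneg_right h2 h0).trans (mul_le_mul_of_nonneg_left ?_ hp)
    split_ifs <;> linarith
  by_cases hkj : k = j
  · subst hkj
    simp only [h.ker_self, mul_right_comm _ N, integral_mul_const]
    refine (mul_le_mul_of_nonneg_right h2 h0).trans (mul_le_mul_of_nonneg_left ?_ hp)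
    split_ifs <;> linarith
  have := h.out j i k (Ne.symm hkj) (Ne.symm hki) (fun t => ker ψ (t i) (t j)) (h.G_meas i j) N
    (fun t => h.ker_abs _ _)
    (fun t x => by simp only [Function.update_of_ne (Ne.symm hkj),
      Function.update_of_ne (Ne.symm hki)])
  calc _ = ∫ t, ker ψ (t j) (t k) * ker ψ (t k) (t i) * ker ψ (t i) (t j)
      ∂(Measure.pi fun _ : Fin n => μ) := by congr 1; ext t; ring
    _ = ∫ t, ker ψ (t i) (t j) * ker ψ (t j) (t i) ∂(Measure.pi fun _ : Fin n => μ) := by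
      rw [this]; congr 1; ext t; ring
    _ ≤ _ := by simpa [hki, hkj] using h2

lemma T4 {n : ℕ} (i j k l : Fin n) :
    ∫ t, ker ψ (t i) (t j) * ker ψ (t j) (t k) * ker ψ (t k) (t l) * ker ψ (t l) (t i)
      ∂(Measure.pi fun _ : Fin n => μ)
      ≤ N * (1 + if j = i then N else 0) *
        (1 + (if k = i then N else 0) + (if k = j then N else 0)) *
        (1 + (if l = i then N else 0) + (if l = j then N else 0) + (if l = k then N else 0)) := by
  have := h.prob
  have h0 := h.N0
  have h2 := h.T2 i j
  have h3 := h.T3 i j k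
  have hp2 : 0 ≤ N * (1 + if j = i then N else 0) := by split_ifs <;> positivity
  have hp : 0 ≤ N * (1 + if j = i then N else 0) *
        (1 + (if k = i then N else 0) + (if k = j then N else 0)) := by
    split_ifs <;> positivity
  by_cases hli : l = i
  · subst hli
    simp only [h.ker_self, integral_mul_const]
    refine (mul_le_mul_of_nonneg_right h3 h0).trans (mul_le_mul_of_nonneg_left ?_ hp)
    split_ifs <;> linarith
  by_cases hlk : l = k
  · subst hlk
    simp only [h.ker_self, mul_right_comm _ N, integral_mul_const]
    refine (mul_le_mul_of_nonneg_right h3 h0).trans (mul_le_mul_of_nonneg_left ?_ hp)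
    split_ifs <;> linarith
  by_cases hlj : l = j
  · subst hlj
    suffices hs : ∫ t, ker ψ (t i) (t l) * ker ψ (t l) (t k) * ker ψ (t k) (t l) * ker ψ (t l) (t i)
      ∂(Measure.pi fun _ : Fin n => μ) ≤ (N * (1 + if l = i then N else 0) *
        (1 + (if k = i then N else 0) + (if k = l then N else 0))) * N by
      refine hs.trans (mul_le_mul_of_nonneg_left ?_ hp)
      rw [if_neg hli, if_neg hlk, if_pos (rfl : l = l)]
      linarith
    by_cases hk : k = i ∨ k = l
    · -- crude bound
      calc _ ≤ ∫ t, (ker ψ (t i) (t l) * ker ψ (t l) (t i)) * (N * N)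
            ∂(Measure.pi fun _ : Fin n => μ) := by
            apply integral_mono
            · refine h.G_int _ ((((h.G_meas _ _).mul (h.G_meas _ _)).mul (h.G_meas _ _)).mul
                (h.G_meas _ _)) (N * N * N * N) fun t => ?_
              simp only [abs_mul]
              have := h.ker_abs
              gcongr <;> apply this
            · refine h.G_int _ (((h.G_meas _ _).mul (h.G_meas _ _)).mul_const _) (N * N * (N * N))
                fun t => ?_
              simp only [abs_mul, abs_of_nonneg h0]
              have := h.ker_abs
              gcongr <;> apply this
            · intro t
              have e : ker ψ (t i) (t l) * ker ψ (t l) (t k) * ker ψ (t k) (t l) * ker ψ (t l) (t i)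
                = (ker ψ (t i) (t l)) ^ 2 * (ker ψ (t k) (t l)) ^ 2 := by
                rw [ker_comm (t l) (t k), ker_comm (t l) (t i)]; ring
              have e2 : ker ψ (t i) (t l) * ker ψ (t l) (t i) = (ker ψ (t i) (t l)) ^ 2 := by
                rw [ker_comm (t l) (t i)]; ring
              simp only
              rw [e, e2, ← pow_two N]
              exact mul_le_mul_of_nonneg_left (sq_le_sq' (abs_le.1 (h.ker_abs _ _)).1
                (abs_le.1 (h.ker_abs _ _)).2) (sq_nonneg _)
        _ ≤ (N * (1 + if l = i then N else 0)) * (N * N) := by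
          rw [integral_mul_const]
          exact mul_le_mul_of_nonneg_right h2 (by positivity)
        _ = (N * (1 + if l = i then N else 0)) * N * N := by ring
        _ ≤ _ := by
          refine mul_le_mul_of_nonneg_right (mul_le_mul_of_nonneg_left ?_ hp2) h0
          rcases hk with hk | hk <;> rw [if_pos hk] <;> split_ifs <;> linarith
    · push Not at hk
      obtain ⟨hki, hkl⟩ := hk
      have := h.out l l k (Ne.symm hkl) (Ne.symm hkl)
        (fun t => ker ψ (t i) (t l) * ker ψ (t l) (t i)) ((h.G_meas i l).mul (h.G_meas l i)) (N * N)
        (fun t => by rw [abs_mul]; have := h.ker_abs; gcongr <;> apply this)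
        (fun t x => by simp only [Function.update_of_ne (Ne.symm hkl),
          Function.update_of_ne (Ne.symm hki)])
      simp only [h.ker_self, integral_const_mul] at this
      calc _ = ∫ t, ker ψ (t l) (t k) * ker ψ (t k) (t l) * (ker ψ (t i) (t l) * ker ψ (t l) (t i))
            ∂(Measure.pi fun _ : Fin n => μ) := by congr 1; ext t; ring
        _ = _ := this
        _ ≤ N * (N * (1 + if l = i then N else 0)) := mul_le_mul_of_nonneg_left h2 h0
        _ = _ := by simp [hki, hkl]; ring
  have := h.out k i l (Ne.symm hlk) (Ne.symm hli)
    (fun t => ker ψ (t i) (t j) * ker ψ (t j) (t k)) ((h.G_meas i j).mul (h.G_meas j k)) (N * N)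
    (fun t => by rw [abs_mul]; have := h.ker_abs; gcongr <;> apply this)
    (fun t x => by simp only [Function.update_of_ne (Ne.symm hlk),
      Function.update_of_ne (Ne.symm hli), Function.update_of_ne (Ne.symm hlj)])
  calc _ = ∫ t, ker ψ (t k) (t l) * ker ψ (t l) (t i) * (ker ψ (t i) (t j) * ker ψ (t j) (t k))
      ∂(Measure.pi fun _ : Fin n => μ) := by congr 1; ext t; ring
    _ = ∫ t, ker ψ (t i) (t j) * ker ψ (t j) (t k) * ker ψ (t k) (t i)
        ∂(Measure.pi fun _ : Fin n => μ) := by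
      rw [this]; congr 1; ext t; ring
    _ ≤ _ := by simpa [hli, hlk, hlj] using h3

end Core

section Trace

variable {d : ℕ} {φ : ι → (Fin d → ℝ) → ℝ}

omit [DecidableEq ι] in
lemma empR_eq (n : ℕ) (t : Fin n → (Fin d → ℝ)) :
    empR φ n t = (1 / (n : ℝ)) • ((Matrix.of fun (i : Fin n) l => φ l (t i)).transpose *
      (Matrix.of fun (i : Fin n) l => φ l (t i))) := by
  ext j l
  simp [empR, Matrix.mul_apply]

omit [DecidableEq ι] in
lemma gram_eq (n : ℕ) (t : Fin n → (Fin d → ℝ)) (i j : Fin n) :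
    ((Matrix.of fun (i : Fin n) l => φ l (t i)) *
      (Matrix.of fun (i : Fin n) l => φ l (t i)).transpose) i j = ker φ (t i) (t j) := by
  simp [ker, Matrix.mul_apply]

omit [DecidableEq ι] in
lemma trace1 (n : ℕ) (t : Fin n → (Fin d → ℝ)) :
    (empR φ n t).trace = (1 / (n : ℝ)) * ∑ i, ker φ (t i) (t i) := by
  rw [empR_eq, Matrix.trace_smul, Matrix.trace_mul_comm, smul_eq_mul]
  simp only [Matrix.trace, Matrix.diag, gram_eq]

lemma trace2 (n : ℕ) (t : Fin n → (Fin d → ℝ)) :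
    ((empR φ n t) ^ 2).trace =
      (1 / (n : ℝ)) ^ 2 * ∑ i, ∑ j, ker φ (t i) (t j) * ker φ (t j) (t i) := by
  rw [empR_eq, smul_pow, Matrix.trace_smul, smul_eq_mul]
  congr 1
  set V := (Matrix.of fun (i : Fin n) l => φ l (t i)) with hV
  have : ((V.transpose * V) ^ 2).trace = ((V * V.transpose) * (V * V.transpose)).trace := by
    rw [pow_two, Matrix.mul_assoc, Matrix.trace_mul_comm]
    simp only [Matrix.mul_assoc]
  rw [this]
  simp only [Matrix.trace, Matrix.diag]
  refine Finset.sum_congr rfl fun i _ => ?_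
  rw [Matrix.mul_apply]
  simp only [hV, gram_eq]

lemma trace4 (n : ℕ) (t : Fin n → (Fin d → ℝ)) :
    ((empR φ n t) ^ 4).trace =
      (1 / (n : ℝ)) ^ 4 * ∑ i, ∑ j, ∑ k, ∑ l,
        ker φ (t i) (t j) * ker φ (t j) (t k) * ker φ (t k) (t l) * ker φ (t l) (t i) := by
  rw [empR_eq, smul_pow, Matrix.trace_smul, smul_eq_mul]
  congr 1
  set V := (Matrix.of fun (i : Fin n) l => φ l (t i)) with hV
  have : ((V.transpose * V) ^ 4).trace = ((V * V.transpose) * ((V * V.transpose) *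
      ((V * V.transpose) * (V * V.transpose)))).trace := by
    rw [show (V.transpose * V) ^ 4 = (V.transpose * V) * ((V.transpose * V) * ((V.transpose * V) *
      (V.transpose * V))) by noncomm_ring, Matrix.mul_assoc, Matrix.trace_mul_comm]
    simp only [Matrix.mul_assoc]
  rw [this]
  simp only [Matrix.trace, Matrix.diag]
  refine Finset.sum_congr rfl fun i _ => ?_
  simp only [Matrix.mul_apply (M := V * V.transpose)]
  simp only [hV, gram_eq, Finset.mul_sum, mul_assoc]

omit [DecidableEq ι] in
lemma trace_sq_nonneg (A : Matrix ι ι ℝ) (hA : A.transpose = A) : 0 ≤ (A * A).trace := by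
  simp only [Matrix.trace, Matrix.diag, Matrix.mul_apply]
  refine Finset.sum_nonneg fun i _ => Finset.sum_nonneg fun j _ => ?_
  have : A j i = A i j := congrFun (congrFun hA i) j
  rw [this]
  exact mul_self_nonneg _

omit [DecidableEq ι] in
lemma empR_symm (n : ℕ) (t : Fin n → (Fin d → ℝ)) :
    (empR φ n t).transpose = empR φ n t := by
  ext i j
  simp [empR, mul_comm]

namespace Core

variable {μ : Measure (Fin d → ℝ)} (h : Core μ φ N)
include h

lemma tr1 {n : ℕ} (hn : 1 ≤ n) (t : Fin n → (Fin d → ℝ)) : (empR φ n t).trace = N := by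
  rw [trace1]
  simp only [h.ker_self]
  have : (n : ℝ) ≠ 0 := by positivity
  simp
  field_simp

lemma trsub {n : ℕ} (hn : 1 ≤ n) (t : Fin n → (Fin d → ℝ)) :
    ((empR φ n t - 1) ^ 2).trace = ((empR φ n t) ^ 2).trace - N := by
  rw [show (empR φ n t - 1) ^ 2 = (empR φ n t) ^ 2 - (2 : ℝ) • empR φ n t + 1 by
    rw [two_smul]; noncomm_ring]
  rw [Matrix.trace_add, Matrix.trace_sub, Matrix.trace_smul, h.tr1 hn, Matrix.trace_one, ← h.card,
    smul_eq_mul]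
  ring

lemma tr2_ge {n : ℕ} (hn : 1 ≤ n) (t : Fin n → (Fin d → ℝ)) :
    N ≤ ((empR φ n t) ^ 2).trace := by
  have h1 := h.trsub hn t
  have h2 := trace_sq_nonneg (empR φ n t - 1) (by simp [empR_symm])
  rw [← pow_two] at h2
  linarith

lemma tr4_ge {n : ℕ} (hn : 1 ≤ n) (t : Fin n → (Fin d → ℝ)) :
    N ≤ ((empR φ n t) ^ 4).trace := by
  have h1 := h.tr2_ge hn t
  have h2 := trace_sq_nonneg ((empR φ n t) ^ 2 - 1) (by simp [Matrix.transpose_pow, empR_symm])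
  rw [show ((empR φ n t) ^ 2 - 1) * ((empR φ n t) ^ 2 - 1) =
    (empR φ n t) ^ 4 - (2 : ℝ) • (empR φ n t) ^ 2 + 1 by
    rw [two_smul]; noncomm_ring] at h2
  rw [Matrix.trace_add, Matrix.trace_sub, Matrix.trace_smul, Matrix.trace_one, ← h.card,
    smul_eq_mul] at h2
  linarith

lemma int2 {n : ℕ} (i j : Fin n) : Integrable (fun t : Fin n → (Fin d → ℝ) =>
    ker φ (t i) (t j) * ker φ (t j) (t i)) (Measure.pi fun _ : Fin n => μ) := by
  refine h.G_int _ ((h.G_meas _ _).mul (h.G_meas _ _)) (N * N) fun t => ?_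
  simp only [abs_mul]
  have := h.ker_abs
  have := h.N0
  gcongr <;> apply h.ker_abs

lemma int4 {n : ℕ} (i j k l : Fin n) : Integrable (fun t : Fin n → (Fin d → ℝ) =>
    ker φ (t i) (t j) * ker φ (t j) (t k) * ker φ (t k) (t l) * ker φ (t l) (t i))
    (Measure.pi fun _ : Fin n => μ) := by
  refine h.G_int _ ((((h.G_meas _ _).mul (h.G_meas _ _)).mul (h.G_meas _ _)).mul
                (h.G_meas _ _)) (N * N * N * N) fun t => ?_
  simp only [abs_mul]
  have := h.N0
  gcongr <;> apply h.ker_abs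

lemma int_tr2 (n : ℕ) : Integrable (fun t => ((empR φ n t) ^ 2).trace)
    (Measure.pi fun _ : Fin n => μ) := by
  simp only [trace2]
  exact (integrable_finsetSum _ fun i _ => integrable_finsetSum _ fun j _ => h.int2 i j).const_mul _

lemma int_tr4 (n : ℕ) : Integrable (fun t => ((empR φ n t) ^ 4).trace)
    (Measure.pi fun _ : Fin n => μ) := by
  simp only [trace4]
  exact (integrable_finsetSum _ fun i _ => integrable_finsetSum _ fun j _ =>
    integrable_finsetSum _ fun k _ => integrable_finsetSum _ fun l _ => h.int4 i j k l).const_mul _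

lemma E2_ge {n : ℕ} (hn : 1 ≤ n) :
    N ≤ ∫ t, ((empR φ n t) ^ 2).trace ∂(Measure.pi fun _ : Fin n => μ) := by
  have := h.prob
  have := integral_mono (integrable_const N) (h.int_tr2 n) (fun t => h.tr2_ge hn t)
  simpa using this

lemma E4_ge {n : ℕ} (hn : 1 ≤ n) :
    N ≤ ∫ t, ((empR φ n t) ^ 4).trace ∂(Measure.pi fun _ : Fin n => μ) := by
  have := h.prob
  have := integral_mono (integrable_const N) (h.int_tr4 n) (fun t => h.tr4_ge hn t)
  simpa using this

lemma E2_le {n : ℕ} (hn : 1 ≤ n) :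
    ∫ t, ((empR φ n t) ^ 2).trace ∂(Measure.pi fun _ : Fin n => μ) ≤ N * (1 + N / n) := by
  have hn0 : (n : ℝ) ≠ 0 := by positivity
  simp only [trace2]
  rw [integral_const_mul, integral_finsetSum _ fun i _ => integrable_finsetSum _ fun j _ =>
    h.int2 i j]
  simp_rw [integral_finsetSum _ fun j _ => h.int2 _ j]
  calc _ ≤ (1 / (n : ℝ)) ^ 2 * ∑ i : Fin n, ∑ j : Fin n, N * (1 + if j = i then N else 0) := by
        gcongr with i _ j _
        exact h.T2 i j
    _ = _ := by
      simp only [← Finset.mul_sum, Finset.sum_add_distrib, Finset.sum_ite_eq', Finset.mem_univ,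
        if_true, Finset.sum_const, Finset.card_univ, Fintype.card_fin, nsmul_eq_mul]
      field_simp

lemma E4_le {n : ℕ} (hn : 1 ≤ n) :
    ∫ t, ((empR φ n t) ^ 4).trace ∂(Measure.pi fun _ : Fin n => μ) ≤
      N * ((1 + N / n) * (1 + 2 * (N / n)) * (1 + 3 * (N / n))) := by
  have hn0 : (n : ℝ) ≠ 0 := by positivity
  simp only [trace4]
  rw [integral_const_mul, integral_finsetSum _ fun i _ => integrable_finsetSum _ fun j _ =>
    integrable_finsetSum _ fun k _ => integrable_finsetSum _ fun l _ => h.int4 i j k l]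
  simp_rw [integral_finsetSum _ fun j _ =>
    integrable_finsetSum _ fun k _ => integrable_finsetSum _ fun l _ => h.int4 _ j k l]
  simp_rw [integral_finsetSum _ fun k _ => integrable_finsetSum _ fun l _ => h.int4 _ _ k l]
  simp_rw [integral_finsetSum _ fun l _ => h.int4 _ _ _ l]
  calc _ ≤ (1 / (n : ℝ)) ^ 4 * ∑ i : Fin n, ∑ j : Fin n, ∑ k : Fin n, ∑ l : Fin n,
        N * (1 + if j = i then N else 0) *
        (1 + (if k = i then N else 0) + (if k = j then N else 0)) *
        (1 + (if l = i then N else 0) + (if l = j then N else 0) + (if l = k then N else 0)) := by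
        gcongr with i _ j _ k _ l _
        exact h.T4 i j k l
    _ = (1 / (n : ℝ)) ^ 4 * (n * (N * (n + N) * (n + N + N) * (n + N + N + N))) := by
      simp only [← Finset.mul_sum, ← Finset.sum_mul, Finset.sum_add_distrib, Finset.sum_ite_eq',
        Finset.mem_univ,
        if_true, Finset.sum_const, Finset.card_univ, Fintype.card_fin, nsmul_eq_mul, mul_one]
      ring
    _ = _ := by
      field_simp
      ring

end Core

end Trace

open Classical in
/-- modification of a function outside the cube -/
def ext0 {d : ℕ} (f : (Fin d → ℝ) → ℝ) (t : Fin d → ℝ) : ℝ :=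
  if t ∈ Set.Icc (0 : Fin d → ℝ) 1 then f t else f 0

lemma ext0_of_mem {d : ℕ} (f : (Fin d → ℝ) → ℝ) {t : Fin d → ℝ}
    (ht : t ∈ Set.Icc (0 : Fin d → ℝ) 1) : ext0 f t = f t := if_pos ht

lemma prob_cube (d : ℕ) : IsProbabilityMeasure (uniformCube d) := by
  refine ⟨?_⟩
  rw [uniformCube, Measure.restrict_apply_univ, Real.volume_Icc_pi]
  simp

lemma ae_cube (d : ℕ) : ∀ᵐ t ∂(uniformCube d), t ∈ Set.Icc (0 : Fin d → ℝ) 1 :=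
  ae_restrict_mem measurableSet_Icc

lemma core_ext0 {d : ℕ} (φ : ι → (Fin d → ℝ) → ℝ) (hmeas : ∀ l, Measurable (φ l))
    (hON : ∀ (j l : ι), ∫ t, φ j t * φ l t ∂(uniformCube d) = if j = l then (1 : ℝ) else 0)
    (N : ℕ) (hcard : (N : ℝ) = Fintype.card ι)
    (hA2 : ∀ t ∈ Set.Icc (0 : Fin d → ℝ) 1, ∑ l, (φ l t) ^ 2 = (N : ℝ)) :
    Core (uniformCube d) (fun l => ext0 (φ l)) (N : ℝ) where
  prob := prob_cube d
  meas l := Measurable.ite measurableSet_Icc (hmeas l) measurable_const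
  on j l := by
    rw [← hON j l]
    apply integral_congr_ae
    filter_upwards [ae_cube d] with t ht
    rw [ext0_of_mem _ ht, ext0_of_mem _ ht]
  card := hcard
  sumsq t := by
    by_cases ht : t ∈ Set.Icc (0 : Fin d → ℝ) 1
    · simp only [ext0_of_mem _ ht]
      exact hA2 t ht
    · simp only [ext0, if_neg ht]
      exact hA2 0 ⟨le_refl _, zero_le_one⟩

omit [DecidableEq ι] in
lemma transfer {d : ℕ} (φ : ι → (Fin d → ℝ) → ℝ) (n : ℕ) (F : Matrix ι ι ℝ → ℝ) :
    ∫ t, F (empR φ n t) ∂(Measure.pi fun _ : Fin n => uniformCube d)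
      = ∫ t, F (empR (fun l => ext0 (φ l)) n t)
        ∂(Measure.pi fun _ : Fin n => uniformCube d) := by
  have := prob_cube d
  apply integral_congr_ae
  have hae : ∀ᵐ t ∂(Measure.pi fun _ : Fin n => uniformCube d),
      ∀ i, t i ∈ Set.Icc (0 : Fin d → ℝ) 1 := by
    rw [eventually_all]
    intro i
    exact (measurePreserving_eval (fun _ : Fin n => uniformCube d) i).quasiMeasurePreserving.ae
      (ae_cube d)
  filter_upwards [hae] with t ht
  congr 1
  ext j l
  simp only [empR, Matrix.of_apply]
  congr 1
  refine Finset.sum_congr rfl fun i _ => ?_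
  rw [ext0_of_mem _ (ht i), ext0_of_mem _ (ht i)]

end Aux9

/- STATEMENT 9 (Lemma 7.2, part (2)): if Σ_{l∈𝓝} φ_l²(t) = N on Δ and
N = N_n = o(n), then E Tr((R−I)²) ≤ N²/n = o(N), E Tr(R²) ∼ N and
E Tr(R⁴) ∼ N, indeed E Tr(R⁴) = N(1 + O(N/n + (N/n)² + (N/n)³)). -/
theorem stmt9 {d : ℕ} {ι : ℕ → Type*} [∀ n, Fintype (ι n)] [∀ n, DecidableEq (ι n)]
    (φ : ∀ n, ι n → (Fin d → ℝ) → ℝ)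
    (hmeas : ∀ n l, Measurable (φ n l))
    (hON : ∀ n (j l : ι n),
      ∫ t, φ n j t * φ n l t ∂(uniformCube d) = if j = l then (1 : ℝ) else 0)
    (N : ℕ → ℕ) (hNcard : ∀ n, N n = Fintype.card (ι n)) (hNpos : ∀ n, 0 < N n)
    (hA2 : ∀ n, ∀ t ∈ Set.Icc (0 : Fin d → ℝ) 1, ∑ l, (φ n l t) ^ 2 = (N n : ℝ))
    (hB1 : Tendsto (fun n => (N n : ℝ) / n) atTop (𝓝 0)) :
    (∀ n, 1 ≤ n →
      (∫ t, Matrix.trace ((empR (φ n) n t - 1) ^ 2)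
          ∂(Measure.pi fun _ : Fin n => uniformCube d)) ≤ (N n : ℝ) ^ 2 / n) ∧
    Tendsto (fun n =>
      (∫ t, Matrix.trace ((empR (φ n) n t - 1) ^ 2)
          ∂(Measure.pi fun _ : Fin n => uniformCube d)) / (N n : ℝ)) atTop (𝓝 0) ∧
    Tendsto (fun n =>
      (∫ t, Matrix.trace ((empR (φ n) n t) ^ 2)
          ∂(Measure.pi fun _ : Fin n => uniformCube d)) / (N n : ℝ)) atTop (𝓝 1) ∧
    Tendsto (fun n =>
      (∫ t, Matrix.trace ((empR (φ n) n t) ^ 4)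
          ∂(Measure.pi fun _ : Fin n => uniformCube d)) / (N n : ℝ)) atTop (𝓝 1) ∧
    ∃ K > (0 : ℝ), ∀ᶠ n in atTop,
      |(∫ t, Matrix.trace ((empR (φ n) n t) ^ 4)
          ∂(Measure.pi fun _ : Fin n => uniformCube d)) - (N n : ℝ)| ≤
        K * (N n : ℝ) * ((N n : ℝ) / n + ((N n : ℝ) / n) ^ 2 + ((N n : ℝ) / n) ^ 3) := by
  classical
  -- pass to functions satisfying the hypotheses everywhere
  let ψ : ∀ n, ι n → (Fin d → ℝ) → ℝ := fun n l => Aux9.ext0 (φ n l)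
  have hC : ∀ n, Aux9.Core (uniformCube d) (ψ n) (N n : ℝ) := fun n =>
    Aux9.core_ext0 (φ n) (hmeas n) (hON n) (N n) (by rw [hNcard]) (hA2 n)
  have hT : ∀ n (F : Matrix (ι n) (ι n) ℝ → ℝ),
      ∫ t, F (empR (φ n) n t) ∂(Measure.pi fun _ : Fin n => uniformCube d)
        = ∫ t, F (empR (ψ n) n t) ∂(Measure.pi fun _ : Fin n => uniformCube d) := fun n F =>
    Aux9.transfer (φ n) n F
  have hT1 := fun n => hT n (fun A => Matrix.trace ((A - 1) ^ 2))
  have hT2 := fun n => hT n (fun A => Matrix.trace (A ^ 2))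
  have hT4 := fun n => hT n (fun A => Matrix.trace (A ^ 4))
  simp only [hT1, hT2, hT4]
  have hN : ∀ n, (0 : ℝ) < N n := fun n => by exact_mod_cast hNpos n
  have hE1 : ∀ n, 1 ≤ n → (∫ t, Matrix.trace ((empR (ψ n) n t - 1) ^ 2)
        ∂(Measure.pi fun _ : Fin n => uniformCube d)) =
      (∫ t, Matrix.trace ((empR (ψ n) n t) ^ 2)
        ∂(Measure.pi fun _ : Fin n => uniformCube d)) - (N n : ℝ) := by
    intro n hn
    have := (hC n).prob
    simp only [(hC n).trsub hn]
    rw [integral_sub ((hC n).int_tr2 n) (integrable_const _)]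
    simp
  have hev : ∀ᶠ n : ℕ in atTop, 1 ≤ n := eventually_ge_atTop 1
  have hx : ∀ n, 0 ≤ (N n : ℝ) / n := fun n => by positivity
  refine ⟨fun n hn => ?_, ?_, ?_, ?_, 11, by norm_num, ?_⟩
  · rw [hE1 n hn]
    have := (hC n).E2_le hn
    have e : (N n : ℝ) * (1 + N n / n) = N n + (N n : ℝ) ^ 2 / n := by ring
    linarith
  · refine tendsto_of_tendsto_of_tendsto_of_le_of_le' tendsto_const_nhds hB1 ?_ ?_
    · filter_upwards [hev] with n hn
      rw [hE1 n hn]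
      have := (hC n).E2_ge hn
      have := hN n
      apply div_nonneg <;> linarith
    · filter_upwards [hev] with n hn
      rw [hE1 n hn, div_le_iff₀ (hN n)]
      have := (hC n).E2_le hn
      linarith
  · have hlim : Tendsto (fun n => 1 + (N n : ℝ) / n) atTop (𝓝 1) := by
      simpa using hB1.const_add 1
    refine tendsto_of_tendsto_of_tendsto_of_le_of_le' tendsto_const_nhds hlim ?_ ?_
    · filter_upwards [hev] with n hn
      rw [le_div_iff₀ (hN n), one_mul]
      exact (hC n).E2_ge hn
    · filter_upwards [hev] with n hn
      rw [div_le_iff₀ (hN n), mul_comm]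
      exact (hC n).E2_le hn
  · have hlim : Tendsto (fun n => (1 + (N n : ℝ) / n) * (1 + 2 * ((N n : ℝ) / n)) *
        (1 + 3 * ((N n : ℝ) / n))) atTop (𝓝 1) := by
      have := ((hB1.const_add 1).mul ((hB1.const_mul 2).const_add 1)).mul
        ((hB1.const_mul 3).const_add 1)
      simpa using this
    refine tendsto_of_tendsto_of_tendsto_of_le_of_le' tendsto_const_nhds hlim ?_ ?_
    · filter_upwards [hev] with n hn
      rw [le_div_iff₀ (hN n), one_mul]
      exact (hC n).E4_ge hn
    · filter_upwards [hev] with n hn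
      rw [div_le_iff₀ (hN n), mul_comm]
      exact (hC n).E4_le hn
  · filter_upwards [hev] with n hn
    have h1 := (hC n).E4_ge hn
    have h2 := (hC n).E4_le hn
    rw [abs_of_nonneg (by linarith)]
    have hxn := hx n
    have hNn := hN n
    generalize (N n : ℝ) / n = x at *
    have h3 : (1 + x) * (1 + 2 * x) * (1 + 3 * x) ≤ 1 + 11 * (x + x ^ 2 + x ^ 3) := by
      have : 0 ≤ x ^ 3 := by positivity
      nlinarith
    have h4 := mul_le_mul_of_nonneg_left h3 hNn.le
    linarith
end
end
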